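/- There are no rational numbers x and z satisfying x^5 + 11x^4 + 64 = 3z^2. -/

import Mathlib

open Polynomial NumberField

namespace QuinticDescent

/-- The quintic `X ^ 5 + 44 X - 16`, over any commutative ring. -/
noncomputable def quintic (R : Type*) [CommRing R] : R[X] := X ^ 5 + (C 44 * X - C 16)

section quintic
variable (R : Type*) [CommRing R]

theorem quintic_map {S : Type*} [CommRing S] (φ : R →+* S) :
    (quintic R).map φ = quintic S := by
  rw [quintic, quintic, ← map_ofNat φ 44, ← map_ofNat φ 16]
  simp only [Polynomial.map_add, Polynomial.map_sub, Polynomial.map_mul, Polynomial.map_pow, map_X,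
    map_C]

theorem quintic_tail_degree : (C 44 * X - C 16 : R[X]).degree < (5 : ℕ) := by
  refine lt_of_le_of_lt (b := (1 : WithBot ℕ)) ?_ (by norm_num)
  compute_degree

theorem quintic_monic : (quintic R).Monic := monic_X_pow_add (quintic_tail_degree R)

variable [Nontrivial R]

theorem quintic_natDegree : (quintic R).natDegree = 5 :=
  natDegree_eq_of_degree_eq_some (by
    rw [quintic, degree_add_eq_left_of_degree_lt] <;> rw [degree_X_pow]
    exact quintic_tail_degree R)

theorem quintic_ne_one : quintic R ≠ 1 := fun h => by
  have := quintic_natDegree R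
  simp [h] at this

end quintic

theorem quintic_eval₂_eq {S T : Type*} [CommRing S] [CommRing T] (φ : S →+* T) (x : T) :
    (quintic S).eval₂ φ x = x ^ 5 + 44 * x - 16 := by
  simp only [quintic, eval₂_add, eval₂_sub, eval₂_mul, eval₂_pow, eval₂_X]
  rw [eval₂_C, eval₂_C, map_ofNat, map_ofNat]
  ring

theorem quintic_eval₂ {S T : Type*} [CommRing S] [CommRing T] (φ : S →+* T) (x : T)
    (h : (quintic S).eval₂ φ x = 0) : x ^ 5 = 16 - 44 * x := by
  rw [quintic_eval₂_eq] at h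
  linear_combination h

/-- A linear factor of the quintic gives a root. -/
theorem root_of_dvd {k : Type*} [Field k] {q : k[X]} (hq : q.Monic) (hd : q.natDegree = 1)
    (hdvd : q ∣ quintic k) : (-q.coeff 0) ^ 5 + 44 * (-q.coeff 0) - 16 = 0 := by
  have hq1 : q = X + C (q.coeff 0) := by
    conv_lhs => rw [q.as_sum_range' 2 (by omega)]
    have : q.coeff 1 = 1 := by rw [← hd]; exact hq
    simp [Finset.sum_range_succ, this, ← C_mul_X_pow_eq_monomial, add_comm]
  have : (quintic k).IsRoot (-q.coeff 0) := by
    rw [← dvd_iff_isRoot, C_neg, sub_neg_eq_add, ← hq1]; exact hdvd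
  simp [IsRoot, quintic] at this
  linear_combination this

/-- For a quadratic factor `X ^ 2 + u X + v` of the quintic, the remainder of the division
vanishes. -/
theorem remainder_of_dvd {k : Type*} [Field k] {q : k[X]} (hq : q.Monic) (hd : q.natDegree = 2)
    (hdvd : q ∣ quintic k) : ∃ u v : k, u ^ 4 - 3 * u ^ 2 * v + v ^ 2 + 44 = 0 ∧
      u ^ 3 * v - 2 * u * v ^ 2 - 16 = 0 := by
  have hq1 : q = X ^ 2 + C (q.coeff 1) * X + C (q.coeff 0) := by
    conv_lhs => rw [q.as_sum_range' 3 (by omega)]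
    have : q.coeff 2 = 1 := by rw [← hd]; exact hq
    simp [Finset.sum_range_succ, this, ← C_mul_X_pow_eq_monomial]
    ring
  set u := q.coeff 1
  set v := q.coeff 0
  have key : quintic k = q * (X ^ 3 - C u * X ^ 2 + C (u ^ 2 - v) * X - C (u ^ 3 - 2 * u * v)) +
      (C (u ^ 4 - 3 * u ^ 2 * v + v ^ 2 + 44) * X + C (u ^ 3 * v - 2 * u * v ^ 2 - 16)) := by
    rw [hq1, quintic]
    simp only [C_sub, C_add, C_mul, C_pow, map_ofNat]
    ring
  have hdvd' : q ∣ C (u ^ 4 - 3 * u ^ 2 * v + v ^ 2 + 44) * X +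
      C (u ^ 3 * v - 2 * u * v ^ 2 - 16) := by
    rw [key] at hdvd
    exact (dvd_add_right (dvd_mul_right _ _)).1 hdvd
  have h0 := eq_zero_of_dvd_of_degree_lt hdvd' (by
    rw [degree_eq_natDegree hq.ne_zero, hd]
    exact degree_linear_le.trans_lt (by norm_num))
  have h3 := congrArg (coeff · 1) h0
  have h4 := congrArg (coeff · 0) h0
  simp only [coeff_add, coeff_C_mul, coeff_X_one, coeff_C_succ, coeff_X_zero, coeff_C_zero,
    coeff_zero, mul_one, mul_zero, add_zero, zero_add] at h3 h4
  exact ⟨u, v, h3, h4⟩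

theorem no_root_zmod {p : ℕ} (hp : p = 3 ∨ p = 5 ∨ p = 7 ∨ p = 11) (r : ZMod p) :
    r ^ 5 + 44 * r - 16 ≠ 0 := by
  revert r
  rcases hp with rfl | rfl | rfl | rfl <;> decide +kernel

theorem no_remainder_zmod {p : ℕ} (hp : p = 3 ∨ p = 5 ∨ p = 7 ∨ p = 11 ∨ p = 13) (u v : ZMod p) :
    ¬ (u ^ 4 - 3 * u ^ 2 * v + v ^ 2 + 44 = 0 ∧ u ^ 3 * v - 2 * u * v ^ 2 - 16 = 0) := by
  revert u v
  rcases hp with rfl | rfl | rfl | rfl | rfl <;> decide +kernel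

theorem quintic_irreducible_zmod {p : ℕ} [Fact p.Prime] (hp : p = 3 ∨ p = 5 ∨ p = 7 ∨ p = 11) :
    Irreducible (quintic (ZMod p)) := by
  rw [(quintic_monic _).irreducible_iff_lt_natDegree_lt (quintic_ne_one _)]
  intro q hq hdeg hdvd
  rw [quintic_natDegree, Finset.mem_Ioc] at hdeg
  obtain hd | hd : q.natDegree = 1 ∨ q.natDegree = 2 := by omega
  · exact no_root_zmod hp _ (root_of_dvd hq hd hdvd)
  · obtain ⟨u, v, h⟩ := remainder_of_dvd hq hd hdvd
    exact no_remainder_zmod (by tauto) u v h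

theorem quintic_irreducible_rat : Irreducible (quintic ℚ) := by
  rw [← quintic_map ℤ (Int.castRingHom ℚ)]
  refine ((quintic_monic ℤ).irreducible_iff_irreducible_map_fraction_map (K := ℚ)).1 ?_
  have : Fact (Nat.Prime 5) := ⟨by norm_num⟩
  refine (quintic_monic ℤ).irreducible_of_irreducible_map (Int.castRingHom (ZMod 5)) _ ?_
  rw [quintic_map]
  exact quintic_irreducible_zmod (by simp)

instance : Fact (Irreducible (quintic ℚ)) := ⟨quintic_irreducible_rat⟩

theorem exists_powerBasis_of_algebra {L : Type} [Field L] [CharZero L] (A : Algebra ℚ L)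
    (P : @PowerBasis ℚ L _ _ A) (h : P.dim = 5 ∧ P.gen ^ 5 = 16 - 44 * P.gen) :
    ∃ P : PowerBasis ℚ L, P.dim = 5 ∧ P.gen ^ 5 = 16 - 44 * P.gen := by
  obtain rfl : A = DivisionRing.toRatAlgebra := Subsingleton.elim _ _
  exact ⟨P, h⟩

theorem exists_quintic_field : ∃ (L : Type) (_ : Field L) (_ : CharZero L) (P : PowerBasis ℚ L),
    P.dim = 5 ∧ P.gen ^ 5 = 16 - 44 * P.gen := by
  have : CharZero (AdjoinRoot (quintic ℚ)) :=
    charZero_of_injective_algebraMap (algebraMap ℚ (AdjoinRoot (quintic ℚ))).injective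
  refine ⟨AdjoinRoot (quintic ℚ), AdjoinRoot.instField, this, @exists_powerBasis_of_algebra
    (AdjoinRoot (quintic ℚ)) AdjoinRoot.instField this (AdjoinRoot.instAlgebra _)
    (AdjoinRoot.powerBasis quintic_irreducible_rat.ne_zero) ⟨?_, ?_⟩⟩
  · exact quintic_natDegree ℚ
  · exact quintic_eval₂ _ _ (AdjoinRoot.eval₂_root (quintic ℚ))

/-- The quintic field generated by a root of `X ^ 5 + 44 X - 16`. -/
def K : Type := exists_quintic_field.choose

noncomputable instance : Field K := exists_quintic_field.choose_spec.choose

instance : CharZero K := exists_quintic_field.choose_spec.choose_spec.choose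

theorem exists_powerBasis : ∃ P : PowerBasis ℚ K, P.dim = 5 ∧ P.gen ^ 5 = 16 - 44 * P.gen :=
  exists_quintic_field.choose_spec.choose_spec.choose_spec

/-- The power basis `1, β, …, β ^ 4`. -/
noncomputable def pb : PowerBasis ℚ K := exists_powerBasis.choose

/-- The distinguished root. -/
noncomputable def β : K := pb.gen

theorem β_rel : β ^ 5 = 16 - 44 * β := exists_powerBasis.choose_spec.2

theorem pb_dim : pb.dim = 5 := exists_powerBasis.choose_spec.1

instance : NumberField K where
  to_finiteDimensional := pb.finite

theorem finrank_K : Module.finrank ℚ K = 5 := by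
  rw [pb.finrank, pb_dim]

/-- The basis `1, β, …, β ^ 4`, indexed by `Fin 5`. -/
noncomputable def powBasis : Module.Basis (Fin 5) ℚ K := pb.basis.reindex (finCongr pb_dim)

theorem powBasis_apply (i : Fin 5) : powBasis i = β ^ (i : ℕ) := by
  simp [powBasis, β]

/-- The element of `K` with given coordinates on `1, β, …, β ^ 4`. -/
noncomputable def pw (a0 a1 a2 a3 a4 : ℚ) : K := a0 + a1 * β + a2 * β ^ 2 + a3 * β ^ 3 + a4 * β ^ 4

theorem pw_eq_sum (a : Fin 5 → ℚ) :
    pw (a 0) (a 1) (a 2) (a 3) (a 4) = ∑ i, a i • powBasis i := by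
  simp [Fin.sum_univ_five, powBasis_apply, pw, Algebra.smul_def]

theorem powBasis_repr_pw (a : Fin 5 → ℚ) (i : Fin 5) :
    powBasis.repr (pw (a 0) (a 1) (a 2) (a 3) (a 4)) i = a i := by
  rw [pw_eq_sum]
  exact congrFun (powBasis.repr_sum_self a) i

theorem exists_pw (x : K) : ∃ a : Fin 5 → ℚ, x = pw (a 0) (a 1) (a 2) (a 3) (a 4) :=
  ⟨fun i => powBasis.repr x i, by rw [pw_eq_sum, powBasis.sum_repr]⟩

theorem pw_inj {a0 a1 a2 a3 a4 b0 b1 b2 b3 b4 : ℚ} (h : pw a0 a1 a2 a3 a4 = pw b0 b1 b2 b3 b4) :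
    a0 = b0 ∧ a1 = b1 ∧ a2 = b2 ∧ a3 = b3 ∧ a4 = b4 := by
  have h1 := powBasis_repr_pw ![a0, a1, a2, a3, a4]
  have h2 := powBasis_repr_pw ![b0, b1, b2, b3, b4]
  have h3 (i) : ![a0, a1, a2, a3, a4] i = ![b0, b1, b2, b3, b4] i := by
    rw [← h1, ← h2]; simp [h]
  exact ⟨h3 0, h3 1, h3 2, h3 3, h3 4⟩

theorem pw_mul (a0 a1 a2 a3 a4 b0 b1 b2 b3 b4 : ℚ) :
    pw a0 a1 a2 a3 a4 * pw b0 b1 b2 b3 b4 =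
      pw (a0 * b0 + 16 * (a1 * b4 + a2 * b3 + a3 * b2 + a4 * b1))
        (a0 * b1 + a1 * b0 - 44 * (a1 * b4 + a2 * b3 + a3 * b2 + a4 * b1) +
          16 * (a2 * b4 + a3 * b3 + a4 * b2))
        (a0 * b2 + a1 * b1 + a2 * b0 - 44 * (a2 * b4 + a3 * b3 + a4 * b2) +
          16 * (a3 * b4 + a4 * b3))
        (a0 * b3 + a1 * b2 + a2 * b1 + a3 * b0 - 44 * (a3 * b4 + a4 * b3) + 16 * (a4 * b4))
        (a0 * b4 + a1 * b3 + a2 * b2 + a3 * b1 + a4 * b0 - 44 * (a4 * b4)) := by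
  simp only [pw]
  push_cast
  linear_combination ((a1 * b4 + a2 * b3 + a3 * b2 + a4 * b1) +
    (a2 * b4 + a3 * b3 + a4 * b2) * β + (a3 * b4 + a4 * b3) * β ^ 2 + (a4 * b4) * β ^ 3) * β_rel

/-- Coordinates on the integral basis `1, β, β² / 2, (β³ + 2 β) / 4, β⁴ / 4`. -/
@[ext] structure Coord where
  (c0 c1 c2 c3 c4 : ℤ)

namespace Coord

instance : DecidableEq Coord := fun _ _ => decidable_of_iff _ Coord.ext_iff.symm

/-- The element with given coordinates. -/
noncomputable def val (c : Coord) : K := pw c.c0 (c.c1 + c.c3 / 2) (c.c2 / 2) (c.c3 / 4) (c.c4 / 4)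

/-- Sum of coordinate vectors. -/
def add (a b : Coord) : Coord :=
  ⟨a.c0 + b.c0, a.c1 + b.c1, a.c2 + b.c2, a.c3 + b.c3, a.c4 + b.c4⟩

/-- Integer multiple of a coordinate vector. -/
def smul (n : ℤ) (a : Coord) : Coord := ⟨n * a.c0, n * a.c1, n * a.c2, n * a.c3, n * a.c4⟩

/-- The multiplication of the ring of integers, in coordinates. -/
def mul (a b : Coord) : Coord where
  c0 := 4 * (a.c1 * b.c4 + a.c4 * b.c1) + 2 * (a.c2 * b.c3 + a.c3 * b.c2 + a.c3 * b.c4 + a.c4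
      * b.c3) + a.c0 * b.c0
  c1 := 2 * (a.c2 * b.c4 + a.c4 * b.c2) + a.c0 * b.c1 + a.c1 * b.c0 + a.c3 * b.c3 - (a.c1 *
      b.c2 + a.c2 * b.c1) - 2 * a.c4 * b.c4 - 6 * (a.c2 * b.c3 + a.c3 * b.c2) - 11 * (a.c1 * b.c4 +
      a.c4 * b.c1)
  c2 := 2 * (a.c1 * b.c1 + a.c3 * b.c4 + a.c4 * b.c3) + a.c0 * b.c2 + a.c1 * b.c3 + a.c2 *
      b.c0 + a.c3 * b.c1 - 5 * a.c3 * b.c3 - 11 * (a.c2 * b.c4 + a.c4 * b.c2)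
  c3 := 4 * a.c4 * b.c4 + 2 * (a.c1 * b.c2 + a.c2 * b.c1) + a.c0 * b.c3 + a.c2 * b.c3 + a.c3 *
      b.c0 + a.c3 * b.c2 - 11 * (a.c3 * b.c4 + a.c4 * b.c3)
  c4 := a.c0 * b.c4 + a.c1 * b.c3 + a.c2 * b.c2 + a.c3 * b.c1 + a.c3 * b.c3 + a.c4 * b.c0 - 11
      * a.c4 * b.c4

theorem val_inj {a b : Coord} (h : a.val = b.val) : a = b := by
  obtain ⟨h0, h1, h2, h3, h4⟩ := pw_inj h
  have e3 : a.c3 = b.c3 := by exact_mod_cast (by linarith : (a.c3 : ℚ) = b.c3)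
  have e1 : a.c1 = b.c1 := by
    rw [e3] at h1
    exact_mod_cast (by linarith : (a.c1 : ℚ) = b.c1)
  ext
  · exact_mod_cast h0
  · exact e1
  · exact_mod_cast (by linarith : (a.c2 : ℚ) = b.c2)
  · exact e3
  · exact_mod_cast (by linarith : (a.c4 : ℚ) = b.c4)

theorem val_add (a b : Coord) : (a.add b).val = a.val + b.val := by
  simp only [val, add, pw]; push_cast; ring

theorem val_smul (n : ℤ) (a : Coord) : (a.smul n).val = n * a.val := by
  simp only [val, smul, pw]; push_cast; ring

theorem val_mul (a b : Coord) : (a.mul b).val = a.val * b.val := by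
  simp only [val, mul]
  rw [pw_mul]
  congr 1 <;> push_cast <;> ring

theorem val_int (n : ℤ) : (⟨n, 0, 0, 0, 0⟩ : Coord).val = n := by
  simp [val, pw]

theorem val_eq (a : Coord) : a.val = a.c0 * (⟨1, 0, 0, 0, 0⟩ : Coord).val +
    a.c1 * (⟨0, 1, 0, 0, 0⟩ : Coord).val + a.c2 * (⟨0, 0, 1, 0, 0⟩ : Coord).val +
    a.c3 * (⟨0, 0, 0, 1, 0⟩ : Coord).val + a.c4 * (⟨0, 0, 0, 0, 1⟩ : Coord).val := by
  simp only [← val_smul, ← val_add]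
  simp [add, smul]

theorem isIntegral_of_quintic {x : K} (p q r s t : ℤ)
    (h : x ^ 5 + p * x ^ 4 + q * x ^ 3 + r * x ^ 2 + s * x + t = 0) : IsIntegral ℤ x := by
  refine ⟨X ^ 5 + (C p * X ^ 4 + C q * X ^ 3 + C r * X ^ 2 + C s * X + C t),
    monic_X_pow_add (n := 5) ?_, ?_⟩
  · refine lt_of_le_of_lt (b := ((4 : ℕ) : WithBot ℕ)) ?_ (by norm_num)
    compute_degree
    norm_num
  · simp only [eval₂_add, eval₂_mul, eval₂_pow, eval₂_X, eval₂_C]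
    simp only [eq_intCast]
    linear_combination h

theorem isIntegral (a : Coord) : IsIntegral ℤ a.val := by
  have hi (n : ℤ) : IsIntegral ℤ (n : K) := isIntegral_algebraMap (R := ℤ) (A := K) (x := n)
  rw [val_eq]
  refine (((((hi _).mul ?_).add ((hi _).mul ?_)).add ((hi _).mul ?_)).add ((hi _).mul ?_)).add
    ((hi _).mul ?_)
  · simpa using val_int 1 ▸ hi 1
  · apply isIntegral_of_quintic 0 0 0 44 (-16)
    simp only [pow_succ, pow_zero, one_mul, ← val_mul, ← val_add, ← val_int]
    simpa [mul, add] using val_int 0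
  · apply isIntegral_of_quintic 0 22 0 121 (-8)
    simp only [pow_succ, pow_zero, one_mul, ← val_mul, ← val_add, ← val_int]
    simpa [mul, add] using val_int 0
  · apply isIntegral_of_quintic 0 22 28 386 (-76)
    simp only [pow_succ, pow_zero, one_mul, ← val_mul, ← val_add, ← val_int]
    simpa [mul, add] using val_int 0
  · apply isIntegral_of_quintic 44 726 5324 14641 (-64)
    simp only [pow_succ, pow_zero, one_mul, ← val_mul, ← val_add, ← val_int]
    simpa [mul, add] using val_int 0

/-- The algebraic integer with given coordinates. -/
noncomputable def toInt (a : Coord) : 𝓞 K := ⟨a.val, a.isIntegral⟩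

theorem coe_toInt (a : Coord) : ((a.toInt : 𝓞 K) : K) = a.val := rfl

theorem toInt_inj {a b : Coord} (h : a.toInt = b.toInt) : a = b :=
  val_inj (congrArg (fun x : 𝓞 K => (x : K)) h)

theorem toInt_add (a b : Coord) : (a.add b).toInt = a.toInt + b.toInt :=
  RingOfIntegers.ext (val_add a b)

theorem toInt_mul (a b : Coord) : (a.mul b).toInt = a.toInt * b.toInt :=
  RingOfIntegers.ext (val_mul a b)

theorem toInt_smul (n : ℤ) (a : Coord) : (a.smul n).toInt = n * a.toInt :=
  RingOfIntegers.ext (by simpa [coe_toInt] using val_smul n a)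

theorem toInt_int (n : ℤ) : (⟨n, 0, 0, 0, 0⟩ : Coord).toInt = n :=
  RingOfIntegers.ext (by simpa [coe_toInt] using val_int n)

/-- The determinant of a `5 × 5` matrix, by expansion along the first row. -/
def det3 (a b c d e f g h i : ℤ) : ℤ :=
  a * (e * i - f * h) - b * (d * i - f * g) + c * (d * h - e * g)

/-- The determinant of a `4 × 4` matrix with given rows. -/
def det4 (a b c d e f g h i j k l m n o p : ℤ) : ℤ :=
  a * det3 f g h j k l n o p - b * det3 e g h i k l m o p + c * det3 e f h i j l m n p -
    d * det3 e f g i j k m n o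

/-- The determinant of the `5 × 5` matrix with given rows, by expansion along the first row. -/
def det5 (a b c d e : Coord) : ℤ :=
  a.c0 * det4 b.c1 b.c2 b.c3 b.c4 c.c1 c.c2 c.c3 c.c4 d.c1 d.c2 d.c3 d.c4 e.c1 e.c2 e.c3 e.c4 -
  a.c1 * det4 b.c0 b.c2 b.c3 b.c4 c.c0 c.c2 c.c3 c.c4 d.c0 d.c2 d.c3 d.c4 e.c0 e.c2 e.c3 e.c4 +
  a.c2 * det4 b.c0 b.c1 b.c3 b.c4 c.c0 c.c1 c.c3 c.c4 d.c0 d.c1 d.c3 d.c4 e.c0 e.c1 e.c3 e.c4 -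
  a.c3 * det4 b.c0 b.c1 b.c2 b.c4 c.c0 c.c1 c.c2 c.c4 d.c0 d.c1 d.c2 d.c4 e.c0 e.c1 e.c2 e.c4 +
  a.c4 * det4 b.c0 b.c1 b.c2 b.c3 c.c0 c.c1 c.c2 c.c3 d.c0 d.c1 d.c2 d.c3 e.c0 e.c1 e.c2 e.c3

/-- The vector of coordinates. -/
def vec (a : Coord) : Fin 5 → ℤ := ![a.c0, a.c1, a.c2, a.c3, a.c4]

theorem det_eq_det5 (a b c d e : Coord) :
    Matrix.det (Matrix.of ![a.vec, b.vec, c.vec, d.vec, e.vec]) = det5 a b c d e := by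
  simp [Matrix.det_succ_row_zero, Fin.sum_univ_succ, det5, det4, det3, vec, Fin.succAbove]
  ring

/-- The standard basis. -/
def std : Fin 5 → Coord :=
  ![⟨1, 0, 0, 0, 0⟩, ⟨0, 1, 0, 0, 0⟩, ⟨0, 0, 1, 0, 0⟩, ⟨0, 0, 0, 1, 0⟩, ⟨0, 0, 0, 0, 1⟩]

/-- The norm, in coordinates. -/
def norm (a : Coord) : ℤ :=
  det5 (a.mul (std 0)) (a.mul (std 1)) (a.mul (std 2)) (a.mul (std 3)) (a.mul (std 4))

end Coord

/-- The integral basis `1, β, β² / 2, (β³ + 2 β) / 4, β⁴ / 4`, as a rational basis. -/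
noncomputable def intBasis : Module.Basis (Fin 5) ℚ K :=
  basisOfTopLeSpanOfCardEqFinrank (fun i => (Coord.std i).val) (by
    intro x _
    obtain ⟨a, rfl⟩ := exists_pw x
    have : pw (a 0) (a 1) (a 2) (a 3) (a 4) = a 0 • (Coord.std 0).val +
        (a 1 - 2 * a 3) • (Coord.std 1).val + (2 * a 2) • (Coord.std 2).val +
        (4 * a 3) • (Coord.std 3).val + (4 * a 4) • (Coord.std 4).val := by
      simp [Coord.std, Coord.val, pw, Algebra.smul_def]
      ring
    rw [this]
    have h (i : Fin 5) (q : ℚ) : q • (Coord.std i).val ∈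
        Submodule.span ℚ (Set.range fun i => (Coord.std i).val) :=
      Submodule.smul_mem _ _ (Submodule.subset_span ⟨i, rfl⟩)
    exact add_mem (add_mem (add_mem (add_mem (h _ _) (h _ _)) (h _ _)) (h _ _)) (h _ _))
    (by simp [finrank_K])

theorem intBasis_apply (i : Fin 5) : intBasis i = (Coord.std i).val := by
  simp [intBasis]

namespace Coord

theorem intBasis_repr (a : Coord) (i : Fin 5) : intBasis.repr a.val i = a.vec i := by
  have : a.val = ∑ i, (a.vec i : ℚ) • intBasis i := by
    rw [val_eq]
    simp [Fin.sum_univ_five, intBasis_apply, Algebra.smul_def, vec, std]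
  rw [this]
  exact congrFun (intBasis.repr_sum_self _) i

theorem norm_val (a : Coord) : Algebra.norm ℚ a.val = a.norm := by
  rw [Algebra.norm_eq_matrix_det intBasis, norm, ← det_eq_det5, ← Matrix.det_transpose,
    ← eq_intCast (Int.castRingHom ℚ), RingHom.map_det]
  congr 1
  ext i j
  simp only [RingHom.mapMatrix_apply, Matrix.map_apply, Matrix.transpose_apply,
    Algebra.leftMulMatrix_eq_repr_mul, intBasis_apply, ← val_mul, intBasis_repr]
  fin_cases i <;> rfl

theorem norm_toInt (a : Coord) : Algebra.norm ℤ a.toInt = a.norm := by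
  have := Algebra.coe_norm_int a.toInt
  rw [coe_toInt, norm_val] at this
  exact_mod_cast this

theorem absNorm_span (a : Coord) : Ideal.absNorm (Ideal.span {a.toInt}) = a.norm.natAbs := by
  rw [Ideal.absNorm_span_singleton, norm_toInt]

end Coord

namespace Coord

/-- The trace, in coordinates. -/
def trace (a : Coord) : ℤ := 5 * a.c0 - 44 * a.c4

theorem trace_val (a : Coord) : Algebra.trace ℚ K a.val = a.trace := by
  rw [Algebra.trace_eq_matrix_trace intBasis, Matrix.trace]
  simp only [Matrix.diag_apply, Algebra.leftMulMatrix_eq_repr_mul, intBasis_apply, ← val_mul,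
    intBasis_repr, Fin.sum_univ_five]
  simp [vec, mul, std, trace]
  ring

theorem trace_toInt (a : Coord) : Algebra.trace ℤ (𝓞 K) a.toInt = a.trace := by
  have := Algebra.coe_trace_int a.toInt
  rw [coe_toInt, trace_val] at this
  exact_mod_cast this

/-- The unit `2 / (π_a π_M ^ 4)`. -/
def u : Coord := ⟨338437, -384656, -1033071, -671967, -39865⟩

/-- The inverse of `u`. -/
def uInv : Coord := ⟨-6723, -25119, -140299, 130503, -31139⟩

/-- A generator of the prime above `2` at which `β / 2` is not integral. -/
def πa : Coord := ⟨32, 0, 0, 1, 3⟩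

/-- A generator of the ramified prime above `2`. -/
def πM : Coord := ⟨3, -6, 2, 1, -1⟩

theorem two_eq : (2 : 𝓞 K) = u.toInt * (πa.toInt * πM.toInt ^ 4) := by
  simp only [pow_succ, pow_zero, one_mul, ← toInt_mul]
  rw [show u.mul (πa.mul (((πM.mul πM).mul πM).mul πM)) = ⟨2, 0, 0, 0, 0⟩ by decide +kernel,
    toInt_int]
  norm_num

theorem u_mul_uInv : u.toInt * uInv.toInt = 1 := by
  rw [← toInt_mul, show u.mul uInv = ⟨1, 0, 0, 0, 0⟩ by decide +kernel, toInt_int]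
  norm_num

theorem dvd_of_cert {p : Coord} (m : Fin 5 → ℤ) (q : Fin 5 → Coord)
    (h : ∀ i, std i = add ⟨m i, 0, 0, 0, 0⟩ (p.mul (q i))) (a : Coord) :
    ∃ (n : ℤ) (b : Coord), a.toInt = n + p.toInt * b.toInt := by
  have key (i : Fin 5) : (std i).toInt = m i + p.toInt * (q i).toInt := by
    rw [← toInt_mul, ← toInt_int, ← toInt_add, ← h]
  have ha : a.toInt = a.c0 * (std 0).toInt + a.c1 * (std 1).toInt + a.c2 * (std 2).toInt +
      a.c3 * (std 3).toInt + a.c4 * (std 4).toInt := by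
    apply RingOfIntegers.ext
    simpa [coe_toInt, std] using val_eq a
  refine ⟨a.c0 * m 0 + a.c1 * m 1 + a.c2 * m 2 + a.c3 * m 3 + a.c4 * m 4,
    add (smul a.c0 (q 0)) (add (smul a.c1 (q 1)) (add (smul a.c2 (q 2)) (add (smul a.c3 (q 3))
      (smul a.c4 (q 4))))), ?_⟩
  rw [ha]
  simp only [key, toInt_add, toInt_smul]
  push_cast
  ring

/-- An integral combination of the basis divisible by a prime `p` of norm `2` in `𝓞 K` is divisible
by `p` among integral combinations. -/
theorem saturated {p : Coord} (hp : p.norm.natAbs = 2)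
    (h2 : ∃ b : Coord, (2 : 𝓞 K) = p.toInt * b.toInt)
    (h : ∀ a : Coord, ∃ (n : ℤ) (b : Coord), a.toInt = n + p.toInt * b.toInt) {a : Coord}
    {x : 𝓞 K} (hx : a.toInt = p.toInt * x) : ∃ b : Coord, x = b.toInt := by
  have hp0 : p.toInt ≠ 0 := fun h0 => by
    have := norm_toInt p
    rw [h0, Algebra.norm_zero] at this
    omega
  obtain ⟨n, b, hb⟩ := h a
  obtain ⟨c, hc⟩ := h2
  obtain ⟨k, rfl | rfl⟩ := Int.even_or_odd' n
  · refine ⟨add (smul k c) b, mul_left_cancel₀ hp0 ?_⟩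
    rw [← hx, hb, toInt_add, toInt_smul]
    push_cast
    rw [hc]
    ring
  · have h1 : p.toInt * (x - b.toInt - k * c.toInt) = 1 := by
      rw [mul_sub, mul_sub, ← hx, hb]
      push_cast
      rw [hc]
      ring
    have := congrArg (Algebra.norm ℤ) h1
    rw [map_mul, norm_toInt, map_one] at this
    have := Int.isUnit_iff.1 (IsUnit.of_mul_eq_one _ this)
    omega

theorem saturated_πa {a : Coord} {x : 𝓞 K} (hx : a.toInt = πa.toInt * x) :
    ∃ b : Coord, x = b.toInt := by
  refine saturated (by decide +kernel) ⟨u.mul (πM.mul (πM.mul (πM.mul πM))), ?_⟩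
    (dvd_of_cert ![1, 0, 0, 0, 0] ![⟨0, 0, 0, 0, 0⟩, ⟨-2, 5, 3, 0, -1⟩, ⟨-2, 3, 5, 3, 0⟩,
      ⟨-1, -1, 6, 5, 1⟩, ⟨6, -21, -2, 9, 5⟩] (by decide +kernel)) hx
  rw [two_eq]
  simp only [toInt_mul]
  ring

theorem saturated_πM {a : Coord} {x : 𝓞 K} (hx : a.toInt = πM.toInt * x) :
    ∃ b : Coord, x = b.toInt := by
  refine saturated (by decide +kernel) ⟨u.mul (πa.mul (πM.mul (πM.mul πM))), ?_⟩
    (dvd_of_cert ![1, 0, 1, 0, 1] ![⟨0, 0, 0, 0, 0⟩, ⟨-2, 1, 9, 7, 1⟩, ⟨3, -15, 1, 8, 4⟩,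
      ⟨6, -20, -2, 8, 5⟩, ⟨19, -40, -40, -14, 5⟩] (by decide +kernel)) hx
  rw [two_eq]
  simp only [toInt_mul]
  ring

theorem saturated_two {a : Coord} {x : 𝓞 K} (hx : a.toInt = 2 * x) : ∃ b : Coord, x = b.toInt := by
  rw [two_eq] at hx
  obtain ⟨b1, h1⟩ := saturated_πa (x := u.toInt * πM.toInt ^ 4 * x) (by rw [hx]; ring)
  obtain ⟨b2, h2⟩ := saturated_πM (x := u.toInt * πM.toInt ^ 3 * x) (by rw [← h1]; ring)
  obtain ⟨b3, h3⟩ := saturated_πM (x := u.toInt * πM.toInt ^ 2 * x) (by rw [← h2]; ring)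
  obtain ⟨b4, h4⟩ := saturated_πM (x := u.toInt * πM.toInt * x) (by rw [← h3]; ring)
  obtain ⟨b5, h5⟩ := saturated_πM (x := u.toInt * x) (by rw [← h4]; ring)
  refine ⟨b5.mul uInv, ?_⟩
  rw [toInt_mul, ← h5, mul_right_comm, u_mul_uInv, one_mul]

/-- Every algebraic integer of `K` has, up to the odd factor `647329`, integral coordinates. -/
theorem exists_coord (x : 𝓞 K) : ∃ a : Coord, 647329 * x = a.toInt := by
  have ht (i : Fin 5) : ∃ t : ℤ, Algebra.trace ℚ K (x * (std i).val) = t :=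
    ⟨_, (Algebra.coe_trace_int (x * (std i).toInt)).symm⟩
  choose t ht using ht
  have hx := intBasis.sum_repr (x : K)
  set a : Fin 5 → ℚ := fun i => intBasis.repr (x : K) i
  have hs (i j : Fin 5) : Algebra.trace ℚ K ((std i).val * (std j).val) =
      ((std i).mul (std j)).trace := by rw [← val_mul, trace_val]
  have key (j : Fin 5) : ∑ i, a i * (((std i).mul (std j)).trace : ℚ) = t j := by
    rw [← ht, ← hx]
    simp only [intBasis_apply, Finset.sum_mul, map_sum, smul_mul_assoc, map_smul, hs, smul_eq_mul]
    rfl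
  have k0 := key 0
  have k1 := key 1
  have k2 := key 2
  have k3 := key 3
  have k4 := key 4
  simp [Fin.sum_univ_five, std, mul, trace] at k0 k1 k2 k3 k4
  have hc : 4 * (647329 * (x : K)) = val
      ⟨2579316 * t 0 - 47740 * t 1 + 24200 * t 2 + 106480 * t 3 + 234256 * t 4,
      -47740 * t 0 + 56914 * t 1 - 13935 * t 2 - 61314 * t 3 - 5425 * t 4,
      24200 * t 0 - 13935 * t 1 - 58564 * t 2 + 1250 * t 3 + 2750 * t 4,
      106480 * t 0 - 61314 * t 1 + 1250 * t 2 + 5500 * t 3 + 12100 * t 4,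
      234256 * t 0 - 5425 * t 1 + 2750 * t 2 + 12100 * t 3 + 26620 * t 4⟩ := by
    rw [val_eq, ← hx]
    simp only [Fin.sum_univ_five, Algebra.smul_def, intBasis_apply, eq_ratCast]
    push_cast
    have hq (i : Fin 5) : (t i : K) = ((t i : ℚ) : K) := (Rat.cast_intCast _).symm
    simp only [hq, ← k0, ← k1, ← k2, ← k3, ← k4]
    change 4 * (647329 * (a 0 * (std 0).val + a 1 * (std 1).val + a 2 * (std 2).val +
      a 3 * (std 3).val + a 4 * (std 4).val)) = _ * (std 0).val + _ * (std 1).val +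
      _ * (std 2).val + _ * (std 3).val + _ * (std 4).val
    push_cast
    ring
  obtain ⟨b, hb⟩ := saturated_two (x := 2 * (647329 * x)) (RingOfIntegers.ext (by
    simp only [map_mul, map_ofNat]
    exact hc.symm.trans (by ring)))
  exact saturated_two hb.symm

end Coord

theorem abs_discr_le : |discr K| ≤ 41429056 := by
  let c : Fin 5 → 𝓞 K := fun i => (Coord.std i).toInt
  have hcard : Fintype.card (Module.Free.ChooseBasisIndex ℤ (𝓞 K)) = 5 := by
    rw [← Module.finrank_eq_card_chooseBasisIndex, RingOfIntegers.rank, finrank_K]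
  let ω : Module.Basis (Fin 5) ℤ (𝓞 K) :=
    (RingOfIntegers.basis K).reindex (Fintype.equivFinOfCardEq hcard)
  have h1 : Algebra.discr ℤ c = (ω.toMatrix c).det ^ 2 * discr K := by
    rw [← discr_eq_discr K ω, ← Algebra.discr_of_matrix_vecMul, ω.toMatrix_map_vecMul]
  have h2 : Algebra.discr ℤ c = 41429056 := by
    have : Algebra.traceMatrix ℤ c = Matrix.of ![(⟨5, 0, 0, 0, -44⟩ : Coord).vec,
        (⟨0, 0, 0, -44, 20⟩ : Coord).vec, (⟨0, 0, -44, 10, 0⟩ : Coord).vec,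
        (⟨0, -44, 10, -44, 10⟩ : Coord).vec, (⟨-44, 20, 0, 10, 484⟩ : Coord).vec] := by
      ext i j
      rw [Algebra.traceMatrix_apply, Algebra.traceForm_apply, ← Coord.toInt_mul, Coord.trace_toInt]
      fin_cases i <;> fin_cases j <;> decide +kernel
    rw [Algebra.discr_def, this, Coord.det_eq_det5]
    decide +kernel
  rw [h2] at h1
  have h3 : (ω.toMatrix c).det ≠ 0 := fun h => by simp [h] at h1
  have h4 : 1 ≤ (ω.toMatrix c).det ^ 2 := by
    have : 0 < (ω.toMatrix c).det ^ 2 := by positivity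
    omega
  calc |discr K| = 1 * |discr K| := (one_mul _).symm
    _ ≤ |(ω.toMatrix c).det ^ 2| * |discr K| := by gcongr; exact h4.trans (le_abs_self _)
    _ = 41429056 := by rw [← abs_mul, ← h1]; rfl

theorem hom_ext {φ ψ : K →+* ℂ} (h : φ β = ψ β) : φ = ψ := by
  ext x
  obtain ⟨a, rfl⟩ := exists_pw x
  simp [pw, h]

theorem hom_β_rel (φ : K →+* ℂ) : φ β ^ 5 = 16 - 44 * φ β := by
  have h := congrArg φ β_rel
  rw [map_pow, map_sub, map_mul, map_ofNat, map_ofNat] at h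
  exact h

theorem nrRealPlaces_K : InfinitePlace.nrRealPlaces K = 1 := by
  have h1 : InfinitePlace.nrRealPlaces K ≤ 1 := by
    classical
    rw [← InfinitePlace.card_real_embeddings, Fintype.card_le_one_iff]
    rintro ⟨φ, hφ⟩ ⟨ψ, hψ⟩
    refine Subtype.ext (hom_ext ?_)
    have h1 := hom_β_rel φ
    have h2 := hom_β_rel ψ
    rw [← ComplexEmbedding.IsReal.coe_embedding_apply hφ,
      ← ComplexEmbedding.IsReal.coe_embedding_apply hψ] at *
    norm_cast at *
    generalize hφ.embedding β = x at *
    generalize hψ.embedding β = y at *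
    have hmono : StrictMono fun t : ℝ => t ^ 5 + 44 * t :=
      (Odd.strictMono_pow (by decide)).add (strictMono_id.const_mul (by norm_num))
    exact hmono.injective (show x ^ 5 + 44 * x = y ^ 5 + 44 * y by linarith)
  have h2 := InfinitePlace.card_add_two_mul_card_eq_rank K
  rw [finrank_K] at h2
  omega

theorem nrComplexPlaces_K : InfinitePlace.nrComplexPlaces K = 2 := by
  have h2 := InfinitePlace.card_add_two_mul_card_eq_rank K
  rw [finrank_K, nrRealPlaces_K] at h2
  omega

theorem minkowski_lt : (4 / Real.pi) ^ InfinitePlace.nrComplexPlaces K *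
    ((Module.finrank ℚ K).factorial / (Module.finrank ℚ K) ^ (Module.finrank ℚ K) *
      √|(discr K : ℝ)|) < 401 := by
  rw [nrComplexPlaces_K, finrank_K]
  have h1 : √|(discr K : ℝ)| ≤ 6437 := by
    apply Real.sqrt_le_iff.2 ⟨by norm_num, ?_⟩
    have : (|discr K| : ℝ) ≤ 41429056 := by exact_mod_cast abs_discr_le
    linarith
  have h2 : 4 / Real.pi ≤ 4 / 3.1415 := by gcongr; exact Real.pi_gt_d4.le
  have h3 : (4 / Real.pi) ^ 2 ≤ (4 / 3.1415) ^ 2 := by gcongr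
  calc _ ≤ (4 / 3.1415) ^ 2 * (((5 : ℕ).factorial : ℝ) / (5 : ℕ) ^ 5 * 6437) := by gcongr
    _ < 401 := by norm_num [Nat.factorial]

/-- The value at `β = r` of `4` times the element with coordinates `c`. -/
def Coord.eval4 (c : Coord) (r : ℤ) : ℤ :=
  4 * c.c0 + (4 * c.c1 + 2 * c.c3) * r + 2 * c.c2 * r ^ 2 + c.c3 * r ^ 3 + c.c4 * r ^ 4

/-- The root `β` as an algebraic integer. -/
noncomputable def βint : 𝓞 K := (⟨0, 1, 0, 0, 0⟩ : Coord).toInt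

theorem βint_rel : βint ^ 5 + 44 * βint - 16 = 0 := by
  apply RingOfIntegers.ext
  have : (βint : K) = β := by simp [βint, Coord.coe_toInt, Coord.val, pw]
  simp only [map_add, map_sub, map_pow, map_mul, map_ofNat, this, β_rel]
  simp

theorem four_mul_toInt (c : Coord) : 4 * c.toInt = 4 * c.c0 + (4 * c.c1 + 2 * c.c3) * βint +
    2 * c.c2 * βint ^ 2 + c.c3 * βint ^ 3 + c.c4 * βint ^ 4 := by
  apply RingOfIntegers.ext
  have : (βint : K) = β := by simp [βint, Coord.coe_toInt, Coord.val, pw]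
  simp only [map_add, map_pow, map_mul, map_ofNat, map_intCast, this, Coord.coe_toInt,
    Coord.val, pw]
  push_cast
  ring

/-- Tabulated elements of prime norm `p` vanishing at `β = r` modulo `p`. -/
def primeTable : List (ℕ × ℕ × Coord) := 
  [(13, 2, ⟨-3, 28, -20, -30, -10⟩), (17, 6, ⟨1, -2, -4, 0, -2⟩), (17, 14, ⟨-1, 4, -1, -2, -1⟩),
  (17, 15, ⟨-3, 17, 16, -22, 6⟩), (19, 11, ⟨-5, 10, 9, 4, -1⟩), (19, 13, ⟨1, -2, -7, 1, -1⟩), (19,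
  15, ⟨-3, 6, -11, 8, -1⟩), (23, 20, ⟨-3, 6, -8, 7, -2⟩), (29, 1, ⟨1, -1, 0, 0, 0⟩), (29, 19, ⟨5,
  -10, -3, -6, -1⟩), (37, 4, ⟨1, -1, -2, -1, 0⟩), (37, 14, ⟨1, 3, -8, -8, -2⟩), (37, 30, ⟨3, -2,
  -11, -8, -1⟩), (43, 32, ⟨-3, 5, 3, 0, -1⟩), (47, 22, ⟨1, -4, 1, 2, -1⟩), (53, 47, ⟨1, -2, 2, -1,
  0⟩), (59, 6, ⟨1, -3, 4, -2, 0⟩), (61, 29, ⟨-5, -5, -7, 8, -3⟩), (61, 60, ⟨1, 1, 0, 0, 0⟩), (67,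
  9, ⟨1, -2, -2, -1, 0⟩), (89, 31, ⟨1, -13, -5, 21, -3⟩), (97, 50, ⟨9, -29, 9, 5, -5⟩), (97, 88,
  ⟨-3, 9, 2, -2, -2⟩), (103, 63, ⟨5, -10, -6, -5, 0⟩), (107, 14, ⟨-7, 14, 14, 5, 4⟩), (107, 68,
  ⟨1, -1, -4, -2, 0⟩), (109, 101, ⟨-1, 1, -5, 5, -1⟩), (127, 31, ⟨-3, -7, 7, -3, -1⟩), (127, 38,
  ⟨-5, 12, 8, 1, -2⟩), (127, 100, ⟨1, -6, 3, 0, -1⟩), (137, 28, ⟨1, -2, 2, -2, 0⟩), (137, 64, ⟨21,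
  -1, 0, 1, 2⟩), (149, 30, ⟨1, -2, -1, -1, -3⟩), (149, 31, ⟨-13, 5, 2, -1, -2⟩), (149, 58, ⟨-3, 9,
  -7, 2, 1⟩), (149, 66, ⟨1, 3, 4, 2, 0⟩), (149, 113, ⟨-3, 12, 1, -5, -3⟩), (151, 28, ⟨-5, 10, 12,
  3, -2⟩), (151, 32, ⟨3, -6, 14, -9, 0⟩), (151, 121, ⟨1, -2, -10, 2, 0⟩), (163, 29, ⟨-19, 48, 27,
  -1, -9⟩), (163, 51, ⟨-1, 11, -8, -12, -4⟩), (167, 38, ⟨5, -3, -18, -14, -2⟩), (167, 72, ⟨7, -5,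
  4, -1, 0⟩), (167, 116, ⟨5, -7, -14, -8, 0⟩), (179, 141, ⟨23, -1, 0, 1, 2⟩), (181, 15, ⟨1, -3, 2,
  0, 0⟩), (181, 134, ⟨3, -10, -2, 4, -2⟩), (193, 97, ⟨1, -2, 0, 0, 0⟩), (211, 73, ⟨-3, 17, 13,
  -21, 7⟩), (229, 97, ⟨3, -10, 1, 3, -3⟩), (229, 174, ⟨5, -2, 0, 1, 0⟩), (229, 214, ⟨-3, 7, 5, 1,
  -1⟩), (239, 144, ⟨-5, 32, -21, -27, -3⟩), (251, 183, ⟨-1, 13, -18, -13, -4⟩), (257, 171, ⟨1, -4,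
  4, 1, 0⟩), (269, 17, ⟨5, -6, 1, 2, -1⟩), (269, 118, ⟨-3, 6, -5, 6, -3⟩), (277, 108, ⟨-1, -7, 0,
  3, -2⟩), (283, 50, ⟨1, -4, -2, 3, 0⟩), (293, 133, ⟨-29, -6, 2, 0, -4⟩), (307, 134, ⟨3, -6, 8,
  -4, 0⟩), (307, 221, ⟨11, -1, 1, 0, 1⟩), (307, 229, ⟨-7, -5, 0, 2, -2⟩), (313, 45, ⟨1, -4, -1, 3,
  -1⟩), (313, 133, ⟨5, -17, 0, 6, 4⟩), (313, 286, ⟨21, 0, 0, 1, 2⟩), (331, 97, ⟨3, -4, -8, -5,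
  0⟩), (347, 39, ⟨1, 9, -6, -20, 0⟩), (347, 45, ⟨-13, 37, -1, -2, 1⟩), (347, 106, ⟨1, 1, -6, -5,
  0⟩), (349, 99, ⟨-1, -4, 1, 1, -1⟩), (349, 208, ⟨-3, 17, -7, -14, -1⟩), (359, 3, ⟨3, -1, 0, 0,
  0⟩), (373, 309, ⟨57, -5, 0, 4, 4⟩), (373, 337, ⟨-3, 21, -11, -20, -7⟩), (373, 360, ⟨15, -30,
  -30, -11, 4⟩), (383, 131, ⟨1, 1, -3, -6, -1⟩), (397, 297, ⟨5, -15, 10, -1, -2⟩)]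

theorem primeTable_spec : ∀ e ∈ primeTable, e.2.2.norm.natAbs = e.1 := by decide +kernel

set_option synthInstance.maxSize 1000 in
set_option synthInstance.maxHeartbeats 400000 in
theorem primeTable_complete : ∀ p < 401, p % 2 = 1 → (∀ d < 20, 1 < d → d < p → p % d ≠ 0) → 1 < p →
    ∀ r < p, (r ^ 5 + 44 * r) % p = 16 % p →
      ∃ e ∈ primeTable, e.1 = p ∧ (p : ℤ) ∣ e.2.2.eval4 r := by
  decide +kernel

theorem eq_span_of_absNorm_eq {P : Ideal (𝓞 K)} {α : 𝓞 K} (hα : α ∈ P) (h0 : Ideal.absNorm P ≠ 0)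
    (h : Ideal.absNorm (Ideal.span {α}) = Ideal.absNorm P) : P = Ideal.span {α} := by
  obtain ⟨J, hJ⟩ := Ideal.dvd_iff_le.2 ((Ideal.span_singleton_le_iff_mem P).2 hα)
  rw [hJ, map_mul] at h
  have h1 : Ideal.absNorm J = 1 := by
    rw [mul_eq_left₀ h0] at h; exact h
  rw [Ideal.absNorm_eq_one_iff] at h1
  rw [hJ, h1, Ideal.mul_top]

theorem eq_span_of_absNorm_prime {P : Ideal (𝓞 K)} {α : 𝓞 K} (hα : α ∈ P) (h1 : P ≠ ⊤)
    (h : (Ideal.absNorm (Ideal.span {α})).Prime) : P = Ideal.span {α} := by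
  have hdvd : Ideal.absNorm P ∣ Ideal.absNorm (Ideal.span {α}) :=
    Ideal.absNorm_dvd_absNorm_of_le ((Ideal.span_singleton_le_iff_mem P).2 hα)
  rcases (Nat.dvd_prime h).1 hdvd with h2 | h2
  · exact absurd (Ideal.absNorm_eq_one_iff.1 h2) h1
  · exact eq_span_of_absNorm_eq hα (h2 ▸ h.ne_zero) h2.symm

theorem isPrincipal_of_coord_mem {P : Ideal (𝓞 K)} {c : Coord} (hc : c.toInt ∈ P) (h1 : P ≠ ⊤)
    (h : c.norm.natAbs.Prime) : Submodule.IsPrincipal P :=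
  ⟨_, eq_span_of_absNorm_prime hc h1 (by rwa [Coord.absNorm_span])⟩

/-- A unit. -/
def unitW : Coord := ⟨34779704406081, -536467497912, 208795430139, 1148830494516, 3160537336117⟩

theorem unitW_isUnit : IsUnit unitW.toInt := by
  refine IsUnit.of_mul_eq_one (⟨-7271, -1870, 34195, 29260, 5153⟩ : Coord).toInt ?_
  rw [← Coord.toInt_mul, show unitW.mul ⟨-7271, -1870, 34195, 29260, 5153⟩ = ⟨1, 0, 0, 0, 0⟩ by
    decide +kernel, Coord.toInt_int, Int.cast_one]

theorem seventeen_eq : (⟨17, 0, 0, 0, 0⟩ : Coord) = unitW.mul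
    (Coord.mul ⟨27, -125, 24, 80, 36⟩ (Coord.mul ⟨-1, 4, -1, -2, -1⟩ (Coord.mul ⟨1, -2, -4, 0, -2⟩
      ⟨-3, 17, 16, -22, 6⟩))) := by
  decide +kernel

theorem nineteen_eq : (⟨19, 0, 0, 0, 0⟩ : Coord) = unitW.mul
    (Coord.mul ⟨-47, 125, 64, -7, -24⟩ (Coord.mul ⟨-5, 10, 9, 4, -1⟩ (Coord.mul ⟨-3, 6, -11, 8, -1⟩
      ⟨1, -2, -7, 1, -1⟩))) := by
  decide +kernel

theorem isPrincipal_of_norm_le {P : Ideal (𝓞 K)} [hP : P.IsPrime] (h0 : P ≠ ⊥)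
    (hle : Ideal.absNorm P ≤ 400) : Submodule.IsPrincipal P := by
  have hmax : P.IsMaximal := hP.isMaximal h0
  let _ := Ideal.Quotient.field P
  have : Finite (𝓞 K ⧸ P) := Ideal.finiteQuotientOfFreeOfNeBot P h0
  have hcard : Ideal.absNorm P = Nat.card (𝓞 K ⧸ P) := by
    rw [Ideal.absNorm_apply, Submodule.cardQuot_apply]
  obtain ⟨p, hchar⟩ := CharP.exists (𝓞 K ⧸ P)
  have hp : Fact p.Prime := ⟨(CharP.char_is_prime_or_zero (𝓞 K ⧸ P) p).resolve_right
    (CharP.char_ne_zero_of_finite (𝓞 K ⧸ P) p)⟩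
  let _ := ZMod.algebra (𝓞 K ⧸ P) p
  set f := Module.finrank (ZMod p) (𝓞 K ⧸ P) with hf
  have hpow : Ideal.absNorm P = p ^ f := by
    rw [hcard, Module.natCard_eq_pow_finrank (K := ZMod p), Nat.card_zmod]
  have h0' : Ideal.absNorm P ≠ 0 := by rw [hpow]; exact pow_ne_zero _ hp.out.ne_zero
  have hpP : (p : 𝓞 K) ∈ P := by
    rw [← Ideal.Quotient.eq_zero_iff_mem, map_natCast, CharP.cast_eq_zero]
  have hInt (n : ℤ) (hn : (p : ℤ) ∣ n) : (n : 𝓞 K ⧸ P) = 0 :=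
    (CharP.intCast_eq_zero_iff _ p n).2 hn
  rw [hpow] at hle
  by_cases hp2 : p = 2
  · have : (2 : 𝓞 K) ∈ P := by rw [hp2] at hpP; exact_mod_cast hpP
    rw [Coord.two_eq] at this
    rcases hP.mem_or_mem this with h | h
    · refine absurd (Ideal.eq_top_of_isUnit_mem P h ?_) hmax.ne_top
      exact IsUnit.of_mul_eq_one _ Coord.u_mul_uInv
    rcases hP.mem_or_mem h with h | h
    · exact isPrincipal_of_coord_mem h hmax.ne_top (by
        rw [show Coord.πa.norm.natAbs = 2 by decide +kernel]; exact Nat.prime_two)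
    · exact isPrincipal_of_coord_mem (hP.mem_of_pow_mem _ h) hmax.ne_top (by
        rw [show Coord.πM.norm.natAbs = 2 by decide +kernel]; exact Nat.prime_two)
  set x : 𝓞 K ⧸ P := Ideal.Quotient.mk P βint with hx
  have hxrel : x ^ 5 + 44 * x - 16 = 0 := by
    have := congrArg (Ideal.Quotient.mk P) βint_rel
    simpa only [map_add, map_sub, map_mul, map_pow, map_ofNat, map_zero] using this
  have hxint : IsIntegral (ZMod p) x := Algebra.IsIntegral.isIntegral x
  set q := minpoly (ZMod p) x with hq
  have hqm : q.Monic := minpoly.monic hxint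
  have hdvd : q ∣ quintic (ZMod p) := by
    refine minpoly.dvd _ _ ?_
    rw [aeval_def, quintic_eval₂_eq, hxrel]
  have hdf : q.natDegree ≤ f := minpoly.natDegree_le x
  have hd0 : 0 < q.natDegree := minpoly.natDegree_pos hxint
  have hpos : 1 < p := hp.out.one_lt
  have hpd : p ^ q.natDegree ≤ 400 := (Nat.pow_le_pow_right hpos.le hdf).trans hle
  have hbig (k : ℕ) (hk : k ≤ q.natDegree) : p ^ k ≤ 400 :=
    (Nat.pow_le_pow_right hpos.le hk).trans hpd
  have hmod (c : Coord) (r : ℤ) (hr : x = r) :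
      4 * Ideal.Quotient.mk P c.toInt = (c.eval4 r : ℤ) := by
    have := congrArg (Ideal.Quotient.mk P) (four_mul_toInt c)
    simp only [map_add, map_mul, map_pow, map_ofNat, map_intCast, ← hx, hr] at this
    rw [this, Coord.eval4]
    push_cast
    ring
  by_cases hirr : p = 3 ∨ p = 5 ∨ p = 7 ∨ p = 11
  · have hdeg : q.natDegree = 5 := by
      rw [hq, ← minpoly.eq_of_irreducible_of_monic (quintic_irreducible_zmod hirr) _
        (quintic_monic _), quintic_natDegree]
      rw [aeval_def, quintic_eval₂_eq, hxrel]
    have h5 := hbig 5 hdeg.ge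
    obtain rfl : p = 3 := by
      rcases hirr with rfl | rfl | rfl | rfl <;> simp at h5 ⊢
    have hf5 : f = 5 := by
      refine le_antisymm ?_ (hdeg ▸ hdf)
      by_contra! h
      have := (Nat.pow_le_pow_right hpos.le h).trans hle
      norm_num at this
    refine ⟨_, eq_span_of_absNorm_eq (α := (⟨3, 0, 0, 0, 0⟩ : Coord).toInt) ?_ h0' ?_⟩
    · rw [Coord.toInt_int]; exact_mod_cast hpP
    · rw [Coord.absNorm_span, hpow, hf5]
      decide +kernel
  have hodd : p % 2 = 1 := (hp.out.eq_two_or_odd).resolve_left hp2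
  have h4 : (4 : 𝓞 K ⧸ P) ≠ 0 := by
    intro h
    have h' : ((4 : ℕ) : 𝓞 K ⧸ P) = 0 := by exact_mod_cast h
    rw [CharP.cast_eq_zero_iff _ p] at h'
    have := Nat.le_of_dvd (by norm_num) h'
    have : p = 1 ∨ p = 3 := by omega
    rcases this with rfl | rfl
    · omega
    · simp at hirr
  obtain hd | hd : q.natDegree = 1 ∨ 2 ≤ q.natDegree := by omega
  · obtain ⟨a, ha⟩ := minpoly.natDegree_eq_one_iff.1 hd
    have ha' : a ^ 5 + 44 * a = 16 := by
      apply (algebraMap (ZMod p) (𝓞 K ⧸ P)).injective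
      rw [map_add, map_mul, map_pow, map_ofNat, map_ofNat, ha]
      linear_combination hxrel
    have haval : ((a.val : ℕ) : ZMod p) = a := ZMod.natCast_zmod_val a
    have hxa : x = ((a.val : ℕ) : ℤ) := by
      rw [← ha, Int.cast_natCast, ← map_natCast (algebraMap (ZMod p) (𝓞 K ⧸ P)), haval]
    have hmodp : (a.val ^ 5 + 44 * a.val) % p = 16 % p := by
      rw [← ZMod.natCast_eq_natCast_iff']
      push_cast
      rw [haval, ha']
    have hp401 : p < 401 := by
      have := hbig 1 hd.ge
      rw [pow_one] at this
      omega
    obtain ⟨e, he, hep, hev⟩ := primeTable_complete p hp401 hodd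
      (fun d _ h1 h2 h ↦ by
        rcases (Nat.dvd_prime hp.out).1 (Nat.dvd_of_mod_eq_zero h) with h | h <;> omega) hpos
      a.val (ZMod.val_lt a) hmodp
    refine isPrincipal_of_coord_mem (c := e.2.2) ?_ hmax.ne_top
      (by rw [primeTable_spec e he, hep]; exact hp.out)
    have := hmod e.2.2 _ hxa
    rw [hInt _ hev, mul_eq_zero] at this
    exact Ideal.Quotient.eq_zero_iff_mem.1 (this.resolve_left h4)
  · have h20 : p ≤ 20 := by
      by_contra! h
      have := hbig 2 hd
      nlinarith
    have hf2 : 2 ≤ f := hd.trans hdf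
    have hfin (τ : Coord) (hτ : τ.norm.natAbs = p ^ 2) (hm : τ.toInt ∈ P) :
        Submodule.IsPrincipal P := by
      refine ⟨_, eq_span_of_absNorm_eq hm h0' ?_⟩
      have h : Ideal.absNorm P ∣ Ideal.absNorm (Ideal.span {τ.toInt}) :=
        Ideal.absNorm_dvd_absNorm_of_le ((Ideal.span_singleton_le_iff_mem P).2 hm)
      rw [Coord.absNorm_span, hτ] at h ⊢
      rw [hpow] at h ⊢
      rw [le_antisymm ((Nat.pow_dvd_pow_iff_le_right hpos).1 h) hf2]
    obtain rfl | rfl | rfl : p = 13 ∨ p = 17 ∨ p = 19 := by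
      have := hp.out
      clear_value q f x
      clear hmod hInt hfin hbig
      interval_cases p <;> first | omega | (exfalso; revert this; norm_num)
    · have hd2 : q.natDegree = 2 := by
        by_contra h
        have := hbig 3 (by omega)
        norm_num at this
      obtain ⟨u, v, h⟩ := remainder_of_dvd hqm hd2 hdvd
      exact absurd h (no_remainder_zmod (by tauto) u v)
    · have hpr : (17 : 𝓞 K) ∈ P := by exact_mod_cast hpP
      rw [show (17 : 𝓞 K) = ((17 : ℤ) : 𝓞 K) by norm_num, ← Coord.toInt_int, seventeen_eq] at hpr
      simp only [Coord.toInt_mul] at hpr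
      rcases hP.mem_or_mem hpr with h | h
      · exact absurd (Ideal.eq_top_of_isUnit_mem P h unitW_isUnit) hmax.ne_top
      rcases hP.mem_or_mem h with h | h
      · exact hfin _ (by decide +kernel) h
      rcases hP.mem_or_mem h with h | h
      · exact isPrincipal_of_coord_mem h hmax.ne_top (by decide +kernel)
      rcases hP.mem_or_mem h with h | h <;>
      exact isPrincipal_of_coord_mem h hmax.ne_top (by decide +kernel)
    · have hpr : (19 : 𝓞 K) ∈ P := by exact_mod_cast hpP
      rw [show (19 : 𝓞 K) = ((19 : ℤ) : 𝓞 K) by norm_num, ← Coord.toInt_int, nineteen_eq] at hpr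
      simp only [Coord.toInt_mul] at hpr
      rcases hP.mem_or_mem hpr with h | h
      · exact absurd (Ideal.eq_top_of_isUnit_mem P h unitW_isUnit) hmax.ne_top
      rcases hP.mem_or_mem h with h | h
      · exact hfin _ (by decide +kernel) h
      rcases hP.mem_or_mem h with h | h
      · exact isPrincipal_of_coord_mem h hmax.ne_top (by decide +kernel)
      rcases hP.mem_or_mem h with h | h <;>
      exact isPrincipal_of_coord_mem h hmax.ne_top (by decide +kernel)

theorem isPrincipal_of_norm_le_minkowski : IsPrincipalIdealRing (𝓞 K) := by
  refine RingOfIntegers.isPrincipalIdealRing_of_isPrincipal_of_norm_le_of_isPrime ?_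
  intro I hI hle
  have h : (Ideal.absNorm (I : Ideal (𝓞 K)) : ℝ) < 401 := hle.trans_lt minkowski_lt
  have h' : Ideal.absNorm (I : Ideal (𝓞 K)) < 401 := by exact_mod_cast h
  exact isPrincipal_of_norm_le (nonZeroDivisors.coe_ne_zero I) (by omega)

instance : IsPrincipalIdealRing (𝓞 K) := isPrincipal_of_norm_le_minkowski

namespace Coord

/-- Coordinatewise reduction. -/
def mod (a : Coord) (m : ℤ) : Coord := ⟨a.c0 % m, a.c1 % m, a.c2 % m, a.c3 % m, a.c4 % m⟩

/-- The elements with coordinates in `{0, 1, 2, 3}`. -/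
def residues : List Coord :=
  [0, 1, 2, 3].flatMap fun a ↦ [0, 1, 2, 3].flatMap fun b ↦ [0, 1, 2, 3].flatMap fun c ↦
    [0, 1, 2, 3].flatMap fun d ↦ [0, 1, 2, 3].map fun e ↦ ⟨a, b, c, d, e⟩

theorem mod_four_mem_residues (a : Coord) : a.mod 4 ∈ residues := by
  have h (x : ℤ) : x % 4 ∈ ([0, 1, 2, 3] : List ℤ) := by
    have : x % 4 = 0 ∨ x % 4 = 1 ∨ x % 4 = 2 ∨ x % 4 = 3 := by omega
    simpa using this
  simp only [residues, List.mem_flatMap, List.mem_map]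
  exact ⟨_, h _, _, h _, _, h _, _, h _, _, h _, rfl⟩

/-- The first fundamental unit. -/
def e1 : Coord := ⟨29, -81, 66, -20, -8⟩

/-- The second fundamental unit. -/
def e2 : Coord := ⟨3573, 316, -280, 213, 374⟩

/-- The unit element. -/
def one : Coord := ⟨1, 0, 0, 0, 0⟩

theorem toInt_one : one.toInt = 1 := by rw [one, toInt_int, Int.cast_one]

/-- The representatives `e1 ^ i e2 ^ j πa ^ k` of the relevant square classes. -/
def delta (i j k : Bool) : Coord :=
  ((if i then e1 else one).mul (if j then e2 else one)).mul (if k then πa else one)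

theorem delta_mul_sq_mod : ∀ i j k, ∀ g ∈ residues, ∀ t, ((delta i j k).mul (g.mul g)).mod 8 = t →
    t.c1 = 0 → t.c2 = 0 → t.c3 = 0 → t.c4 % 4 = 0 → t.c0 % 2 = 1 →
    t.c0 = 1 ∧ t.c4 = 0 ∧ i = false ∧ j = false ∧ k = false := by
  simp only [forall_eq']
  decide +kernel

theorem lambda_delta_mul_sq_mod : ∀ i j k, ∀ g ∈ residues, ∀ t,
    ((Coord.mul ⟨0, -2, 0, 4, -11⟩ (delta i j k)).mul (g.mul g)).mod 8 = t →
    t.c0 = 0 → t.c2 = 0 → t.c3 = 0 → t.c1 % 4 = 0 → t.c4 % 2 = 1 →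
    i = false ∧ j = false ∧ k = false ∧ t.c4 = 1 ∨
      i = false ∧ j = true ∧ k = true ∧ t.c4 = 7 := by
  simp only [forall_eq']
  decide +kernel

theorem mod_eq_of_toInt {a b d : Coord} (h : a.toInt = b.toInt + 8 * d.toInt) :
    a.mod 8 = b.mod 8 := by
  have : a = b.add (d.smul 8) := toInt_inj (by rw [h, toInt_add, toInt_smul]; push_cast; rfl)
  subst this
  simp [mod, add, smul]

/-- An element that equals `δ` times a square is so modulo `8`, with a square of a small
element. -/
theorem exists_residue {δ c : Coord} {γ : 𝓞 K} (h : c.toInt = δ.toInt * γ ^ 2) :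
    ∃ g ∈ residues, (δ.mul (g.mul g)).mod 8 = c.mod 8 := by
  obtain ⟨a, ha⟩ := exists_coord γ
  refine ⟨a.mod 4, mod_four_mem_residues a, ?_⟩
  set b : Coord := ⟨a.c0 / 4, a.c1 / 4, a.c2 / 4, a.c3 / 4, a.c4 / 4⟩ with hb
  have hab : a.toInt = (a.mod 4).toInt + 4 * b.toInt := by
    have : a = (a.mod 4).add (b.smul 4) := by
      ext <;> simp [mod, add, smul, hb, Int.emod_add_mul_ediv]
    conv_lhs => rw [this, toInt_add, toInt_smul]
    push_cast; rfl
  refine mod_eq_of_toInt (d := (c.smul ((647329 ^ 2 - 1) / 8)).add ((δ.mul (((a.mod 4).mul b).add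
    ((b.mul b).smul 2))).smul (-1))) ?_
  simp only [toInt_mul, toInt_add, toInt_smul]
  norm_num
  rw [← ha] at hab
  set g := (a.mod 4).toInt
  have hg : g = 647329 * γ - 4 * b.toInt := by rw [hab]; ring
  rw [hg]
  linear_combination -647329 ^ 2 * h

theorem one_eq_delta {i j k : Bool} {γ : 𝓞 K} {c : Coord}
    (h : c.toInt = (delta i j k).toInt * γ ^ 2)
    (h0 : c.c0 % 2 = 1) (h1 : c.c1 % 8 = 0) (h2 : c.c2 % 8 = 0) (h3 : c.c3 % 8 = 0)
    (h4 : c.c4 % 4 = 0) :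
    c.c0 % 8 = 1 ∧ c.c4 % 8 = 0 ∧ i = false ∧ j = false ∧ k = false := by
  obtain ⟨g, hg, hg'⟩ := exists_residue h
  exact delta_mul_sq_mod i j k g hg _ hg' h1 h2 h3 (by simp only [mod]; omega)
    (by simp only [mod]; omega)

end Coord

section squareClasses
variable {G : Type*} [CommGroup G]

theorem isSquare_trans {a b c : G} (h1 : IsSquare (a * b)) (h2 : IsSquare (b * c)) :
    IsSquare (a * c) := by
  obtain ⟨r, hr⟩ := h1
  obtain ⟨s, hs⟩ := h2
  refine ⟨r * s * b⁻¹, ?_⟩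
  calc a * c = (a * b) * (b * c) * (b⁻¹ * b⁻¹) := by
        rw [← mul_inv]; rw [eq_mul_inv_iff_mul_eq]; simp only [mul_comm, mul_left_comm]
    _ = _ := by rw [hr, hs]; simp only [mul_comm, mul_left_comm, mul_assoc]

/-- If finitely many elements represent all square classes, as many pairwise inequivalent
elements do. -/
theorem represent_of_independent {ι : Type*} [Finite ι] {f e : ι → G}
    (hf : ∀ u, ∃ t, IsSquare (u * f t)) (he : ∀ t t', IsSquare (e t * e t') → t = t') (u : G) :
    ∃ t, IsSquare (u * e t) := by
  choose σ hσ using fun t ↦ hf (e t)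
  have hinj : Function.Injective σ := fun t t' h ↦ he t t' (isSquare_trans (hσ t) (by
    rw [h, mul_comm]; exact hσ t'))
  obtain ⟨t, ht⟩ := hf u
  obtain ⟨t', rfl⟩ := Finite.injective_iff_surjective.1 hinj t
  exact ⟨t', isSquare_trans ht (by rw [mul_comm]; exact hσ t')⟩

/-- The power of `x` with exponent `0` or `1`. -/
def bpow (x : G) (b : Bool) : G := if b then x else 1

theorem bpow_mul_bpow (x : G) (a b : Bool) :
    bpow x a * bpow x b = bpow x (xor a b) * (bpow x (a && b) * bpow x (a && b)) := by
  cases a <;> cases b <;> simp [bpow]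

theorem isSquare_zpow_mul_bpow (x : G) (n : ℤ) : ∃ b, IsSquare (x ^ n * bpow x b) := by
  obtain ⟨k, rfl | rfl⟩ := Int.even_or_odd' n
  · exact ⟨false, x ^ k, by simp [bpow, two_mul, zpow_add]⟩
  · refine ⟨true, x ^ (k + 1), ?_⟩
    simp only [bpow, if_true]
    rw [← zpow_add_one, ← zpow_add]
    congr 1
    ring

end squareClasses

theorem rank_K : Units.rank K = 2 := by
  rw [Units.rank, InfinitePlace.card_eq_nrRealPlaces_add_nrComplexPlaces, nrRealPlaces_K,
    nrComplexPlaces_K]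

/-- `e1` as a unit. -/
noncomputable def unit1 : (𝓞 K)ˣ :=
  .mkOfMulEqOne Coord.e1.toInt (⟨133, 3, 8, 8, 12⟩ : Coord).toInt (by
    rw [← Coord.toInt_mul, show Coord.e1.mul ⟨133, 3, 8, 8, 12⟩ = .one by decide +kernel,
      Coord.toInt_one])

/-- `e2` as a unit. -/
noncomputable def unit2 : (𝓞 K)ˣ :=
  .mkOfMulEqOne Coord.e2.toInt (⟨9193, -30451, -4384, 11009, 7400⟩ : Coord).toInt (by
    rw [← Coord.toInt_mul, show Coord.e2.mul ⟨9193, -30451, -4384, 11009, 7400⟩ = .one by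
      decide +kernel, Coord.toInt_one])

/-- The units `± e1 ^ i * e2 ^ j` with exponents `0` or `1`. -/
noncomputable def unitRep (t : Bool × Bool × Bool) : (𝓞 K)ˣ :=
  bpow (-1) t.1 * (bpow unit1 t.2.1 * bpow unit2 t.2.2)

theorem coe_unitRep (s i j : Bool) :
    (unitRep (s, i, j) : 𝓞 K) = (if s then -1 else 1) * (Coord.delta i j false).toInt := by
  cases s <;> cases i <;> cases j <;>
    simp [unitRep, bpow, Coord.delta, Coord.toInt_mul, Coord.toInt_one, unit1, unit2]

theorem eq_false_of_isSquare_unitRep {t : Bool × Bool × Bool} (h : IsSquare (unitRep t)) :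
    t = (false, false, false) := by
  obtain ⟨s, i, j⟩ := t
  obtain ⟨w, hw⟩ := h
  have h1 : (unitRep (s, i, j) : 𝓞 K) * ((w⁻¹ : (𝓞 K)ˣ) : 𝓞 K) ^ 2 = 1 := by
    rw [← Units.val_pow_eq_pow_val, ← Units.val_mul, hw, ← sq, ← mul_pow, mul_inv_cancel, one_pow,
      Units.val_one]
  rw [coe_unitRep] at h1
  cases s
  · have := Coord.one_eq_delta (c := .one) (i := i) (j := j) (k := false)
      (γ := ((w⁻¹ : (𝓞 K)ˣ) : 𝓞 K))
      (by rw [Coord.toInt_one]; simpa using h1.symm) (by decide) (by decide) (by decide)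
      (by decide) (by decide)
    simp [this]
  · have := Coord.one_eq_delta (c := ⟨-1, 0, 0, 0, 0⟩) (i := i) (j := j) (k := false)
      (γ := ((w⁻¹ : (𝓞 K)ˣ) : 𝓞 K))
      (by
        rw [Coord.toInt_int]
        simp only [if_true] at h1
        push_cast
        linear_combination h1) (by decide) (by decide) (by decide)
      (by decide) (by decide)
    simp at this

theorem eq_of_isSquare_unitRep_mul (t t' : Bool × Bool × Bool)
    (h : IsSquare (unitRep t * unitRep t')) : t = t' := by
  have key : unitRep t * unitRep t' = unitRep (xor t.1 t'.1, xor t.2.1 t'.2.1, xor t.2.2 t'.2.2) *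
      (unitRep (t.1 && t'.1, t.2.1 && t'.2.1, t.2.2 && t'.2.2) *
        unitRep (t.1 && t'.1, t.2.1 && t'.2.1, t.2.2 && t'.2.2)) := by
    simp only [unitRep]
    rw [mul_mul_mul_comm, mul_mul_mul_comm (bpow unit1 _), bpow_mul_bpow, bpow_mul_bpow unit1,
      bpow_mul_bpow unit2]
    simp only [mul_comm, mul_left_comm, mul_assoc]
  rw [key] at h
  obtain ⟨r, hr⟩ := h
  have := eq_false_of_isSquare_unitRep ⟨r * (unitRep _)⁻¹, by
    rw [mul_mul_mul_comm, ← hr, mul_assoc, ← mul_inv, mul_inv_cancel, mul_one]⟩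
  have hx : ∀ a b : Bool, xor a b = false → a = b := by decide
  simp only [Prod.mk.injEq] at this
  exact Prod.ext (hx _ _ this.1) (Prod.ext (hx _ _ this.2.1) (hx _ _ this.2.2))

theorem exists_unitRep (u : (𝓞 K)ˣ) : ∃ t, IsSquare (u * unitRep t) := by
  let F (i : Fin 2) : (𝓞 K)ˣ := Units.fundSystem K (finCongr rank_K.symm i)
  refine represent_of_independent (f := fun t : Bool × Bool × Bool ↦
    bpow (-1) t.1 * (bpow (F 0) t.2.1 * bpow (F 1) t.2.2)) (fun u ↦ ?_)
    eq_of_isSquare_unitRep_mul u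
  obtain ⟨⟨ζ, e⟩, hu, -⟩ := Units.exist_unique_eq_mul_prod K u
  simp only at hu
  rw [← Equiv.prod_comp (finCongr rank_K.symm), Fin.prod_univ_two] at hu
  obtain ⟨s, hs⟩ : ∃ s, IsSquare ((ζ : (𝓞 K)ˣ) * bpow (-1) s) := by
    rcases Units.torsion_eq_one_or_neg_one_of_odd_finrank (K := K)
      (by rw [finrank_K]; decide) ζ with h | h
    · exact ⟨false, 1, by simp [h, bpow]⟩
    · exact ⟨true, 1, by simp [h, bpow]⟩
  obtain ⟨i, hi⟩ := isSquare_zpow_mul_bpow (F 0) (e (finCongr rank_K.symm 0))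
  obtain ⟨j, hj⟩ := isSquare_zpow_mul_bpow (F 1) (e (finCongr rank_K.symm 1))
  refine ⟨(s, i, j), ?_⟩
  rw [hu, mul_mul_mul_comm, mul_mul_mul_comm (_ ^ _)]
  exact hs.mul (hi.mul hj)

/-- Every unit is, up to sign and squares, a product of the two fundamental units. -/
theorem unit_eq (u : (𝓞 K)ˣ) : ∃ (i j : Bool) (v : 𝓞 K),
    (u : 𝓞 K) = (Coord.delta i j false).toInt * v ^ 2 ∨
      (u : 𝓞 K) = -((Coord.delta i j false).toInt * v ^ 2) := by
  obtain ⟨⟨s, i, j⟩, w, hw⟩ := exists_unitRep u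
  refine ⟨i, j, ((w * (unitRep (s, i, j))⁻¹ : (𝓞 K)ˣ) : 𝓞 K), ?_⟩
  have h : u = unitRep (s, i, j) * (w * (unitRep (s, i, j))⁻¹) ^ 2 := by
    rw [sq, mul_mul_mul_comm, ← hw, mul_comm]
    group
  have h' := congrArg (Units.val) h
  rw [Units.val_mul, coe_unitRep, Units.val_pow_eq_pow_val] at h'
  cases s
  · left; simpa using h'
  · right; simpa using h'

/-- The polynomial `X ^ 5 + 11 X ^ 4 + 64`. -/
noncomputable def curvePoly : ℤ[X] := X ^ 5 + C 11 * X ^ 4 + C 64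

theorem not_sq_dvd_discriminant {p : ℕ} (hp : p.Prime) (h2 : p ≠ 2)
    (h : (p : ℤ) ^ 2 ∣ 41429056) : False := by
  have h' : p ^ 2 ∣ 2 ^ 6 * (251 * 2579) := by exact_mod_cast h
  have hc : Nat.Coprime (p ^ 2) (2 ^ 6) :=
    Nat.Coprime.pow _ _ ((Nat.coprime_primes hp Nat.prime_two).2 h2)
  have h3 := hc.dvd_of_dvd_mul_left h'
  have h4 : p ∣ 251 * 2579 := (dvd_pow_self p two_ne_zero).trans h3
  rcases (hp.dvd_mul).1 h4 with h5 | h5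
  · rw [(Nat.prime_dvd_prime_iff_eq hp (by norm_num)).1 h5] at h3
    norm_num at h3
  · rw [(Nat.prime_dvd_prime_iff_eq hp (by norm_num)).1 h5] at h3
    norm_num at h3

section residueField

variable {κ : Type*} [Field κ] {p : ℕ} [hp : Fact p.Prime] {t : κ}
  {U V W : ℤ[X]} {D : ℤ}

theorem dvd_of_common_root [CharP κ p] (ht : t ^ 5 + 11 * t ^ 4 + 64 = 0) (h2 : p ≠ 2) (h3 : p ≠ 3)
    (h : V ^ 2 - U * W = C (3 * D ^ 2) * curvePoly) (hU : aeval t U = 0) (hW : aeval t W = 0) :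
    (p : ℤ) ∣ D := by
  by_contra hD
  have hz (n : ℤ) : (n : κ) = 0 ↔ (p : ℤ) ∣ n := CharP.intCast_eq_zero_iff κ p n
  have hpZ : Prime (p : ℤ) := Nat.prime_iff_prime_int.1 hp.out
  have hne (q : ℕ) (hq : q.Prime) (hpq : p ≠ q) : (q : κ) ≠ 0 := fun h0 ↦
    hpq ((Nat.prime_dvd_prime_iff_eq hp.out hq).1 ((CharP.cast_eq_zero_iff κ p q).1 h0))
  have h2' : (2 : κ) ≠ 0 := by exact_mod_cast hne 2 Nat.prime_two h2
  have h3' : (3 : κ) ≠ 0 := by exact_mod_cast hne 3 Nat.prime_three h3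
  have hD' : (D : κ) ≠ 0 := fun h0 ↦ hD ((hz D).1 h0)
  have hf : aeval t curvePoly = 0 := by
    simp only [curvePoly, map_add, map_mul, map_pow, aeval_C, aeval_X]
    simpa using ht
  have hV : aeval t V = 0 := by
    have := congrArg (aeval t) h
    simp only [map_sub, map_mul, map_pow, hU, hf, mul_zero, zero_mul, sub_zero] at this
    exact pow_eq_zero_iff two_ne_zero |>.1 this
  have hder := congrArg (fun P ↦ aeval t (derivative P)) h
  simp only [derivative_mul, derivative_pow, map_sub, map_add, map_mul, hU, hV, hW,
    derivative_C, zero_mul, mul_zero, add_zero, zero_add, curvePoly, derivative_X,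
    map_pow, aeval_C, aeval_X] at hder
  have ht0 : t ≠ 0 := by
    rintro rfl
    have : (2 : κ) ^ 6 = 0 := by norm_num at ht ⊢; exact ht
    exact h2' (pow_eq_zero_iff (by norm_num) |>.1 this)
  have h5t : 5 * t + 44 = 0 := by
    have : 3 * (D : κ) ^ 2 * t ^ 3 * (5 * t + 44) = 0 := by
      simp at hder
      rcases hder with (h | h) | h
      · exact absurd h h3'
      · exact absurd h hD'
      · linear_combination 3 * (D : κ) ^ 2 * h
    simpa [h3', hD', ht0] using this
  have h5 : p ≠ 5 := by
    rintro rfl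
    have h50 : (5 : κ) = 0 := by exact_mod_cast CharP.cast_eq_zero κ 5
    have : ((44 : ℤ) : κ) = 0 := by push_cast; linear_combination h5t - t * h50
    have := (hz 44).1 this
    norm_num at this
  have h5' : (5 : κ) ≠ 0 := by exact_mod_cast hne 5 Nat.prime_five h5
  obtain ⟨a, b, hab⟩ : IsCoprime (5 : ℤ) p := by
    exact_mod_cast Nat.isCoprime_iff_coprime.2
      ((Nat.coprime_primes Nat.prime_five hp.out).2 (Ne.symm h5))
  have hr5 : (p : ℤ) ∣ 5 * (-44 * a) + 44 := ⟨44 * b, by linear_combination -44 * hab⟩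
  set r : ℤ := -44 * a with hr
  have htr : t = r := by
    have := (hz _).2 hr5
    push_cast at this
    exact mul_left_cancel₀ h5' (by linear_combination h5t - this)
  have hev (P : ℤ[X]) (hP : aeval t P = 0) : (p : ℤ) ∣ P.eval r := by
    rw [← hz, ← hP, htr]
    simpa using (aeval_algebraMap_apply κ r P).symm
  have hev' := congrArg (eval r) h
  simp only [eval_sub, eval_pow, eval_mul, eval_C, curvePoly, eval_add, eval_X] at hev'
  have hdvd : (p : ℤ) ^ 2 ∣ (3 * D ^ 2) * (r ^ 5 + 11 * r ^ 4 + 64) := by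
    rw [← hev']
    refine dvd_sub (pow_dvd_pow_of_dvd (hev V hV) 2) ?_
    rw [sq]
    exact mul_dvd_mul (hev U hU) (hev W hW)
  have h3D : ¬ (p : ℤ) ∣ 3 * D ^ 2 := by
    rw [← hz]; push_cast
    exact mul_ne_zero h3' (pow_ne_zero 2 hD')
  have hdvd' := hpZ.pow_dvd_of_dvd_mul_left 2 h3D hdvd
  refine not_sq_dvd_discriminant hp.out h2 ?_
  have h6 : (p : ℤ) ^ 2 ∣ (5 * r + 44) ^ 2 := pow_dvd_pow_of_dvd hr5 2
  have : (41429056 : ℤ) = 3125 * (r ^ 5 + 11 * r ^ 4 + 64) - (5 * r + 44) ^ 2 *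
      (125 * r ^ 3 - 825 * r ^ 2 + 4840 * r - 21296) := by ring
  rw [this]
  exact dvd_sub (dvd_mul_of_dvd_right hdvd' _) (dvd_mul_of_dvd_left h6 _)

theorem exists_reduction [Algebra (ZMod p) κ] [Finite κ]
    (hU0 : U.map (Int.castRingHom (ZMod p)) ≠ 0)
    (hdeg : U.natDegree ≤ 2) (h : V ^ 2 - U * W = C (3 * (p * D) ^ 2) * curvePoly)
    (hU : aeval t U = 0) (hW : aeval t W = 0) :
    ∃ V' W' : ℤ[X], V' ^ 2 - U * W' = C (3 * D ^ 2) * curvePoly := by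
  set φ := Int.castRingHom (ZMod p)
  have ht : IsIntegral (ZMod p) t := Algebra.IsIntegral.isIntegral t
  have hker (P : ℤ[X]) : P.map φ = 0 ↔ C (p : ℤ) ∣ P := by
    rw [C_dvd_iff_dvd_coeff, Polynomial.ext_iff]
    refine forall_congr' fun n ↦ ?_
    rw [coeff_map, coeff_zero, eq_intCast, ZMod.intCast_zmod_eq_zero_iff_dvd]
  have hCp : Prime (C (p : ℤ)) := prime_C_iff.2 (Nat.prime_iff_prime_int.1 hp.out)
  have hmap (P : ℤ[X]) (hP : aeval t P = 0) : minpoly (ZMod p) t ∣ P.map φ := by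
    refine minpoly.dvd _ _ ?_
    have := aeval_map_algebraMap (ZMod p) t P
    rwa [hP] at this
  have hmod : V.map φ ^ 2 = U.map φ * W.map φ := by
    have : (V ^ 2 - U * W).map φ = 0 := by
      rw [hker, h]
      exact ⟨C (3 * (p * D ^ 2)) * curvePoly, by rw [← mul_assoc, ← C_mul]; congr 2; ring⟩
    rwa [Polynomial.map_sub, Polynomial.map_mul, Polynomial.map_pow, sub_eq_zero] at this
  have hV : aeval t V = 0 := by
    have h1 := aeval_map_algebraMap (ZMod p) t V
    have h2 := aeval_map_algebraMap (ZMod p) t U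
    have := congrArg (aeval t) hmod
    rw [map_mul, map_pow] at this
    erw [h1, h2, hU] at this
    rw [zero_mul] at this
    exact pow_eq_zero_iff two_ne_zero |>.1 this
  obtain ⟨u, hu⟩ := hmap U hU
  obtain ⟨v, hv⟩ := hmap V hV
  obtain ⟨w, hw⟩ := hmap W hW
  have hμ := minpoly.ne_zero ht
  have hvuw : v ^ 2 = u * w := by
    rw [hu, hv, hw] at hmod
    exact mul_left_cancel₀ (pow_ne_zero 2 hμ) (by linear_combination hmod)
  have hu0 : u ≠ 0 := by rintro rfl; exact hU0 (by rw [hu, mul_zero])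
  have hud : u.natDegree ≤ 1 := by
    have h1 : (U.map φ).natDegree ≤ 2 := natDegree_map_le.trans hdeg
    rw [hu, natDegree_mul hμ hu0] at h1
    have := minpoly.natDegree_pos ht
    omega
  have huv : u ∣ v := by
    rcases Nat.le_one_iff_eq_zero_or_eq_one.1 hud with h0 | h1
    · have : IsUnit u := isUnit_iff_degree_eq_zero.2 (by rw [degree_eq_natDegree hu0, h0]; rfl)
      exact this.dvd
    · have : Prime u := (irreducible_of_degree_eq_one
        (by rw [degree_eq_natDegree hu0, h1]; rfl)).prime
      exact this.dvd_of_dvd_pow ⟨w, hvuw⟩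
  obtain ⟨m', hm'⟩ := huv
  obtain ⟨m, rfl⟩ := map_surjective φ ZMod.intCast_surjective m'
  obtain ⟨V1, hV1⟩ : C (p : ℤ) ∣ V - m * U := by
    rw [← hker, Polynomial.map_sub, Polynomial.map_mul, hv, hu, hm']
    ring
  have hVe : V = m * U + C (p : ℤ) * V1 := by linear_combination hV1
  obtain ⟨W1, hW1⟩ : C (p : ℤ) ^ 2 ∣ W - m ^ 2 * U - 2 * m * C (p : ℤ) * V1 := by
    refine hCp.pow_dvd_of_dvd_mul_left 2 (mt (hker U).2 hU0)
      ⟨V1 ^ 2 - C (3 * D ^ 2) * curvePoly, ?_⟩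
    rw [hVe] at h
    simp only [C_mul, C_pow] at h ⊢
    linear_combination -h
  refine ⟨V1, W1, mul_left_cancel₀ (pow_ne_zero 2 hCp.ne_zero) ?_⟩
  rw [hVe] at h
  simp only [C_mul, C_pow] at h ⊢
  linear_combination h + U * hW1

/-- The cofactor of `U` can be taken nonzero at a common root. -/
theorem exists_cofactor_ne_zero [CharP κ p] [Algebra (ZMod p) κ] [Finite κ]
    (ht : t ^ 5 + 11 * t ^ 4 + 64 = 0) (h2 : p ≠ 2) (h3 : p ≠ 3)
    (hU0 : U.map (Int.castRingHom (ZMod p)) ≠ 0) (hdeg : U.natDegree ≤ 2) (hU : aeval t U = 0)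
    (hD : D ≠ 0) (h : V ^ 2 - U * W = C (3 * D ^ 2) * curvePoly) :
    ∃ (V' W' : ℤ[X]) (D' : ℤ), V' ^ 2 - U * W' = C (3 * D' ^ 2) * curvePoly ∧ aeval t W' ≠ 0 := by
  induction hn : D.natAbs using Nat.strong_induction_on generalizing D V W with
  | _ n ih =>
    subst hn
    by_cases hW : aeval t W = 0
    · obtain ⟨E, rfl⟩ := dvd_of_common_root ht h2 h3 h hU hW
      obtain ⟨V', W', h'⟩ := exists_reduction hU0 hdeg h hU hW
      have hE : E ≠ 0 := right_ne_zero_of_mul hD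
      refine ih E.natAbs ?_ hE h' rfl
      rw [Int.natAbs_mul, Int.natAbs_natCast]
      exact lt_mul_of_one_lt_left (Int.natAbs_pos.2 hE) hp.out.one_lt
    · exact ⟨V, W, D, h, hW⟩

end residueField

section evenMultiplicity
variable {R : Type*} [CommRing R]

/-- `x` is exactly divisible by an even power of `q`. -/
def EvenAt (q x : R) : Prop := ∃ (m : ℕ) (y : R), x = q ^ (2 * m) * y ∧ ¬ q ∣ y

theorem evenAt_of_not_dvd {q x : R} (h : ¬ q ∣ x) : EvenAt q x := ⟨0, x, by simp, h⟩

variable [IsDomain R]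

theorem evenAt_of_mul_eq_sq [WfDvdMonoid R] {q x w v : R} (hq : Prime q) (hx : x ≠ 0)
    (hw : ¬ q ∣ w) (h : x * w = v ^ 2) : EvenAt q x := by
  have hw0 : w ≠ 0 := fun h0 ↦ hw (h0 ▸ dvd_zero q)
  have hv0 : v ≠ 0 := by
    rintro rfl
    rw [zero_pow two_ne_zero] at h
    exact mul_ne_zero hx hw0 h
  obtain ⟨a, y, hy, rfl⟩ := WfDvdMonoid.max_power_factor hx hq.irreducible
  obtain ⟨b, z, hz, rfl⟩ := WfDvdMonoid.max_power_factor hv0 hq.irreducible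
  have hyw : ¬ q ∣ y * w := hq.not_dvd_mul hy hw
  have hzz : ¬ q ∣ z ^ 2 := fun h ↦ hz (hq.dvd_of_dvd_pow h)
  have key : q ^ a * (y * w) = q ^ (2 * b) * z ^ 2 := by rw [← mul_assoc, h]; ring
  rcases lt_trichotomy a (2 * b) with hab | hab | hab
  · obtain ⟨k, hk⟩ := Nat.exists_eq_add_of_lt hab
    rw [hk, add_assoc, pow_add, mul_assoc] at key
    refine absurd ⟨q ^ k * z ^ 2, ?_⟩ hyw
    rw [mul_left_cancel₀ (pow_ne_zero a hq.ne_zero) key]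
    ring
  · exact ⟨b, y, by rw [hab], hy⟩
  · obtain ⟨k, hk⟩ := Nat.exists_eq_add_of_lt hab
    rw [hk, add_assoc, pow_add, mul_assoc] at key
    refine absurd ⟨q ^ k * (y * w), ?_⟩ hzz
    rw [← mul_left_cancel₀ (pow_ne_zero _ hq.ne_zero) key]
    ring

theorem EvenAt.of_mul_left {q a x : R} (hq : Prime q) (ha : ¬ q ∣ a) (h : EvenAt q (a * x)) :
    EvenAt q x := by
  obtain ⟨m, y, hxy, hy⟩ := h
  obtain ⟨z, rfl⟩ := hq.pow_dvd_of_dvd_mul_left _ ha ⟨y, hxy⟩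
  refine ⟨m, z, rfl, fun hz ↦ hy ?_⟩
  rw [mul_left_comm] at hxy
  rw [← mul_left_cancel₀ (pow_ne_zero _ hq.ne_zero) hxy]
  exact dvd_mul_of_dvd_right hz a

/-- An element with even multiplicity at all primes other than `π` is a square up to units and
powers of `π`. -/
theorem exists_eq_unit_mul_pow_mul_sq [IsPrincipalIdealRing R] {π : R} (hπ : Prime π) (x : R)
    (hx : x ≠ 0) (h : ∀ q, Prime q → ¬ Associated q π → EvenAt q x) :
    ∃ (u : Rˣ) (k : ℕ) (γ : R), x = u * π ^ k * γ ^ 2 := by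
  induction x using (wellFounded_dvdNotUnit (α := R)).induction with
  | _ x ih =>
    by_cases hu : IsUnit x
    · obtain ⟨u, rfl⟩ := hu
      exact ⟨u, 0, 1, by simp⟩
    obtain ⟨q, hqi, hqx⟩ := WfDvdMonoid.exists_irreducible_factor hu hx
    have hq : Prime q := hqi.prime
    by_cases hqπ : Associated q π
    · obtain ⟨y, rfl⟩ := hqπ.symm.dvd.trans hqx
      have hy : y ≠ 0 := right_ne_zero_of_mul hx
      obtain ⟨u, k, γ, hγ⟩ := ih y ⟨hy, π, hπ.not_isUnit, mul_comm _ _⟩ hy fun q' hq' hne ↦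
        (h q' hq' hne).of_mul_left hq' fun hd ↦ hne (hq'.associated_of_dvd hπ hd)
      exact ⟨u, k + 1, γ, by rw [hγ]; ring⟩
    · obtain ⟨m, y, rfl, hy⟩ := h q hq hqπ
      have hm : m ≠ 0 := by rintro rfl; simp at hqx; exact hy hqx
      have hy0 : y ≠ 0 := right_ne_zero_of_mul hx
      obtain ⟨u, k, γ, hγ⟩ := ih y ⟨hy0, q ^ (2 * m),
          mt (isUnit_pow_iff (by omega)).1 hq.not_isUnit, mul_comm _ _⟩ hy0 fun q' hq' hne ↦ by
        by_cases hqq : q' ∣ q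
        · exact evenAt_of_not_dvd fun hd ↦ hy ((hq'.associated_of_dvd hq hqq).symm.dvd.trans hd)
        · exact (h q' hq' hne).of_mul_left hq' fun hd ↦ hqq (hq'.dvd_of_dvd_pow hd)
      exact ⟨u, k, q ^ m * γ, by rw [hγ]; ring⟩

end evenMultiplicity

/-- The root `-4 / β` of `curvePoly`. -/
noncomputable def theta : 𝓞 K := (⟨-11, 0, 0, 0, -1⟩ : Coord).toInt

/-- The norm of `a + b θ + c θ ^ 2`. -/
def quadNorm {R : Type*} [CommRing R] (a b c : R) : R :=
  a ^ 5 - 11 * a ^ 4 * b + 121 * a ^ 4 * c - 320 * a ^ 2 * b * c ^ 2 + 1408 * a ^ 2 * c ^ 3 +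
    320 * a * b ^ 3 * c - 2816 * a * b ^ 2 * c ^ 2 - 64 * b ^ 5 + 704 * b ^ 4 * c + 4096 * c ^ 5

namespace Coord

/-- The coordinates of `a + b θ + c θ ^ 2`. -/
def quad (a b c : ℤ) : Coord := ⟨a - 11 * b + 121 * c, -2 * c, 0, 4 * c, -b + 11 * c⟩

theorem toInt_quad (a b c : ℤ) : (quad a b c).toInt = a + b * theta + c * theta ^ 2 := by
  rw [sq, theta, ← toInt_mul, ← toInt_smul, ← toInt_smul, ← toInt_int a, ← toInt_add, ← toInt_add]
  congr 1
  ext <;> simp [quad, add, smul, mul] <;> ring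

theorem norm_quad (a b c : ℤ) : (quad a b c).norm = quadNorm a b c := by
  simp [norm, quad, quadNorm, det5, det4, det3, std, mul]
  ring

end Coord

theorem theta_rel : theta ^ 5 + 11 * theta ^ 4 + 64 = 0 := by
  have h : theta ^ 5 + 11 * theta ^ 4 + 64 =
      theta ^ 2 * theta ^ 2 * (Coord.quad 11 1 0).toInt + (Coord.quad 64 0 0).toInt := by
    rw [Coord.toInt_quad, Coord.toInt_quad]
    push_cast
    ring
  have h2 : theta ^ 2 = (Coord.quad 0 0 1).toInt := by rw [Coord.toInt_quad]; simp
  rw [h, h2, ← Coord.toInt_mul, ← Coord.toInt_mul, ← Coord.toInt_add,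
    show ((((Coord.quad 0 0 1).mul (Coord.quad 0 0 1)).mul (Coord.quad 11 1 0)).add
      (Coord.quad 64 0 0)) = ⟨0, 0, 0, 0, 0⟩ by decide +kernel, Coord.toInt_int, Int.cast_zero]

theorem quad_ne_zero {a b c : ℤ} (ha : a ≠ 0) : (Coord.quad a b c).toInt ≠ 0 := by
  intro h
  have h0 : (Coord.quad a b c) = ⟨0, 0, 0, 0, 0⟩ :=
    Coord.toInt_inj (by rw [h, Coord.toInt_int, Int.cast_zero])
  rw [Coord.quad, Coord.mk.injEq] at h0
  omega

theorem quadNorm_zmod_three : ∀ a b c : ZMod 3, quadNorm a b c = 0 → a = 0 ∧ b = 0 ∧ c = 0 := by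
  unfold quadNorm
  decide +kernel

/-- The polynomial `a + b X + c X ^ 2`. -/
noncomputable def quadPoly (a b c : ℤ) : ℤ[X] := C a + C b * X + C c * X ^ 2

theorem aeval_quadPoly {S : Type*} [CommRing S] (t : S) (a b c : ℤ) :
    aeval t (quadPoly a b c) = a + b * t + c * t ^ 2 := by
  simp [quadPoly]

theorem natDegree_quadPoly_le (a b c : ℤ) : (quadPoly a b c).natDegree ≤ 2 := by
  unfold quadPoly
  compute_degree

theorem coeff_quadPoly (a b c : ℤ) (n : ℕ) : (quadPoly a b c).coeff n =
    if n = 0 then a else if n = 1 then b else if n = 2 then c else 0 := by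
  rcases n with _ | _ | _ | n <;> simp only [quadPoly, coeff_add, coeff_C, coeff_C_mul, coeff_X,
    coeff_X_pow] <;> simp

theorem associated_of_dvd_coord {π : 𝓞 K} (hπ : Prime π) {c : Coord} (hc : c.norm.natAbs.Prime)
    (h : π ∣ c.toInt) : Associated π c.toInt := by
  rw [← Ideal.span_singleton_eq_span_singleton]
  have : (Ideal.span {π}).IsPrime := (Ideal.span_singleton_prime hπ.ne_zero).2 hπ
  exact eq_span_of_absNorm_prime (Ideal.mem_span_singleton.2 h) this.ne_top
    (by rwa [Coord.absNorm_span])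

theorem prime_πa : Prime Coord.πa.toInt := by
  have h : Coord.πa.norm.natAbs = 2 := by decide +kernel
  have h0 : Coord.πa.toInt ≠ 0 := fun h0 ↦ by
    have := Coord.norm_toInt Coord.πa
    rw [h0, Algebra.norm_zero] at this
    rw [← this] at h
    simp at h
  rw [← Ideal.span_singleton_prime h0]
  refine Ideal.isPrime_of_irreducible_absNorm ?_
  rw [Coord.absNorm_span, h]
  exact Nat.prime_two

theorem evenAt_quad_of_ringHom {π : 𝓞 K} {κ : Type*} [Field κ] [Finite κ]
    (φ : 𝓞 K →+* κ) (hker : ∀ x, φ x = 0 ↔ π ∣ x) (hπ : Prime π) (hne : ¬ Associated π Coord.πa.toInt) {a b c : ℤ}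
    (ha : Odd a) (hprim : ∀ p : ℕ, p.Prime → ¬ ((p : ℤ) ∣ a ∧ (p : ℤ) ∣ b ∧ (p : ℤ) ∣ c))
    {V W : ℤ[X]} {D : ℤ} (hD : D ≠ 0)
    (h : V ^ 2 - quadPoly a b c * W = C (3 * D ^ 2) * curvePoly) :
    EvenAt π (Coord.quad a b c).toInt := by
  by_cases hdvd : π ∣ (Coord.quad a b c).toInt
  swap
  · exact evenAt_of_not_dvd hdvd
  have ha0 : a ≠ 0 := by rintro rfl; simp at ha
  obtain ⟨p, hchar⟩ := CharP.exists κ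
  have hp : Fact p.Prime := ⟨(CharP.char_is_prime_or_zero κ p).resolve_right
    (CharP.char_ne_zero_of_finite κ p)⟩
  let _ := ZMod.algebra κ p
  have hz (n : ℤ) : π ∣ n ↔ (p : ℤ) ∣ n := by
    rw [← hker, map_intCast, CharP.intCast_eq_zero_iff κ p]
  by_cases h2 : p = 2
  · have h2π : π ∣ 2 := by
      have := (hz 2).2 (by rw [h2]; norm_num)
      exact_mod_cast this
    rw [Coord.two_eq] at h2π
    have hM : π ∣ Coord.πM.toInt := by
      rcases hπ.dvd_or_dvd h2π with h | h
      · exact absurd (isUnit_of_dvd_unit h (IsUnit.of_mul_eq_one _ Coord.u_mul_uInv)) hπ.not_isUnit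
      rcases hπ.dvd_or_dvd h with h | h
      · refine absurd (associated_of_dvd_coord hπ ?_ h) hne
        decide +kernel
      · exact hπ.dvd_of_dvd_pow h
    have hθ : π ∣ theta := hM.trans ⟨(⟨-7, -8, -2, 2, 1⟩ : Coord).toInt, by
      rw [← Coord.toInt_mul, theta]
      congr 1⟩
    rw [Coord.toInt_quad, sq, ← mul_assoc, add_assoc, ← add_mul, dvd_add_left
      (dvd_mul_of_dvd_right hθ _), hz, h2] at hdvd
    exact absurd ha (Int.not_odd_iff_even.2 (even_iff_two_dvd.2 (by exact_mod_cast hdvd)))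
  have hzmod (n : ℤ) : (n : ZMod p) = 0 ↔ (p : ℤ) ∣ n := ZMod.intCast_zmod_eq_zero_iff_dvd n p
  by_cases h3 : p = 3
  · have hN : (p : ℤ) ∣ quadNorm a b c := by
      rw [← Coord.norm_quad, ← Int.dvd_natAbs, ← hz, Int.cast_natCast, ← Coord.absNorm_span,
        ]
      exact hdvd.trans (Ideal.mem_span_singleton.1 (Ideal.absNorm_mem _))
    subst h3
    rw [← hzmod] at hN
    have := quadNorm_zmod_three a b c (by rw [← hN]; simp [quadNorm])
    simp only [hzmod] at this
    exact absurd this (hprim 3 hp.out)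
  set t := φ theta with ht
  have hft : t ^ 5 + 11 * t ^ 4 + 64 = 0 := by
    have := congrArg φ theta_rel
    simpa only [map_add, map_mul, map_pow, map_ofNat, map_zero] using this
  have hmk (Q : ℤ[X]) : aeval t Q = φ (aeval theta Q) := by
    rw [ht, aeval_def, aeval_def, hom_eval₂]
    congr 1
    exact Subsingleton.elim _ _
  have hU : (Coord.quad a b c).toInt = aeval theta (quadPoly a b c) := by
    rw [aeval_quadPoly, Coord.toInt_quad]
  have hU0 : (quadPoly a b c).map (Int.castRingHom (ZMod p)) ≠ 0 := by
    intro h0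
    refine hprim p hp.out ⟨?_, ?_, ?_⟩ <;> rw [← hzmod]
    · simpa [coeff_quadPoly] using congrArg (coeff · 0) h0
    · simpa [coeff_quadPoly] using congrArg (coeff · 1) h0
    · simpa [coeff_quadPoly] using congrArg (coeff · 2) h0
  obtain ⟨V', W', D', h', hW'⟩ := exists_cofactor_ne_zero (U := quadPoly a b c) hft h2 h3 hU0
    (natDegree_quadPoly_le a b c) (by rw [hmk, hker, ← hU]; exact hdvd) hD h
  rw [hmk, Ne, hker] at hW'
  refine evenAt_of_mul_eq_sq (v := aeval theta V') hπ (quad_ne_zero ha0) hW' ?_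
  have := congrArg (aeval theta) h'
  simp only [curvePoly, map_sub, map_mul, map_pow, map_add, aeval_C, aeval_X] at this
  rw [hU]
  simp only [algebraMap_int_eq, eq_intCast] at this
  push_cast at this
  linear_combination -3 * (D' : 𝓞 K) ^ 2 * theta_rel - this

theorem evenAt_quad {π : 𝓞 K} (hπ : Prime π) (hne : ¬ Associated π Coord.πa.toInt) {a b c : ℤ}
    (ha : Odd a) (hprim : ∀ p : ℕ, p.Prime → ¬ ((p : ℤ) ∣ a ∧ (p : ℤ) ∣ b ∧ (p : ℤ) ∣ c))
    {V W : ℤ[X]} {D : ℤ} (hD : D ≠ 0)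
    (h : V ^ 2 - quadPoly a b c * W = C (3 * D ^ 2) * curvePoly) :
    EvenAt π (Coord.quad a b c).toInt := by
  have hP0 : Ideal.span {π} ≠ ⊥ := by rw [Ne, Ideal.span_singleton_eq_bot]; exact hπ.ne_zero
  have hmax : (Ideal.span {π}).IsMaximal :=
    ((Ideal.span_singleton_prime hπ.ne_zero).2 hπ).isMaximal hP0
  let _ := Ideal.Quotient.field (Ideal.span {π})
  have : Finite (𝓞 K ⧸ Ideal.span {π}) := Ideal.finiteQuotientOfFreeOfNeBot _ hP0
  refine evenAt_quad_of_ringHom (Ideal.Quotient.mk (Ideal.span {π})) (fun x ↦ ?_) hπ hne ha hprim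
    hD h
  rw [Ideal.Quotient.eq_zero_iff_mem, Ideal.mem_span_singleton]

/-- The descent map: a quadratic factor of `V ^ 2 - 3 D ^ 2 f` takes at `θ` a value in one of
finitely many square classes. -/
theorem quad_eq {a b c : ℤ}
    (ha : Odd a) (hprim : ∀ p : ℕ, p.Prime → ¬ ((p : ℤ) ∣ a ∧ (p : ℤ) ∣ b ∧ (p : ℤ) ∣ c))
    {V W : ℤ[X]} {D : ℤ} (hD : D ≠ 0)
    (h : V ^ 2 - quadPoly a b c * W = C (3 * D ^ 2) * curvePoly) :
    ∃ (i j k : Bool) (γ : 𝓞 K), (Coord.quad a b c).toInt = (Coord.delta i j k).toInt * γ ^ 2 ∨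
      (Coord.quad a b c).toInt = -((Coord.delta i j k).toInt * γ ^ 2) := by
  have ha0 : a ≠ 0 := by rintro rfl; simp at ha
  obtain ⟨u, n, γ, hγ⟩ := exists_eq_unit_mul_pow_mul_sq prime_πa _ (quad_ne_zero (b := b) (c := c)
    ha0) fun q hq hne ↦ evenAt_quad hq hne ha hprim hD h
  obtain ⟨i, j, v, hv⟩ := unit_eq u
  have hdelta : (Coord.delta i j true).toInt =
      (Coord.delta i j false).toInt * Coord.πa.toInt := by
    simp [Coord.delta, Coord.toInt_mul, Coord.toInt_one]
  rcases Nat.even_or_odd' n with ⟨m, rfl | rfl⟩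
  · refine ⟨i, j, false, v * Coord.πa.toInt ^ m * γ, ?_⟩
    rcases hv with hv | hv <;> rw [hγ, hv]
    · left; ring
    · right; ring
  · refine ⟨i, j, true, v * Coord.πa.toInt ^ m * γ, ?_⟩
    rcases hv with hv | hv <;> rw [hγ, hv, hdelta]
    · left; ring
    · right; ring

/-- The polynomial `x ^ 5 + 11 x ^ 4 + 64` over the rationals. -/
noncomputable def ratPoly : ℚ[X] := X ^ 5 + C 11 * X ^ 4 + C 64

/-- The polynomial `a + b X + c X ^ 2` over the rationals. -/
noncomputable def ratQuad (a b c : ℚ) : ℚ[X] := C a + C b * X + C c * X ^ 2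

/-- `a + b x + c x ^ 2` divides `V ^ 2 - 3 m ^ 2 f` for some `V` and `m ≠ 0`: it cuts out a divisor
on the curve `3 z ^ 2 = f(x)`. -/
def CutsDivisor (a b c : ℤ) : Prop :=
  ∃ (V W : ℚ[X]) (m : ℚ), m ≠ 0 ∧ V ^ 2 - ratQuad a b c * W = C (3 * m ^ 2) * ratPoly

theorem exists_int_map (V : ℚ[X]) :
    ∃ (N : ℤ) (V₀ : ℤ[X]), N ≠ 0 ∧ V₀.map (Int.castRingHom ℚ) = C (N : ℚ) * V := by
  obtain ⟨b, hb, h⟩ := IsLocalization.integerNormalization_spec (nonZeroDivisors ℤ) V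
  refine ⟨b, IsLocalization.integerNormalization (nonZeroDivisors ℤ) V,
    nonZeroDivisors.ne_zero hb, ?_⟩
  rw [← smul_eq_C_mul]
  ext i
  have := congrArg (coeff · i) h
  simpa using this

theorem CutsDivisor.exists_int {a b c : ℤ} (h : CutsDivisor a b c) : ∃ (V W : ℤ[X]) (D : ℤ),
    D ≠ 0 ∧ V ^ 2 - quadPoly a b c * W = C (3 * D ^ 2) * curvePoly := by
  obtain ⟨V, W, m, hm, h⟩ := h
  obtain ⟨N, V₀, hN, hV⟩ := exists_int_map V
  obtain ⟨M, W₀, hM, hW⟩ := exists_int_map W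
  refine ⟨C (M * m.den) * V₀, C (N ^ 2 * M * m.den ^ 2) * W₀, N * M * m.num, ?_, ?_⟩
  · exact mul_ne_zero (mul_ne_zero hN hM) (Rat.num_ne_zero.2 hm)
  · apply map_injective (Int.castRingHom ℚ) Int.cast_injective
    have hq : (m.num : ℚ) = m * m.den := (Rat.mul_den_eq_num m).symm
    simp only [quadPoly, curvePoly, Polynomial.map_sub, Polynomial.map_mul, Polynomial.map_pow,
      Polynomial.map_add, map_C, map_X, hV, hW]
    simp only [ratQuad, ratPoly] at h
    simp only [eq_intCast]
    push_cast
    rw [hq]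
    simp only [map_mul, map_pow, map_ofNat] at h ⊢
    linear_combination (C (N : ℚ) * C (M : ℚ) * C (m.den : ℚ)) ^ 2 * h

theorem CutsDivisor.quad_eq {a b c : ℤ} (h : CutsDivisor a b c) (ha : Odd a)
    (hprim : ∀ p : ℕ, p.Prime → ¬ ((p : ℤ) ∣ a ∧ (p : ℤ) ∣ b ∧ (p : ℤ) ∣ c)) :
    ∃ (s : ℤ) (i j k : Bool) (γ : 𝓞 K), (s = 1 ∨ s = -1) ∧
      (Coord.quad (s * a) (s * b) (s * c)).toInt = (Coord.delta i j k).toInt * γ ^ 2 := by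
  obtain ⟨V, W, D, hD, h⟩ := h.exists_int
  obtain ⟨i, j, k, γ, h | h⟩ := QuinticDescent.quad_eq ha hprim hD h
  · exact ⟨1, i, j, k, γ, .inl rfl, by simpa using h⟩
  · refine ⟨-1, i, j, k, γ, .inr rfl, ?_⟩
    rw [Coord.toInt_quad] at h ⊢
    push_cast
    linear_combination -h

theorem toInt_delta_false : (Coord.delta false false false).toInt = 1 := by
  simp [Coord.delta, Coord.toInt_mul, Coord.toInt_one]

theorem CutsDivisor.isSquare {a b c : ℤ} (h : CutsDivisor a b c) (ha : Odd a)
    (hprim : ∀ p : ℕ, p.Prime → ¬ ((p : ℤ) ∣ a ∧ (p : ℤ) ∣ b ∧ (p : ℤ) ∣ c))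
    (hb : 4 ∣ b) (hc : 8 ∣ c) : 8 ∣ b ∧ ∃ (s : ℤ) (γ : 𝓞 K), (s = 1 ∨ s = -1) ∧
      s * a % 8 = 1 ∧ (Coord.quad (s * a) (s * b) (s * c)).toInt = γ ^ 2 := by
  obtain ⟨s, i, j, k, γ, hs, h⟩ := h.quad_eq ha hprim
  have ha := Int.odd_iff.1 ha
  obtain ⟨h0, h4, rfl, rfl, rfl⟩ := Coord.one_eq_delta h
    (by simp only [Coord.quad]; rcases hs with rfl | rfl <;> omega)
    (by simp only [Coord.quad]; rcases hs with rfl | rfl <;> omega)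
    (by simp only [Coord.quad]; rfl)
    (by simp only [Coord.quad]; rcases hs with rfl | rfl <;> omega)
    (by simp only [Coord.quad]; rcases hs with rfl | rfl <;> omega)
  rw [toInt_delta_false, one_mul] at h
  simp only [Coord.quad] at h0 h4
  have hb8 : 8 ∣ b := by rcases hs with rfl | rfl <;> omega
  exact ⟨hb8, s, γ, hs, by rcases hs with rfl | rfl <;> omega, h⟩

/-- The square of `θ + 11` in coordinates. -/
def Coord.lambdaSq : Coord := ⟨0, -2, 0, 4, -11⟩

theorem Coord.lambdaSq_mul_quad (a b c : ℤ) : lambdaSq.mul (quad a b c) =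
    ⟨0, -2 * a - 22 * b + 16 * c, -8 * b - 88 * c, 4 * a + 44 * b, -11 * a⟩ := by
  ext <;> simp only [lambdaSq, quad, mul] <;> ring

theorem two_mul_sq_ne {x y l : ℤ} (hl : Odd l) (hy : y ≠ 0) : 2 * x ^ 2 ≠ l * y ^ 2 := by
  intro h
  have hl0 : l ≠ 0 := by rintro rfl; simp at hl
  have hx : x ≠ 0 := by rintro rfl; simp [hl0, hy] at h
  have := congrArg (padicValInt 2) h
  rw [padicValInt.mul two_ne_zero (pow_ne_zero 2 hx), padicValInt.mul hl0 (pow_ne_zero 2 hy), sq,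
    sq, padicValInt.mul hx hx, padicValInt.mul hy hy, padicValInt.eq_zero_of_not_dvd
    (z := l) (by rw [Nat.cast_ofNat, ← even_iff_two_dvd, Int.not_even_iff_odd]; exact hl)] at this
  have h2 : padicValInt 2 2 = 1 := padicValInt.self one_lt_two
  omega

theorem mod_eight_of_sq_eq {x y l : ℤ} (hl : Odd l) (hy : y ≠ 0) (h : x ^ 2 = l * y ^ 2) :
    l % 8 = 1 := by
  obtain ⟨z, rfl⟩ := (Int.pow_dvd_pow_iff two_ne_zero).1 (Dvd.intro_left l h.symm)
  have : l = z ^ 2 := by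
    apply mul_right_cancel₀ (pow_ne_zero 2 hy)
    linear_combination -h
  rw [this] at hl ⊢
  have := Int.eight_dvd_sq_sub_one_of_odd (k := z) (by simpa [Int.odd_pow] using hl)
  omega

theorem CutsDivisor.mul_mod_eight {a b c l x y : ℤ} (h : CutsDivisor a b c) (ha : Odd a)
    (hprim : ∀ p : ℕ, p.Prime → ¬ ((p : ℤ) ∣ a ∧ (p : ℤ) ∣ b ∧ (p : ℤ) ∣ c))
    (hb : Odd b) (hl : Odd l) (hx : x ≠ 0) (hN : quadNorm a b c * x ^ 2 = l * y ^ 2) :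
    a * l % 8 = 5 := by
  have ha0 : a ≠ 0 := by rintro rfl; simp at ha
  obtain ⟨s, i, j, k, γ, hs, h⟩ := h.quad_eq ha hprim
  have ha := Int.odd_iff.1 ha
  have hb := Int.odd_iff.1 hb
  have hl' := Int.odd_iff.1 hl
  obtain ⟨g, hg, hg'⟩ := Coord.exists_residue (δ := Coord.lambdaSq.mul (Coord.delta i j k))
    (c := Coord.lambdaSq.mul (Coord.quad (s * a) (s * b) (s * c))) (γ := γ)
    (by rw [Coord.toInt_mul, h, Coord.toInt_mul, mul_assoc])
  have key := Coord.lambda_delta_mul_sq_mod i j k g hg _ hg'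
  rw [Coord.lambdaSq_mul_quad] at key
  simp only [Coord.mod] at key
  have hsN : quadNorm (s * a) (s * b) (s * c) = s * quadNorm a b c := by
    rcases hs with rfl | rfl <;> simp only [quadNorm] <;> ring
  have hnorm := congrArg (Algebra.norm ℤ) h
  rw [map_mul, map_pow, Coord.norm_toInt, Coord.norm_toInt, Coord.norm_quad, hsN] at hnorm
  have hy : y ≠ 0 := by
    rintro rfl
    have : quadNorm a b c ≠ 0 := by
      rw [← Coord.norm_quad, ← Coord.norm_toInt, Algebra.norm_ne_zero_iff]
      exact quad_ne_zero ha0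
    simp [this, hx] at hN
  rcases key (by rfl) (by rcases hs with rfl | rfl <;> omega)
    (by rcases hs with rfl | rfl <;> omega) (by rcases hs with rfl | rfl <;> omega)
    (by rcases hs with rfl | rfl <;> omega) with ⟨rfl, rfl, rfl, h5⟩ | ⟨rfl, rfl, rfl, h3⟩
  · have hδ : (Coord.delta false false false).norm = 1 := by decide +kernel
    rw [hδ, one_mul] at hnorm
    have := mod_eight_of_sq_eq (l := s * l) (x := Algebra.norm ℤ γ * x) (y := y)
      (by rw [Int.odd_iff]; rcases hs with rfl | rfl <;> omega) hy
      (by linear_combination s * hN - x ^ 2 * hnorm)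
    have h1 : l % 8 = s % 8 := by rcases hs with rfl | rfl <;> omega
    have h2 : a % 8 = 5 * s % 8 := by rcases hs with rfl | rfl <;> omega
    rw [Int.mul_emod, h1, h2]
    rcases hs with rfl | rfl <;> rfl
  · have hδ : (Coord.delta false true true).norm = 2 ∨ (Coord.delta false true true).norm = -2 := by
      decide +kernel
    exfalso
    rcases hδ with hδ | hδ <;> rw [hδ] at hnorm
    · exact two_mul_sq_ne (l := s * l) (x := Algebra.norm ℤ γ * x) (y := y)
        (by rw [Int.odd_iff]; rcases hs with rfl | rfl <;> omega) hy
        (by linear_combination s * hN - x ^ 2 * hnorm)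
    · exact two_mul_sq_ne (l := -(s * l)) (x := Algebra.norm ℤ γ * x) (y := y)
        (by rw [Int.odd_iff]; rcases hs with rfl | rfl <;> omega) hy
        (by linear_combination -s * hN + x ^ 2 * hnorm)

theorem ratPoly_natDegree : ratPoly.natDegree = 5 := by
  unfold ratPoly
  compute_degree!

theorem ratPoly_monic : ratPoly.Monic := by
  unfold ratPoly
  monicity!

theorem aeval_ratPoly : aeval (theta : K) ratPoly = 0 := by
  have := congrArg (algebraMap (𝓞 K) K) theta_rel
  simp only [map_add, map_mul, map_pow, map_ofNat, map_zero] at this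
  simpa [ratPoly] using this

theorem natDegree_minpoly_theta : (minpoly ℚ (theta : K)).natDegree = 5 := by
  have hInt : IsIntegral ℚ (theta : K) := ⟨ratPoly, ratPoly_monic, aeval_ratPoly⟩
  have hdvd := minpoly.degree_dvd hInt
  rw [finrank_K] at hdvd
  refine ((Nat.dvd_prime Nat.prime_five).1 hdvd).resolve_left fun h ↦ ?_
  obtain ⟨q, hq⟩ := minpoly.natDegree_eq_one_iff.1 h
  have hval : ((theta : 𝓞 K) : K) = pw (-11) 0 0 0 (-1 / 4) := by
    rw [theta, Coord.coe_toInt, Coord.val]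
    norm_num
  have : pw q 0 0 0 0 = pw (-11) 0 0 0 (-1 / 4) := by
    rw [← hval, ← hq]
    simp [pw]
  have := (pw_inj this).2.2.2.2
  norm_num at this

theorem eq_zero_of_aeval_theta {S : ℚ[X]} (hS : S.natDegree < 5) (h : aeval (theta : K) S = 0) :
    S = 0 := by
  by_contra h0
  have := natDegree_le_of_dvd (minpoly.dvd ℚ _ h) h0
  rw [natDegree_minpoly_theta] at this
  omega

theorem ratPoly_dvd_of_aeval_theta {R : ℚ[X]} (h : aeval (theta : K) R = 0) : ratPoly ∣ R := by
  rw [← modByMonic_eq_zero_iff_dvd ratPoly_monic]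
  apply eq_zero_of_aeval_theta
  · have := natDegree_modByMonic_lt R ratPoly_monic (fun h ↦ by
      have := ratPoly_natDegree
      rw [h] at this
      simp at this)
    rwa [ratPoly_natDegree] at this
  · have := congrArg (aeval (theta : K)) (modByMonic_add_div R ratPoly)
    simpa [aeval_ratPoly, h] using this

/-- Linear algebra: there are `H` and `P` of small degree with `H(θ) = γ P(θ)` and
`H ≡ m V (mod U)`. -/
theorem exists_interpolation (U V : ℚ[X]) (hU : U ≠ 0) (γ : K) : ∃ (H P : ℚ[X]) (m : ℚ),
    (H ≠ 0 ∨ P ≠ 0 ∨ m ≠ 0) ∧ H.natDegree ≤ U.natDegree + 1 ∧ P.natDegree ≤ 2 ∧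
      aeval (theta : K) H = γ * aeval (theta : K) P ∧ U ∣ H - C m * V := by
  set n := U.natDegree with hn
  let e (k : ℕ) : (Fin k → ℚ) →ₗ[ℚ] ℚ[X] :=
    (degreeLT ℚ k).subtype ∘ₗ (degreeLTEquiv ℚ k).symm.toLinearMap
  have he (k : ℕ) (v) : (e (k + 1) v).natDegree ≤ k := by
    have := mem_degreeLT.1 ((degreeLTEquiv ℚ (k + 1)).symm v).2
    rcases eq_or_ne (e (k + 1) v) 0 with h0 | h0
    · simp [h0]
    · exact Nat.lt_succ_iff.1 ((natDegree_lt_iff_degree_lt h0).2 this)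
  have he0 (k : ℕ) (v) (h : e k v = 0) : v = 0 := by
    have : (degreeLTEquiv ℚ k).symm v = 0 := Subtype.ext h
    simpa using this
  let ev : ℚ[X] →ₗ[ℚ] K := (aeval (theta : K)).toLinearMap
  let mk : ℚ[X] →ₗ[ℚ] AdjoinRoot U := (AdjoinRoot.mkₐ U).toLinearMap
  let p₁ := LinearMap.fst ℚ (Fin (n + 2) → ℚ) ((Fin 3 → ℚ) × ℚ)
  let p₂ := LinearMap.snd ℚ (Fin (n + 2) → ℚ) ((Fin 3 → ℚ) × ℚ)
  let L := (ev ∘ₗ e (n + 2) ∘ₗ p₁ -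
      LinearMap.mulLeft ℚ γ ∘ₗ ev ∘ₗ e 3 ∘ₗ LinearMap.fst ℚ _ _ ∘ₗ p₂).prod
    (mk ∘ₗ (e (n + 2) ∘ₗ p₁ - LinearMap.toSpanSingleton ℚ ℚ[X] V ∘ₗ LinearMap.snd ℚ _ _ ∘ₗ p₂))
  have hfin : Module.finrank ℚ (AdjoinRoot U) = n := by
    rw [(AdjoinRoot.powerBasis hU).finrank, AdjoinRoot.powerBasis_dim]
  have : Module.Finite ℚ (AdjoinRoot U) := (AdjoinRoot.powerBasis hU).finite
  have hker : L.ker ≠ ⊥ := by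
    apply LinearMap.ker_ne_bot_of_finrank_lt
    simp only [Module.finrank_prod, Module.finrank_fin_fun, Module.finrank_self, hfin, finrank_K]
    omega
  obtain ⟨⟨u, v, m⟩, hx, hx0⟩ := Submodule.exists_mem_ne_zero_of_ne_bot hker
  have hx : L (u, v, m) = 0 := hx
  have h₁ := congrArg Prod.fst hx
  have h₂ := congrArg Prod.snd hx
  refine ⟨e _ u, e _ v, m, ?_, he _ _, he _ _, sub_eq_zero.1 h₁, ?_⟩
  · contrapose! hx0
    rw [he0 _ _ hx0.1, he0 _ _ hx0.2.1, hx0.2.2]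
    rfl
  · rw [← smul_eq_C_mul]
    exact AdjoinRoot.mk_eq_zero.1 h₂

/-- Halving: a quadratic which is a square at `θ` produces a new one. -/
theorem exists_half {U V W : ℚ[X]} {γ : K} {D : ℚ} (hD : D ≠ 0) (h1 : 1 ≤ U.natDegree)
    (h2 : U.natDegree ≤ 2) (hsq : ¬ IsSquare U) (hγ : aeval (theta : K) U = γ ^ 2)
    (h : V ^ 2 - U * W = C (3 * D ^ 2) * ratPoly) :
    ∃ (H P : ℚ[X]) (m : ℚ), m ≠ 0 ∧ P ≠ 0 ∧ H.natDegree ≤ 3 ∧ P.natDegree ≤ 2 ∧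
      H ^ 2 - U * P ^ 2 = C (3 * m ^ 2) * ratPoly := by
  have hU : U ≠ 0 := by rintro rfl; simp at h1
  obtain ⟨H, P, m, hne, hH, hP, hθ, T, hT⟩ := exists_interpolation U V hU γ
  have hR : aeval (theta : K) (H ^ 2 - U * P ^ 2) = 0 := by
    simp only [map_sub, map_mul, map_pow, hθ, hγ]
    ring
  obtain ⟨κ, hκ⟩ := ratPoly_dvd_of_aeval_theta hR
  have hRdeg : (H ^ 2 - U * P ^ 2).natDegree ≤ U.natDegree + 4 := by
    refine (natDegree_sub_le _ _).trans (max_le ?_ ?_)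
    · exact natDegree_pow_le.trans (by omega)
    · exact natDegree_mul_le.trans (Nat.add_le_add_left (natDegree_pow_le.trans (by omega)) _)
  have hκdeg : κ.natDegree < U.natDegree := by
    rcases eq_or_ne κ 0 with rfl | h0
    · rw [natDegree_zero]; omega
    · rw [hκ, ratPoly_monic.natDegree_mul' h0, ratPoly_natDegree] at hRdeg
      omega
  have hS : ratPoly * (κ - C (3 * (D * m) ^ 2)) =
      U * (T * (H + C m * V) - P ^ 2 + C m ^ 2 * W) := by
    simp only [map_mul, map_pow] at h ⊢
    linear_combination -hκ + (H + C m * V) * hT + C m ^ 2 * h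
  set S := T * (H + C m * V) - P ^ 2 + C m ^ 2 * W
  have hκ0 : κ - C (3 * (D * m) ^ 2) = 0 := by
    by_contra h0
    have hS0 : S ≠ 0 := by
      rintro hS0
      rw [hS0, mul_zero] at hS
      exact mul_ne_zero ratPoly_monic.ne_zero h0 hS
    have hdeg := congrArg natDegree hS
    rw [natDegree_mul hU hS0, ratPoly_monic.natDegree_mul' h0, ratPoly_natDegree] at hdeg
    have : (κ - C (3 * (D * m) ^ 2)).natDegree < U.natDegree :=
      (natDegree_sub_le _ _).trans_lt (max_lt hκdeg (by rw [natDegree_C]; omega))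
    refine hS0 (eq_zero_of_aeval_theta (by omega) ?_)
    have := congrArg (aeval (theta : K)) hS
    rw [map_mul, aeval_ratPoly, zero_mul, eq_comm, map_mul, mul_eq_zero] at this
    refine this.resolve_left fun h0 ↦ hU (eq_zero_of_aeval_theta (by omega) h0)
  rw [sub_eq_zero] at hκ0
  rw [hκ0, mul_comm ratPoly] at hκ
  have key : D * m ≠ 0 ∧ P ≠ 0 := by
    have hP0 : P ≠ 0 := by
      rintro rfl
      have hH0 : H = 0 := eq_zero_of_aeval_theta (by omega) (by simpa using hθ)
      rw [hH0] at hκ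
      have : 3 * (D * m) ^ 2 = 0 := by
        have h0 : C (3 * (D * m) ^ 2) * ratPoly = 0 := by rw [← hκ]; ring
        simpa [ratPoly_monic.ne_zero] using h0
      have : m = 0 := by simpa [hD] using this
      simp [this, hH0] at hne
    refine ⟨fun h0 ↦ hsq ?_, hP0⟩
    rw [h0] at hκ
    have hκ' : H ^ 2 = U * P ^ 2 := by
      rw [← sub_eq_zero, hκ]
      simp
    obtain ⟨Q, rfl⟩ := (IsIntegrallyClosed.pow_dvd_pow_iff two_ne_zero).1 (Dvd.intro_left U hκ'.symm)
    exact ⟨Q, mul_right_cancel₀ (pow_ne_zero 2 hP0) (by rw [← hκ']; ring)⟩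
  exact ⟨H, P, D * m, key.1, key.2, by omega, hP, hκ⟩

namespace TwoAdic

/-- Reduction modulo `2`. -/
noncomputable def red2 : ℤ_[2] →+* ZMod 2 := PadicInt.toZModPow 1

/-- Reduction modulo `4`. -/
noncomputable def red4 : ℤ_[2] →+* ZMod 4 := PadicInt.toZModPow 2

/-- Reduction modulo `8`. -/
noncomputable def red8 : ℤ_[2] →+* ZMod 8 := PadicInt.toZModPow 3

theorem toZModPow_eq_zero_iff (k : ℕ) (x : ℤ_[2]) : PadicInt.toZModPow k x = 0 ↔ 2 ^ k ∣ x := by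
  rw [← RingHom.mem_ker, PadicInt.ker_toZModPow, Ideal.mem_span_singleton, Nat.cast_ofNat]

theorem red2_eq_zero {x : ℤ_[2]} : red2 x = 0 ↔ 2 ∣ x := by
  have : (2 : ℤ_[2]) = 2 ^ 1 := (pow_one 2).symm
  rw [this]
  exact toZModPow_eq_zero_iff 1 x

theorem red4_eq_zero {x : ℤ_[2]} : red4 x = 0 ↔ 4 ∣ x := by
  have : (4 : ℤ_[2]) = 2 ^ 2 := by norm_num
  rw [this]
  exact toZModPow_eq_zero_iff 2 x

theorem red8_eq_zero {x : ℤ_[2]} : red8 x = 0 ↔ 8 ∣ x := by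
  have : (8 : ℤ_[2]) = 2 ^ 3 := by norm_num
  rw [this]
  exact toZModPow_eq_zero_iff 3 x

theorem even_or_odd (x : ℤ_[2]) : 2 ∣ x ∨ Odd x := by
  have : ∀ y : ZMod 2, y = 0 ∨ y - 1 = 0 := by decide
  rcases this (red2 x) with h | h
  · exact .inl (red2_eq_zero.1 h)
  · rw [← map_one red2, ← map_sub, red2_eq_zero] at h
    obtain ⟨y, hy⟩ := h
    exact .inr ⟨y, by linear_combination hy⟩

theorem red2_of_odd {x : ℤ_[2]} (h : Odd x) : red2 x = 1 := by
  obtain ⟨y, rfl⟩ := h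
  simp only [map_add, map_mul, map_one, map_ofNat]
  have : ∀ y : ZMod 2, 2 * y + 1 = 1 := by decide
  exact this _

theorem red2_of_dvd {x : ℤ_[2]} (h : 2 ∣ x) : red2 x = 0 := red2_eq_zero.2 h

theorem not_dvd_of_odd {x : ℤ_[2]} (h : Odd x) : ¬ 2 ∣ x := by
  rw [← red2_eq_zero, red2_of_odd h]
  decide

theorem odd_iff {x : ℤ_[2]} : Odd x ↔ red2 x = 1 := by
  refine ⟨red2_of_odd, fun h ↦ (even_or_odd x).resolve_left fun h' ↦ ?_⟩
  rw [red2_eq_zero.2 h'] at h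
  exact absurd h (by decide)

theorem not_dvd_iff {x : ℤ_[2]} : ¬ 2 ∣ x ↔ Odd x :=
  ⟨(even_or_odd x).resolve_left, not_dvd_of_odd⟩

theorem isUnit_iff_odd {x : ℤ_[2]} : IsUnit x ↔ Odd x := by
  rw [← not_dvd_iff, ← not_iff_not, not_not, PadicInt.not_isUnit_iff, PadicInt.norm_lt_one_iff_dvd,
    Nat.cast_ofNat]

theorem red8_sq_of_odd {x : ℤ_[2]} (h : Odd x) : red8 x ^ 2 = 1 := by
  obtain ⟨y, rfl⟩ := h
  simp only [map_add, map_mul, map_one, map_ofNat]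
  have : ∀ y : ZMod 8, (2 * y + 1) ^ 2 = 1 := by decide
  exact this _

theorem norm_two_pow (k : ℕ) : ‖(2 : ℤ_[2]) ^ k‖ = 2⁻¹ ^ k := by
  have := PadicInt.norm_p (p := 2)
  rw [Nat.cast_ofNat] at this
  rw [norm_pow, this]
  norm_num

theorem norm_eq_one_of_odd {x : ℤ_[2]} (h : Odd x) : ‖x‖ = 1 :=
  PadicInt.isUnit_iff.1 (isUnit_iff_odd.2 h)

theorem exists_sq_eq {x : ℤ_[2]} (h : 8 ∣ x - 1) : ∃ y, y ^ 2 = x := by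
  obtain ⟨w, hw⟩ := h
  obtain ⟨y, hy, -⟩ := hensels_lemma (p := 2) (F := (X ^ 2 - C x : ℤ_[2][X])) (a := 1) (by
    have h2 : ‖(2 : ℤ_[2])‖ = 2⁻¹ := by simpa using norm_two_pow 1
    have h8 : ‖(1 - x : ℤ_[2])‖ ≤ 2⁻¹ ^ 3 := by
      rw [show 1 - x = 2 ^ 3 * -w by linear_combination -hw, norm_mul, norm_two_pow]
      exact mul_le_of_le_one_right (by norm_num) (PadicInt.norm_le_one _)
    have hF : aeval (1 : ℤ_[2]) (derivative (X ^ 2 - C x : ℤ_[2][X])) = 2 := by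
      simp [one_add_one_eq_two]
    have hF' : aeval (1 : ℤ_[2]) (X ^ 2 - C x : ℤ_[2][X]) = 1 - x := by simp
    rw [hF, hF', h2]
    exact h8.trans_lt (by norm_num))
  exact ⟨y, by simpa [sub_eq_zero] using hy⟩

theorem exists_root {p q r : ℤ_[2]} (hp : 2 ∣ p) (hq : Odd q) :
    ∃ t, 2 ∣ t ∧ p + q * t + r * t ^ 2 = 0 := by
  have hq1 := norm_eq_one_of_odd hq
  have hp1 : ‖p‖ < 1 := by
    rw [PadicInt.norm_lt_one_iff_dvd, Nat.cast_ofNat]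
    exact hp
  obtain ⟨t, ht, ht', -⟩ := hensels_lemma (p := 2) (F := (C p + C q * X + C r * X ^ 2 : ℤ_[2][X]))
    (a := 0) (by simp [hq1, hp1])
  refine ⟨t, ?_, by simpa using ht⟩
  have := (PadicInt.norm_lt_one_iff_dvd (p := 2) t).1 (by simpa [hq1] using ht')
  simpa using this

theorem dvd_of_sq_eq_mul_sq {x y z : ℤ_[2]} (h : x ^ 2 = y ^ 2 * z) : y ∣ x :=
  (IsIntegrallyClosed.pow_dvd_pow_iff two_ne_zero).1 (Dvd.intro _ h.symm)

theorem not_sq_of_dvd {s t : ℤ_[2]} (ht : 2 ∣ t) : s ^ 2 ≠ 3 * t ^ 5 + 33 * t ^ 4 + 192 := by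
  obtain ⟨t, rfl⟩ := ht
  intro h
  obtain ⟨s, rfl⟩ := dvd_of_sq_eq_mul_sq (y := 4) (z := 6 * t ^ 5 + 33 * t ^ 4 + 12)
    (x := s) (by rw [h]; ring)
  have h : s ^ 2 = 6 * t ^ 5 + 33 * t ^ 4 + 12 := by
    apply mul_left_cancel₀ (show (16 : ℤ_[2]) ≠ 0 by norm_num)
    linear_combination h
  rcases even_or_odd t with ⟨t, rfl⟩ | ho
  · obtain ⟨s, rfl⟩ := dvd_of_sq_eq_mul_sq (y := 2) (z := 48 * t ^ 5 + 132 * t ^ 4 + 3)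
      (x := s) (by rw [h]; ring)
    have h : s ^ 2 = 48 * t ^ 5 + 132 * t ^ 4 + 3 := by
      apply mul_left_cancel₀ (show (4 : ℤ_[2]) ≠ 0 by norm_num)
      linear_combination h
    have h := congrArg red8 h
    simp only [map_add, map_mul, map_pow, map_ofNat] at h
    generalize red8 t = t', red8 s = s' at h
    revert s' t'
    decide +kernel
  · have h2 := red8_sq_of_odd ho
    have h := congrArg red8 h
    simp only [map_add, map_mul, map_pow, map_ofNat] at h
    generalize red8 t = t', red8 s = s' at h h2
    revert s' t'
    decide +kernel

end TwoAdic

namespace TwoAdic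

/-- The equations satisfied by the coefficients of `G` and `q` when
`G ^ 2 = (1 + 4 n a x + 16 n ^ 2 η ^ 2 x ^ 2) q ^ 2 + 12 n e ^ 2 f(x)` and the leading coefficient
of `G` is `4 n η q₂`. -/
structure System (n a η q₀ q₁ q₂ g₀ g₁ g₂ e : ℤ_[2]) : Prop where
  eq₀ : g₀ ^ 2 = q₀ ^ 2 + 768 * n * e ^ 2
  eq₁ : g₀ * g₁ = q₀ * q₁ + 2 * n * a * q₀ ^ 2
  eq₂ : g₁ ^ 2 + 2 * g₀ * g₂ =
    q₁ ^ 2 + 2 * q₀ * q₂ + 8 * n * a * q₀ * q₁ + 16 * n ^ 2 * η ^ 2 * q₀ ^ 2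
  eq₃ : 4 * n * η * g₀ * q₂ + g₁ * g₂ =
    q₁ * q₂ + 2 * n * a * (q₁ ^ 2 + 2 * q₀ * q₂) + 16 * n ^ 2 * η ^ 2 * q₀ * q₁
  eq₄ : g₂ ^ 2 + 8 * n * η * q₂ * g₁ = q₂ ^ 2 + 8 * n * a * q₁ * q₂ +
    16 * n ^ 2 * η ^ 2 * (q₁ ^ 2 + 2 * q₀ * q₂) + 132 * n * e ^ 2
  eq₅ : 3 * e ^ 2 = q₂ * (2 * η * g₂ - a * q₂ - 8 * n * η ^ 2 * q₁)

variable {n a η q₀ q₁ q₂ g₀ g₁ g₂ e : ℤ_[2]}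

theorem System.neg (h : System n a η q₀ q₁ q₂ g₀ g₁ g₂ e) :
    System n a (-η) q₀ q₁ q₂ (-g₀) (-g₁) (-g₂) e where
  eq₀ := by linear_combination h.eq₀
  eq₁ := by linear_combination h.eq₁
  eq₂ := by linear_combination h.eq₂
  eq₃ := by linear_combination h.eq₃
  eq₄ := by linear_combination h.eq₄
  eq₅ := by linear_combination h.eq₅

theorem exists_eq_add {x y m : ℤ_[2]} (hy : Odd y) (h : x ^ 2 = y ^ 2 + 4 * m) :
    ∃ v, Odd v ∧ (x = y + 2 * m * v ∨ -x = y + 2 * m * v) := by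
  have hx : Odd x := by
    rw [odd_iff] at hy ⊢
    have h := congrArg red2 h
    simp only [map_add, map_mul, map_pow, map_ofNat, hy] at h
    generalize red2 x = x', red2 m = m' at h ⊢
    revert x' m'
    decide
  obtain ⟨k, rfl⟩ := hx
  obtain ⟨l, rfl⟩ := hy
  have h : (k - l) * (k + l + 1) = m := by
    apply mul_left_cancel₀ (show (4 : ℤ_[2]) ≠ 0 by norm_num)
    linear_combination h
  have hodd : Odd (k - l) ∨ Odd (k + l + 1) := by
    simp only [odd_iff, map_add, map_sub, map_one]
    generalize red2 k = k', red2 l = l'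
    revert k' l'
    decide
  rcases hodd with ho | ho
  · obtain ⟨v, hv⟩ := (isUnit_iff_odd.2 ho).exists_right_inv
    refine ⟨-v, (isUnit_iff_odd.1 (IsUnit.of_mul_eq_one_right _ hv)).neg, .inr ?_⟩
    linear_combination 2 * (k + l + 1) * hv - 2 * v * h
  · obtain ⟨v, hv⟩ := (isUnit_iff_odd.2 ho).exists_right_inv
    refine ⟨v, isUnit_iff_odd.1 (IsUnit.of_mul_eq_one_right _ hv), .inl ?_⟩
    linear_combination -2 * (k - l) * hv + 2 * v * h

theorem dvd_of_odd_mul {x y z : ℤ_[2]} (hx : Odd x) (h : z ∣ x * y) : z ∣ y :=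
  (isUnit_iff_odd.2 hx).dvd_mul_left.1 h

/-- Cancelled equations in the case where only the leading coefficient of `q` is odd. -/
theorem System.false_of_eq_add (h : System n a η q₀ q₁ q₂ g₀ g₁ g₂ e) (hn : 4 ∣ n) (hn0 : n ≠ 0)
    (ha : Odd a) (h0 : 2 ∣ q₀) (h1 : 2 ∣ q₁) (h2 : Odd q₂) (he : Odd e) {r₂ : ℤ_[2]}
    (hr₂ : g₂ = q₂ + 2 * n * r₂) : False := by
  subst hr₂
  obtain ⟨r₁, hr₁⟩ : 2 * n ∣ g₁ - q₁ := dvd_of_odd_mul h2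
    ⟨a * (q₁ ^ 2 + 2 * q₀ * q₂) + 8 * n * η ^ 2 * q₀ * q₁ - 2 * η * g₀ * q₂ - r₂ * g₁,
      by linear_combination h.eq₃⟩
  obtain rfl : g₁ = q₁ + 2 * n * r₁ := by linear_combination hr₁
  obtain ⟨r₀, hr₀⟩ : 2 * n ∣ g₀ - q₀ := dvd_of_odd_mul h2
    ⟨2 * a * q₀ * q₁ + 4 * n * η ^ 2 * q₀ ^ 2 - r₁ * q₁ - n * r₁ ^ 2 - r₂ * g₀, by
      apply mul_left_cancel₀ (show (2 : ℤ_[2]) ≠ 0 by norm_num)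
      linear_combination h.eq₂⟩
  obtain rfl : g₀ = q₀ + 2 * n * r₀ := by linear_combination hr₀
  have hn4 : 4 * n ≠ 0 := mul_ne_zero (by norm_num) hn0
  have c₀ : r₀ * (q₀ + n * r₀) = 192 * e ^ 2 := by
    apply mul_left_cancel₀ hn4
    linear_combination h.eq₀
  have c₁ : r₁ * q₀ + r₀ * q₁ + 2 * n * r₀ * r₁ = a * q₀ ^ 2 := by
    apply mul_left_cancel₀ hn4
    linear_combination 2 * h.eq₁
  have c₂ : r₂ * q₀ + r₁ * q₁ + r₀ * q₂ + n * (r₁ ^ 2 + 2 * r₀ * r₂) =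
      2 * a * q₀ * q₁ + 4 * n * η ^ 2 * q₀ ^ 2 := by
    apply mul_left_cancel₀ hn4
    linear_combination h.eq₂
  have c₃ : 2 * η * q₂ * q₀ + r₂ * q₁ + r₁ * q₂ + 2 * n * (r₁ * r₂ + 2 * η * q₂ * r₀) =
      a * (q₁ ^ 2 + 2 * q₀ * q₂) + 8 * n * η ^ 2 * q₀ * q₁ := by
    apply mul_left_cancel₀ hn4
    linear_combination 2 * h.eq₃
  have c₄ : 2 * η * q₂ * q₁ + r₂ * q₂ + n * (r₂ ^ 2 + 4 * η * q₂ * r₁) =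
      2 * a * q₁ * q₂ + 4 * n * η ^ 2 * (q₁ ^ 2 + 2 * q₀ * q₂) + 33 * e ^ 2 := by
    apply mul_left_cancel₀ hn4
    linear_combination h.eq₄
  clear h hr₁ hr₀ hn4
  have n2 : red2 n = 0 := red2_of_dvd (dvd_trans ⟨2, by norm_num⟩ hn)
  have n4 : red4 n = 0 := red4_eq_zero.2 hn
  have q2 : red2 q₂ = 1 := red2_of_odd h2
  have a2 : red2 a = 1 := red2_of_odd ha
  have e2 : red2 e = 1 := red2_of_odd he
  have two : (2 : ZMod 2) = 0 := rfl
  have four : (4 : ZMod 2) = 0 := rfl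
  have eight : (8 : ZMod 2) = 0 := rfl
  have twelve : (12 : ZMod 2) = 0 := rfl
  have three : (3 : ZMod 2) = 1 := rfl
  have sixteen : (16 : ZMod 2) = 0 := rfl
  have hr₁ : 2 ∣ r₁ := by
    have h := congrArg red2 c₃
    simpa [n2, q2, red2_of_dvd h1, red2_of_dvd h0, two, eight, red2_eq_zero] using h
  have hr₀ : 2 ∣ r₀ := by
    have h := congrArg red2 c₂
    simpa [n2, q2, red2_of_dvd h1, red2_of_dvd h0, two, four, red2_eq_zero] using h
  obtain ⟨κ, rfl⟩ := h0
  obtain ⟨ρ, rfl⟩ := hr₀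
  obtain ⟨p, rfl⟩ := h1
  obtain ⟨π, rfl⟩ := hr₁
  obtain ⟨ν, rfl⟩ := hn
  have c₀ : ρ * (κ + 4 * ν * ρ) = 48 * e ^ 2 := by
    apply mul_left_cancel₀ (show (4 : ℤ_[2]) ≠ 0 by norm_num)
    linear_combination c₀
  have hr₂ : red2 r₂ = 1 := by
    have h := congrArg red2 c₄
    have h33 : (33 : ZMod 2) = 1 := rfl
    simpa [n2, q2, e2, two, four, h33, map_ofNat] using h
  have c₂ : r₂ * κ + 2 * π * p + ρ * q₂ + 8 * ν * (π ^ 2 + ρ * r₂) =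
      4 * a * κ * p + 32 * ν * η ^ 2 * κ ^ 2 := by
    apply mul_left_cancel₀ (show (2 : ℤ_[2]) ≠ 0 by norm_num)
    linear_combination c₂
  have hκρ : 2 ∣ κ ∧ 2 ∣ ρ := by
    have h₀ := congrArg red2 c₀
    have h₂ := congrArg red2 c₂
    have h48 : (48 : ZMod 2) = 0 := rfl
    have h32 : (32 : ZMod 2) = 0 := rfl
    simp only [map_add, map_mul, map_pow, map_ofNat, q2, two, four, eight, h32, h48, hr₂, zero_mul,
      add_zero, mul_one, one_mul] at h₀ h₂
    rw [← red2_eq_zero, ← red2_eq_zero]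
    generalize red2 κ = κ, red2 ρ = ρ at *
    revert κ ρ
    decide
  obtain ⟨⟨κ, rfl⟩, ρ, rfl⟩ := hκρ
  have c₀ : ρ * (κ + 4 * ν * ρ) = 12 * e ^ 2 := by
    apply mul_left_cancel₀ (show (4 : ℤ_[2]) ≠ 0 by norm_num)
    linear_combination c₀
  have c₁ : π * κ + ρ * p + 8 * ν * ρ * π = 2 * a * κ ^ 2 := by
    apply mul_left_cancel₀ (show (8 : ℤ_[2]) ≠ 0 by norm_num)
    linear_combination c₁
  have c₂ : π * p + 4 * ν * π ^ 2 + r₂ * κ + ρ * q₂ + 8 * ν * ρ * r₂ =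
      4 * a * κ * p + 64 * ν * η ^ 2 * κ ^ 2 := by
    apply mul_left_cancel₀ (show (2 : ℤ_[2]) ≠ 0 by norm_num)
    linear_combination c₂
  have hκρ : 2 ∣ κ ∧ 2 ∣ ρ := by
    have h₀ := congrArg red2 c₀
    have h₁ := congrArg red2 c₁
    have h₂ := congrArg red2 c₂
    have h64 : (64 : ZMod 2) = 0 := rfl
    simp only [map_add, map_mul, map_pow, map_ofNat, q2, two, four, eight, twelve, h64, hr₂,
      zero_mul, add_zero, mul_one, one_mul] at h₀ h₁ h₂
    rw [← red2_eq_zero, ← red2_eq_zero]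
    generalize red2 κ = κ, red2 ρ = ρ, red2 π = π, red2 p = p at *
    revert κ ρ π p
    decide
  obtain ⟨⟨κ, rfl⟩, ρ, rfl⟩ := hκρ
  have c₀ : ρ * (κ + 4 * ν * ρ) = 3 * e ^ 2 := by
    apply mul_left_cancel₀ (show (4 : ℤ_[2]) ≠ 0 by norm_num)
    linear_combination c₀
  have c₁ : π * κ + ρ * p + 8 * ν * ρ * π = 4 * a * κ ^ 2 := by
    apply mul_left_cancel₀ (show (2 : ℤ_[2]) ≠ 0 by norm_num)
    linear_combination c₁
  have h₀ : red2 ρ = 1 ∧ red2 κ = 1 := by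
    have h₀ := congrArg red2 c₀
    simp only [map_add, map_mul, map_pow, map_ofNat, e2, three, four, zero_mul, add_zero, mul_one,
      one_pow] at h₀
    generalize red2 κ = κ, red2 ρ = ρ at *
    revert κ ρ
    decide
  have hpπ : 2 ∣ p ∧ 2 ∣ π := by
    have h₁ := congrArg red2 c₁
    have h₂ := congrArg red2 c₂
    have h64 : (64 : ZMod 2) = 0 := rfl
    simp only [map_add, map_mul, map_pow, map_ofNat, q2, two, four, eight, h64, hr₂, h₀,
      zero_mul, add_zero, mul_one, one_mul, mul_zero] at h₁ h₂
    rw [← red2_eq_zero, ← red2_eq_zero]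
    generalize red2 π = π, red2 p = p at *
    revert π p
    decide
  obtain ⟨⟨p, rfl⟩, π, rfl⟩ := hpπ
  have c₁ : 2 * (π * κ + ρ * p) + 16 * ν * ρ * π = 4 * a * κ ^ 2 := by
    linear_combination c₁
  have c₂ : 2 * π * p + 8 * ν * π ^ 2 + r₂ * κ + ρ * q₂ + 8 * ν * ρ * r₂ =
      8 * a * κ * p + 128 * ν * η ^ 2 * κ ^ 2 := by
    apply mul_left_cancel₀ (show (2 : ℤ_[2]) ≠ 0 by norm_num)
    linear_combination c₂
  have c₃ : 2 * (r₂ * p + π * q₂) =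
      8 * (a * p ^ 2 + a * κ * q₂ + 64 * ν * η ^ 2 * κ * p - η * q₂ * κ -
        2 * ν * (π * r₂ + 4 * η * q₂ * ρ)) := by
    apply mul_left_cancel₀ (show (2 : ℤ_[2]) ≠ 0 by norm_num)
    linear_combination c₃
  have c₄ : r₂ * q₂ + 4 * ν * r₂ ^ 2 = 33 * e ^ 2 + 8 * (a * p * q₂ + 2 * ν * η ^ 2 *
      (16 * p ^ 2 + 16 * κ * q₂) - η * q₂ * p - 8 * ν * η * q₂ * π) := by
    linear_combination c₄
  have c₀ := congrArg red8 c₀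
  have c₁ := congrArg red8 c₁
  have c₂ := congrArg red8 c₂
  have c₃ := congrArg red8 c₃
  have c₄ := congrArg red8 c₄
  have h8 : (8 : ZMod 8) = 0 := rfl
  have h16 : (16 : ZMod 8) = 0 := rfl
  have h128 : (128 : ZMod 8) = 0 := rfl
  have h33 : (33 : ZMod 8) = 1 := rfl
  have he8 := red8_sq_of_odd he
  have hq8 := red8_sq_of_odd h2
  have hκ8 := red8_sq_of_odd (odd_iff.2 h₀.2)
  have ha8 := red8_sq_of_odd ha
  simp only [map_add, map_mul, map_pow, map_ofNat, h8, h16, h128, h33, he8, hκ8, zero_mul,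
    add_zero, mul_one] at c₀ c₁ c₂ c₃ c₄
  have key : ∀ κ : ZMod 8, κ ^ 2 = 1 → ∀ q : ZMod 8, q ^ 2 = 1 → ∀ a : ZMod 8, a ^ 2 = 1 →
      ∀ ν ρ : ZMod 8, ρ * (κ + 4 * ν * ρ) = 3 → ∀ r : ZMod 8, r * q + 4 * ν * r ^ 2 = 1 →
      ∀ p π : ZMod 8, 2 * (π * κ + ρ * p) = 4 * a → 2 * (r * p + π * q) = 0 →
      2 * π * p + r * κ + ρ * q = 0 → False := by
    decide +kernel
  exact key _ hκ8 _ hq8 _ ha8 _ _ c₀ _ c₄ _ _ c₁ c₃ c₂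

end TwoAdic

namespace TwoAdic

variable {n a η q₀ q₁ q₂ g₀ g₁ g₂ e : ℤ_[2]}

theorem System.odd_or_odd (h : System n a η q₀ q₁ q₂ g₀ g₁ g₂ e) (hn : 4 ∣ n) (hn0 : n ≠ 0)
    (ha : Odd a) (hq : Odd q₀ ∨ Odd q₁ ∨ Odd q₂) : Odd q₀ ∨ Odd q₁ := by
  by_contra! hcon
  have h2 := (hq.resolve_left hcon.1).resolve_left hcon.2
  have h0 := (even_or_odd q₀).resolve_right hcon.1
  have h1 := (even_or_odd q₁).resolve_right hcon.2
  have he : Odd e := by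
    have h := congrArg red2 h.eq₅
    simp only [map_sub, map_mul, map_pow, map_ofNat, red2_of_odd h2, red2_of_odd ha,
      red2_of_dvd h1, mul_zero, sub_zero] at h
    rw [odd_iff]
    generalize red2 e = e', red2 η = η', red2 g₂ = g' at *
    revert e' η' g'
    decide
  obtain ⟨v, -, hv | hv⟩ := exists_eq_add (x := g₂) (m := n * (2 * a * q₁ * q₂ +
    4 * n * η ^ 2 * (q₁ ^ 2 + 2 * q₀ * q₂) + 33 * e ^ 2 - 2 * η * q₂ * g₁)) h2
    (by linear_combination h.eq₄)
  · exact h.false_of_eq_add hn hn0 ha h0 h1 h2 he (r₂ := (2 * a * q₁ * q₂ + 4 * n * η ^ 2 * (q₁ ^ 2 +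
      2 * q₀ * q₂) + 33 * e ^ 2 - 2 * η * q₂ * g₁) * v) (by linear_combination hv)
  · exact h.neg.false_of_eq_add hn hn0 ha h0 h1 h2 he (r₂ := (2 * a * q₁ * q₂ + 4 * n * η ^ 2 * (q₁ ^ 2 +
      2 * q₀ * q₂) + 33 * e ^ 2 - 2 * η * q₂ * g₁) * v) (by linear_combination hv)

/-- The possible leading coefficients and linear terms of `q`, when its constant term is odd. -/
def System.Conclusion (n q₀ q₁ q₂ : ℤ_[2]) : Prop :=
  (∃ u w, Odd u ∧ q₁ = n * u ∧ q₂ = n ^ 2 * w) ∨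
    ∃ s, Odd s ∧ Odd q₁ ∧ q₂ = n * s ∧ 8 ∣ q₀ * s - (n - 1)

theorem System.conclusion_of_eq_add (h : System n a η q₀ q₁ q₂ g₀ g₁ g₂ e) (hn : 4 ∣ n)
    (hn0 : n ≠ 0) (ha : Odd a) (h0 : Odd q₀) {v : ℤ_[2]} (hg₀ : g₀ = q₀ + 384 * n * e ^ 2 * v) :
    System.Conclusion n q₀ q₁ q₂ := by
  have n2 : red2 n = 0 := red2_of_dvd (dvd_trans ⟨2, by norm_num⟩ hn)
  have h384 : (384 : ZMod 2) = 0 := rfl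
  have hg₀odd : Odd g₀ := by
    rw [odd_iff, hg₀]
    simp [n2, red2_of_odd h0]
  obtain ⟨m, hm⟩ : ∃ m, m = a + 2 * η := ⟨_, rfl⟩
  obtain ⟨m', hm'⟩ : ∃ m', m' = a - 2 * η := ⟨_, rfl⟩
  have two : (2 : ZMod 2) = 0 := rfl
  have hmodd : Odd m := by
    rw [odd_iff, hm]
    simp [two, red2_of_odd ha, map_ofNat]
  have hm'odd : Odd m' := by
    rw [odd_iff, hm']
    simp [two, red2_of_odd ha, map_ofNat]
  obtain ⟨x₁, hx₁⟩ : 384 * n * e ^ 2 ∣ g₁ - (q₁ + 2 * n * a * q₀) := dvd_of_odd_mul hg₀odd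
    ⟨-v * (q₁ + 2 * n * a * q₀), by linear_combination h.eq₁ - (q₁ + 2 * n * a * q₀) * hg₀⟩
  obtain rfl : g₁ = q₁ + 2 * n * a * q₀ + 384 * n * e ^ 2 * x₁ := by linear_combination hx₁
  obtain ⟨Y, hY⟩ : ∃ Y, Y = q₂ + 2 * n * a * q₁ - 2 * n ^ 2 * (m * m') * q₀ := ⟨_, rfl⟩
  obtain ⟨x₂, hx₂⟩ : 384 * n * e ^ 2 ∣ g₂ - Y := dvd_of_odd_mul hg₀odd
    ⟨-v * Y - x₁ * (q₁ + 2 * n * a * q₀) - 192 * n * e ^ 2 * x₁ ^ 2, by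
      apply mul_left_cancel₀ (show (2 : ℤ_[2]) ≠ 0 by norm_num)
      subst hY hm hm'
      linear_combination h.eq₂ - 2 * (q₂ + 2 * n * a * q₁ -
        2 * n ^ 2 * ((a + 2 * η) * (a - 2 * η)) * q₀) * hg₀⟩
  obtain rfl : g₂ = Y + 384 * n * e ^ 2 * x₂ := by linear_combination hx₂
  obtain ⟨x₃, hx₃⟩ : 192 * e ^ 2 ∣ q₂ - n * m * (q₁ - 2 * n * a * q₀) :=
    dvd_of_odd_mul (h0.mul hm'odd) ⟨4 * n * η * v * q₂ + x₁ * (Y + 384 * n * e ^ 2 * x₂) +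
      (q₁ + 2 * n * a * q₀) * x₂, by
      apply mul_left_cancel₀ (mul_ne_zero two_ne_zero hn0)
      subst hY hm hm'
      linear_combination -h.eq₃ + 4 * n * η * q₂ * hg₀⟩
  obtain ⟨s, rfl⟩ : n ∣ q₂ := by
    refine dvd_of_odd_mul (x := 1 - 64 * x₃ * (2 * η * (Y + 384 * n * e ^ 2 * x₂) - a * q₂ -
      8 * n * η ^ 2 * q₁)) ?_ ⟨m * (q₁ - 2 * n * a * q₀), ?_⟩
    · have h64 : (64 : ZMod 2) = 0 := rfl
      rw [odd_iff]
      simp [h64, map_ofNat]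
    · linear_combination hx₃ + 64 * x₃ * h.eq₅
  obtain ⟨ε, rfl⟩ : n ∣ e := by
    rw [← IsIntegrallyClosed.pow_dvd_pow_iff two_ne_zero]
    refine dvd_of_odd_mul (x := 3) ⟨1, by norm_num⟩ ⟨s * (m' * (-s + 4 * η * (q₁ - n * m * q₀)) +
      768 * η * e ^ 2 * x₂), ?_⟩
    subst hY hm hm'
    linear_combination h.eq₅
  have h₅ : 3 * ε ^ 2 = s * (m' * (-s + 4 * η * (q₁ - n * m * q₀)) +
      768 * η * n ^ 2 * ε ^ 2 * x₂) := by
    apply mul_left_cancel₀ (pow_ne_zero 2 hn0)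
    subst hY hm hm'
    linear_combination h.eq₅
  have hs : s = m * (q₁ - 2 * n * a * q₀) + 192 * n * ε ^ 2 * x₃ := by
    apply mul_left_cancel₀ hn0
    linear_combination hx₃
  obtain ⟨x, h₄⟩ : ∃ x, m' ^ 2 * q₀ * (n * m ^ 2 * q₀ - s) = ε ^ 2 * (33 + 16 * x) := by
    refine ⟨12 * m' * q₁ * x₃ - 12 * n * x₂ * (s + 2 * a * q₁ - 2 * n * (m * m') * q₀) -
      2304 * n ^ 3 * ε ^ 2 * x₂ ^ 2 - 48 * η * s * n ^ 2 * x₁, ?_⟩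
    apply mul_left_cancel₀ (mul_ne_zero (show (4 : ℤ_[2]) ≠ 0 by norm_num) (pow_ne_zero 3 hn0))
    subst hY hm hm'
    linear_combination h.eq₄ + 4 * n ^ 2 * (a - 2 * η) * q₁ * hs
  obtain hsodd | hseven := (even_or_odd s).symm
  · have hε : Odd ε := by
      have h := congrArg red2 h₅
      have h768 : (768 : ZMod 2) = 0 := rfl
      have four : (4 : ZMod 2) = 0 := rfl
      simp only [map_add, map_sub, map_neg, map_mul, map_pow, map_ofNat, red2_of_odd hsodd,
        red2_of_odd hm'odd, h768, four, zero_mul, add_zero, one_mul] at h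
      rw [odd_iff]
      generalize red2 ε = x at h ⊢
      revert x
      decide
    have hq₁ : Odd q₁ := by
      have h := congrArg red2 hs
      simp only [map_add, map_sub, map_mul, n2, red2_of_odd hsodd, red2_of_odd hmodd, mul_zero,
        zero_mul, sub_zero, add_zero, one_mul] at h
      exact odd_iff.2 h.symm
    refine .inr ⟨s, hsodd, hq₁, rfl, red8_eq_zero.1 ?_⟩
    have h := congrArg red8 h₄
    have h33 : (33 : ZMod 8) = 1 := rfl
    have h16 : (16 : ZMod 8) = 0 := rfl
    simp only [map_add, map_sub, map_mul, map_pow, map_ofNat, red8_sq_of_odd hm'odd,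
      red8_sq_of_odd hmodd, red8_sq_of_odd hε, h33, h16, zero_mul, add_zero] at h
    simp only [map_sub, map_mul, map_one]
    linear_combination red8 n * red8_sq_of_odd h0 - h
  · obtain ⟨c, hc, hcn⟩ : ∃ c, Odd c ∧ s * c = n * (3 * m' ^ 2 * m ^ 2 * q₀ ^ 2) := by
      refine ⟨3 * m' ^ 2 * q₀ + (33 + 16 * x) * (m' * (-s + 4 * η * (q₁ - n * m * q₀)) +
        768 * η * n ^ 2 * ε ^ 2 * x₂), ?_, ?_⟩
      · have four : (4 : ZMod 2) = 0 := rfl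
        have three : (3 : ZMod 2) = 1 := rfl
        rw [odd_iff]
        simp [n2, four, three, red2_of_odd h0, red2_of_odd hm'odd, red2_of_dvd hseven, map_ofNat]
      · linear_combination -3 * h₄ - (33 + 16 * x) * h₅
    obtain ⟨w, rfl⟩ : n ∣ s := dvd_of_odd_mul hc ⟨_, (mul_comm _ _).trans hcn⟩
    obtain ⟨u, rfl⟩ : n ∣ q₁ := dvd_of_odd_mul hmodd
      ⟨w + 2 * a * m * q₀ - 192 * ε ^ 2 * x₃, by linear_combination -hs⟩
    refine .inl ⟨u, w, ?_, rfl, by ring⟩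
    have hw : w * c = 3 * m' ^ 2 * m ^ 2 * q₀ ^ 2 :=
      mul_left_cancel₀ hn0 (by linear_combination hcn)
    have hu : w = m * (u - 2 * a * q₀) + 192 * ε ^ 2 * x₃ :=
      mul_left_cancel₀ hn0 (by linear_combination hs)
    have three : (3 : ZMod 2) = 1 := rfl
    have h192 : (192 : ZMod 2) = 0 := rfl
    have hw := congrArg red2 hw
    have hu := congrArg red2 hu
    simp only [map_add, map_sub, map_mul, map_pow, map_ofNat, red2_of_odd h0, red2_of_odd hm'odd,
      red2_of_odd hmodd, red2_of_odd hc, three, two, h192, one_pow, mul_one, one_mul, zero_mul,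
      sub_zero, add_zero] at hw hu
    rw [odd_iff, ← hu, hw]

theorem System.conclusion (h : System n a η q₀ q₁ q₂ g₀ g₁ g₂ e) (hn : 4 ∣ n) (hn0 : n ≠ 0)
    (ha : Odd a) (h0 : Odd q₀) : System.Conclusion n q₀ q₁ q₂ := by
  obtain ⟨v, -, hv | hv⟩ := exists_eq_add (x := g₀) (m := 192 * n * e ^ 2) h0
    (by linear_combination h.eq₀)
  · exact h.conclusion_of_eq_add hn hn0 ha h0 (v := v) (by linear_combination hv)
  · exact h.neg.conclusion_of_eq_add hn hn0 ha h0 (v := v) (by linear_combination hv)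

end TwoAdic

/-- The equations between coefficients expressing
`(h₀ + h₁ x + h₂ x ^ 2 + h₃ x ^ 3) ^ 2 =
  (A₀ + A₁ x + A₂ x ^ 2) (p₀ + p₁ x + p₂ x ^ 2) ^ 2 + 3 D ^ 2 f(x)`. -/
structure SquareSystem {R : Type*} [CommRing R] (A₀ A₁ A₂ h₀ h₁ h₂ h₃ p₀ p₁ p₂ D : R) : Prop where
  eq₀ : h₀ ^ 2 = A₀ * p₀ ^ 2 + 192 * D ^ 2
  eq₁ : 2 * h₀ * h₁ = 2 * A₀ * p₀ * p₁ + A₁ * p₀ ^ 2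
  eq₂ : h₁ ^ 2 + 2 * h₀ * h₂ = A₀ * (p₁ ^ 2 + 2 * p₀ * p₂) + 2 * A₁ * p₀ * p₁ + A₂ * p₀ ^ 2
  eq₃ : 2 * h₀ * h₃ + 2 * h₁ * h₂ =
    2 * A₀ * p₁ * p₂ + A₁ * (p₁ ^ 2 + 2 * p₀ * p₂) + 2 * A₂ * p₀ * p₁
  eq₄ : h₂ ^ 2 + 2 * h₁ * h₃ =
    A₀ * p₂ ^ 2 + 2 * A₁ * p₁ * p₂ + A₂ * (p₁ ^ 2 + 2 * p₀ * p₂) + 33 * D ^ 2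
  eq₅ : 2 * h₂ * h₃ = A₁ * p₂ ^ 2 + 2 * A₂ * p₁ * p₂ + 3 * D ^ 2
  eq₆ : h₃ ^ 2 = A₂ * p₂ ^ 2

namespace SquareSystem

variable {R S : Type*} [CommRing R] [CommRing S] {A₀ A₁ A₂ h₀ h₁ h₂ h₃ p₀ p₁ p₂ D : R}

theorem map (φ : R →+* S) (h : SquareSystem A₀ A₁ A₂ h₀ h₁ h₂ h₃ p₀ p₁ p₂ D) :
    SquareSystem (φ A₀) (φ A₁) (φ A₂) (φ h₀) (φ h₁) (φ h₂) (φ h₃) (φ p₀) (φ p₁) (φ p₂) (φ D) where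
  eq₀ := by simpa [map_ofNat] using congrArg φ h.eq₀
  eq₁ := by simpa [map_ofNat] using congrArg φ h.eq₁
  eq₂ := by simpa [map_ofNat] using congrArg φ h.eq₂
  eq₃ := by simpa [map_ofNat] using congrArg φ h.eq₃
  eq₄ := by simpa [map_ofNat] using congrArg φ h.eq₄
  eq₅ := by simpa [map_ofNat] using congrArg φ h.eq₅
  eq₆ := by simpa [map_ofNat] using congrArg φ h.eq₆

theorem of_map {φ : R →+* S} (hφ : Function.Injective φ)
    (h : SquareSystem (φ A₀) (φ A₁) (φ A₂) (φ h₀) (φ h₁) (φ h₂) (φ h₃) (φ p₀) (φ p₁) (φ p₂) (φ D)) :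
    SquareSystem A₀ A₁ A₂ h₀ h₁ h₂ h₃ p₀ p₁ p₂ D where
  eq₀ := hφ (by simpa [map_ofNat] using h.eq₀)
  eq₁ := hφ (by simpa [map_ofNat] using h.eq₁)
  eq₂ := hφ (by simpa [map_ofNat] using h.eq₂)
  eq₃ := hφ (by simpa [map_ofNat] using h.eq₃)
  eq₄ := hφ (by simpa [map_ofNat] using h.eq₄)
  eq₅ := hφ (by simpa [map_ofNat] using h.eq₅)
  eq₆ := hφ (by simpa [map_ofNat] using h.eq₆)

theorem mul_left (r : R) (h : SquareSystem A₀ A₁ A₂ h₀ h₁ h₂ h₃ p₀ p₁ p₂ D) :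
    SquareSystem A₀ A₁ A₂ (r * h₀) (r * h₁) (r * h₂) (r * h₃) (r * p₀) (r * p₁) (r * p₂)
      (r * D) where
  eq₀ := by linear_combination r ^ 2 * h.eq₀
  eq₁ := by linear_combination r ^ 2 * h.eq₁
  eq₂ := by linear_combination r ^ 2 * h.eq₂
  eq₃ := by linear_combination r ^ 2 * h.eq₃
  eq₄ := by linear_combination r ^ 2 * h.eq₄
  eq₅ := by linear_combination r ^ 2 * h.eq₅
  eq₆ := by linear_combination r ^ 2 * h.eq₆

theorem of_mul_left [IsDomain R] {r : R} (hr : r ≠ 0) (h : SquareSystem A₀ A₁ A₂ (r * h₀) (r * h₁)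
    (r * h₂) (r * h₃) (r * p₀) (r * p₁) (r * p₂) (r * D)) :
    SquareSystem A₀ A₁ A₂ h₀ h₁ h₂ h₃ p₀ p₁ p₂ D where
  eq₀ := mul_left_cancel₀ (pow_ne_zero 2 hr) (by linear_combination h.eq₀)
  eq₁ := mul_left_cancel₀ (pow_ne_zero 2 hr) (by linear_combination h.eq₁)
  eq₂ := mul_left_cancel₀ (pow_ne_zero 2 hr) (by linear_combination h.eq₂)
  eq₃ := mul_left_cancel₀ (pow_ne_zero 2 hr) (by linear_combination h.eq₃)
  eq₄ := mul_left_cancel₀ (pow_ne_zero 2 hr) (by linear_combination h.eq₄)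
  eq₅ := mul_left_cancel₀ (pow_ne_zero 2 hr) (by linear_combination h.eq₅)
  eq₆ := mul_left_cancel₀ (pow_ne_zero 2 hr) (by linear_combination h.eq₆)

theorem absorb {α : R}
    (h : SquareSystem (α ^ 2 * A₀) (α ^ 2 * A₁) (α ^ 2 * A₂) h₀ h₁ h₂ h₃ p₀ p₁ p₂ D) :
    SquareSystem A₀ A₁ A₂ h₀ h₁ h₂ h₃ (α * p₀) (α * p₁) (α * p₂) D where
  eq₀ := by linear_combination h.eq₀
  eq₁ := by linear_combination h.eq₁
  eq₂ := by linear_combination h.eq₂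
  eq₃ := by linear_combination h.eq₃
  eq₄ := by linear_combination h.eq₄
  eq₅ := by linear_combination h.eq₅
  eq₆ := by linear_combination h.eq₆

theorem eval (h : SquareSystem A₀ A₁ A₂ h₀ h₁ h₂ h₃ p₀ p₁ p₂ D) (t : R) :
    (h₀ + h₁ * t + h₂ * t ^ 2 + h₃ * t ^ 3) ^ 2 =
      (A₀ + A₁ * t + A₂ * t ^ 2) * (p₀ + p₁ * t + p₂ * t ^ 2) ^ 2 +
        3 * D ^ 2 * (t ^ 5 + 11 * t ^ 4 + 64) := by
  linear_combination h.eq₀ + t * h.eq₁ + t ^ 2 * h.eq₂ + t ^ 3 * h.eq₃ + t ^ 4 * h.eq₄ +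
    t ^ 5 * h.eq₅ + t ^ 6 * h.eq₆

end SquareSystem

theorem SquareSystem.of_ratPoly {A₀ A₁ A₂ m : ℚ} {H P : ℚ[X]} (hH : H.natDegree ≤ 3)
    (hP : P.natDegree ≤ 2) (h : H ^ 2 - ratQuad A₀ A₁ A₂ * P ^ 2 = C (3 * m ^ 2) * ratPoly) :
    SquareSystem A₀ A₁ A₂ (H.coeff 0) (H.coeff 1) (H.coeff 2) (H.coeff 3) (P.coeff 0) (P.coeff 1)
      (P.coeff 2) m := by
  have eH := H.as_sum_range_C_mul_X_pow' (n := 4) (by omega)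
  have eP := P.as_sum_range_C_mul_X_pow' (n := 3) (by omega)
  simp only [Finset.sum_range_succ, Finset.range_zero, Finset.sum_empty, zero_add, pow_zero,
    mul_one, pow_one] at eH eP
  generalize H.coeff 0 = h₀, H.coeff 1 = h₁, H.coeff 2 = h₂, H.coeff 3 = h₃, P.coeff 0 = p₀,
    P.coeff 1 = p₁, P.coeff 2 = p₂ at *
  subst eH eP
  have key : C (h₀ ^ 2 - (A₀ * p₀ ^ 2 + 192 * m ^ 2)) +
      C (2 * h₀ * h₁ - (2 * A₀ * p₀ * p₁ + A₁ * p₀ ^ 2)) * X +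
      C (h₁ ^ 2 + 2 * h₀ * h₂ - (A₀ * (p₁ ^ 2 + 2 * p₀ * p₂) + 2 * A₁ * p₀ * p₁ + A₂ * p₀ ^ 2)) *
        X ^ 2 +
      C (2 * h₀ * h₃ + 2 * h₁ * h₂ - (2 * A₀ * p₁ * p₂ + A₁ * (p₁ ^ 2 + 2 * p₀ * p₂) +
        2 * A₂ * p₀ * p₁)) * X ^ 3 +
      C (h₂ ^ 2 + 2 * h₁ * h₃ - (A₀ * p₂ ^ 2 + 2 * A₁ * p₁ * p₂ + A₂ * (p₁ ^ 2 + 2 * p₀ * p₂) +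
        33 * m ^ 2)) * X ^ 4 +
      C (2 * h₂ * h₃ - (A₁ * p₂ ^ 2 + 2 * A₂ * p₁ * p₂ + 3 * m ^ 2)) * X ^ 5 +
      C (h₃ ^ 2 - A₂ * p₂ ^ 2) * X ^ 6 = 0 := by
    simp only [ratQuad, ratPoly, map_add, map_sub, map_mul, map_pow, map_ofNat] at h ⊢
    linear_combination h
  have co (i : ℕ) := congrArg (coeff · i) key
  simp only [coeff_add, coeff_C_mul, coeff_C, coeff_X, coeff_X_pow, coeff_zero] at co
  exact ⟨by simpa [sub_eq_zero] using co 0, by simpa [sub_eq_zero] using co 1,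
    by simpa [sub_eq_zero] using co 2, by simpa [sub_eq_zero] using co 3,
    by simpa [sub_eq_zero] using co 4, by simpa [sub_eq_zero] using co 5,
    by simpa [sub_eq_zero] using co 6⟩

theorem SquareSystem.exists_int {A₀ A₁ A₂ : ℤ} {m : ℚ} {H P : ℚ[X]} (hm : m ≠ 0)
    (hH : H.natDegree ≤ 3) (hP : P.natDegree ≤ 2)
    (h : H ^ 2 - ratQuad A₀ A₁ A₂ * P ^ 2 = C (3 * m ^ 2) * ratPoly) :
    ∃ h₀ h₁ h₂ h₃ p₀ p₁ p₂ D : ℤ, D ≠ 0 ∧ SquareSystem A₀ A₁ A₂ h₀ h₁ h₂ h₃ p₀ p₁ p₂ D := by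
  obtain ⟨N, H₀, hN, hH₀⟩ := exists_int_map H
  obtain ⟨M, P₀, hM, hP₀⟩ := exists_int_map P
  have cH (i : ℕ) : (H₀.coeff i : ℚ) = N * H.coeff i := by
    simpa using congrArg (coeff · i) hH₀
  have cP (i : ℕ) : (P₀.coeff i : ℚ) = M * P.coeff i := by
    simpa using congrArg (coeff · i) hP₀
  have hden : (m.num : ℚ) = m.den * m := (Rat.den_mul_eq_num m).symm
  refine ⟨M * m.den * H₀.coeff 0, M * m.den * H₀.coeff 1, M * m.den * H₀.coeff 2,
    M * m.den * H₀.coeff 3, N * m.den * P₀.coeff 0, N * m.den * P₀.coeff 1, N * m.den * P₀.coeff 2,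
    N * M * m.num, mul_ne_zero (mul_ne_zero hN hM) (Rat.num_ne_zero.2 hm), ?_⟩
  refine .of_map (φ := Int.castRingHom ℚ) Int.cast_injective ?_
  convert (SquareSystem.of_ratPoly hH hP h).mul_left (N * M * m.den : ℚ) using 1 <;>
    simp only [eq_intCast, Int.cast_mul, Int.cast_natCast, cH, cP, hden] <;> ring

theorem SquareSystem.exists_odd {A₀ A₁ A₂ h₀ h₁ h₂ h₃ p₀ p₁ p₂ D : ℤ}
    (hD : D ≠ 0) (h : SquareSystem A₀ A₁ A₂ h₀ h₁ h₂ h₃ p₀ p₁ p₂ D) :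
    ∃ h₀ h₁ h₂ h₃ p₀ p₁ p₂ D : ℤ, D ≠ 0 ∧ SquareSystem A₀ A₁ A₂ h₀ h₁ h₂ h₃ p₀ p₁ p₂ D ∧
      (Odd p₀ ∨ Odd p₁ ∨ Odd p₂) := by
  induction hk : D.natAbs using Nat.strong_induction_on generalizing h₀ h₁ h₂ h₃ p₀ p₁ p₂ D with
  | _ k ih =>
    by_cases hodd : Odd p₀ ∨ Odd p₁ ∨ Odd p₂
    · exact ⟨_, _, _, _, _, _, _, _, hD, h, hodd⟩
    simp only [not_or, Int.not_odd_iff_even, even_iff_two_dvd] at hodd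
    obtain ⟨⟨p₀, rfl⟩, ⟨p₁, rfl⟩, ⟨p₂, rfl⟩⟩ := hodd
    obtain ⟨D, rfl⟩ : 2 ∣ D := by
      have : 2 ∣ 3 * D ^ 2 := ⟨h₂ * h₃ - 2 * A₁ * p₂ ^ 2 - 4 * A₂ * p₁ * p₂,
        by linear_combination -h.eq₅⟩
      exact Int.prime_two.dvd_of_dvd_pow (Int.prime_two.dvd_or_dvd this |>.resolve_left (by omega))
    obtain ⟨h₀, rfl⟩ : 2 ∣ h₀ := Int.prime_two.dvd_of_dvd_pow (n := 2)
      ⟨2 * A₀ * p₀ ^ 2 + 384 * D ^ 2, by linear_combination h.eq₀⟩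
    obtain ⟨h₃, rfl⟩ : 2 ∣ h₃ := Int.prime_two.dvd_of_dvd_pow (n := 2)
      ⟨2 * A₂ * p₂ ^ 2, by linear_combination h.eq₆⟩
    obtain ⟨h₁, rfl⟩ : 2 ∣ h₁ := Int.prime_two.dvd_of_dvd_pow (n := 2)
      ⟨2 * (A₀ * (p₁ ^ 2 + 2 * p₀ * p₂) + 2 * A₁ * p₀ * p₁ + A₂ * p₀ ^ 2) - 2 * h₀ * h₂,
        by linear_combination h.eq₂⟩
    obtain ⟨h₂, rfl⟩ : 2 ∣ h₂ := Int.prime_two.dvd_of_dvd_pow (n := 2)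
      ⟨2 * (A₀ * p₂ ^ 2 + 2 * A₁ * p₁ * p₂ + A₂ * (p₁ ^ 2 + 2 * p₀ * p₂) + 33 * D ^ 2) -
        4 * h₁ * h₃, by linear_combination h.eq₄⟩
    have hD := right_ne_zero_of_mul hD
    exact ih D.natAbs (by omega) hD (h.of_mul_left two_ne_zero) rfl

theorem SquareSystem.cutsDivisor {A₀ A₁ A₂ h₀ h₁ h₂ h₃ g p₀ p₁ p₂ D : ℤ} (hD : D ≠ 0)
    (h : SquareSystem A₀ A₁ A₂ h₀ h₁ h₂ h₃ (g * p₀) (g * p₁) (g * p₂) D) :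
    CutsDivisor p₀ p₁ p₂ := by
  refine ⟨C (h₀ : ℚ) + C (h₁ : ℚ) * X + C (h₂ : ℚ) * X ^ 2 + C (h₃ : ℚ) * X ^ 3,
    C (g ^ 2 : ℚ) * ratQuad A₀ A₁ A₂ * ratQuad p₀ p₁ p₂, D, Int.cast_ne_zero.2 hD, ?_⟩
  have := (h.map (Int.castRingHom ℚ[X])).eval X
  simp only [eq_intCast, Int.cast_mul] at this
  simp only [ratQuad, ratPoly, map_mul, map_pow, map_ofNat, map_intCast]
  linear_combination this

namespace TwoAdic

variable {ν a b h₀ h₁ h₂ h₃ q₀ q₁ q₂ D : ℤ_[2]}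

theorem exists_system (hν : ν ≠ 0) (hD : D ≠ 0)
    (h : SquareSystem 1 (4 * ν ^ 2 * a) (16 * ν ^ 4 * b) h₀ h₁ h₂ h₃ q₀ q₁ q₂ D) :
    ∃ η e, System (ν ^ 2) a η q₀ q₁ q₂ h₀ h₁ h₂ e := by
  have hq₂ : q₂ ≠ 0 := by
    rintro rfl
    have h3 : h₃ = 0 := pow_eq_zero_iff two_ne_zero |>.1 (by linear_combination h.eq₆)
    have h5 : (3 : ℤ_[2]) * D ^ 2 = 0 := by linear_combination 2 * h₂ * h3 - h.eq₅
    simp [hD] at h5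
  obtain ⟨η, rfl⟩ := dvd_of_sq_eq_mul_sq (x := h₃) (y := 4 * ν ^ 2 * q₂) (z := b)
    (by linear_combination h.eq₆)
  have hc : (4 * ν ^ 2 * q₂) ^ 2 ≠ 0 :=
    pow_ne_zero 2 (mul_ne_zero (mul_ne_zero (by norm_num) (pow_ne_zero 2 hν)) hq₂)
  obtain rfl : b = η ^ 2 := mul_left_cancel₀ hc (by linear_combination -h.eq₆)
  obtain ⟨e, rfl⟩ : 2 * ν ∣ D := by
    rw [← IsIntegrallyClosed.pow_dvd_pow_iff two_ne_zero]
    refine dvd_of_odd_mul (x := 3) ⟨1, by norm_num⟩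
      ⟨q₂ * (2 * η * h₂ - a * q₂ - 8 * ν ^ 2 * η ^ 2 * q₁), ?_⟩
    linear_combination -h.eq₅
  have h2 : (2 : ℤ_[2]) ≠ 0 := two_ne_zero
  refine ⟨η, e, ⟨?_, ?_, ?_, ?_, ?_, ?_⟩⟩
  · linear_combination h.eq₀
  · exact mul_left_cancel₀ h2 (by linear_combination h.eq₁)
  · linear_combination h.eq₂
  · exact mul_left_cancel₀ h2 (by linear_combination h.eq₃)
  · linear_combination h.eq₄
  · refine mul_left_cancel₀ (pow_ne_zero 2 (mul_ne_zero h2 hν)) ?_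
    linear_combination -h.eq₅

theorem odd_and_conclusion (hν : ν ≠ 0) (hν2 : 2 ∣ ν) (ha : Odd a) (hD : D ≠ 0)
    (h : SquareSystem 1 (4 * ν ^ 2 * a) (16 * ν ^ 4 * b) h₀ h₁ h₂ h₃ q₀ q₁ q₂ D)
    (hq : Odd q₀ ∨ Odd q₁ ∨ Odd q₂) : Odd q₀ ∧ System.Conclusion (ν ^ 2) q₀ q₁ q₂ := by
  obtain ⟨η, e, hs⟩ := exists_system hν hD h
  have hn : 4 ∣ ν ^ 2 := by
    obtain ⟨c, rfl⟩ := hν2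
    exact ⟨c ^ 2, by ring⟩
  have h0 : Odd q₀ := by
    by_contra h0
    have h1 := (hs.odd_or_odd hn (pow_ne_zero 2 hν) ha hq).resolve_left h0
    obtain ⟨t, ht, hroot⟩ := exists_root (r := q₂) ((even_or_odd q₀).resolve_right h0) h1
    have key := h.eval t
    obtain ⟨s, hs⟩ := dvd_of_sq_eq_mul_sq (x := h₀ + h₁ * t + h₂ * t ^ 2 + h₃ * t ^ 3) (y := D)
      (z := 3 * t ^ 5 + 33 * t ^ 4 + 192) (by rw [key, hroot]; ring)
    refine not_sq_of_dvd (s := s) ht (mul_left_cancel₀ (pow_ne_zero 2 hD) ?_)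
    rw [hs, hroot] at key
    linear_combination key
  exact ⟨h0, hs.conclusion hn (pow_ne_zero 2 hν) ha h0⟩

theorem two_pow_dvd_cast {k : ℕ} {x : ℤ} : (2 : ℤ_[2]) ^ k ∣ x ↔ 2 ^ k ∣ x := by
  have := PadicInt.pow_p_dvd_int_iff (p := 2) k x
  push_cast at this
  exact this

theorem odd_cast {x : ℤ} : Odd (x : ℤ_[2]) ↔ Odd x := by
  rw [← not_dvd_iff, ← Int.not_even_iff_odd, even_iff_two_dvd]
  simpa using (two_pow_dvd_cast (k := 1) (x := x)).not

theorem eight_dvd_cast {x : ℤ} : 8 ∣ (x : ℤ_[2]) ↔ 8 ∣ x := by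
  have := two_pow_dvd_cast (k := 3) (x := x)
  norm_num at this
  exact this

end TwoAdic

open TwoAdic

theorem SquareSystem.conclusion {A₀ a b h₀ h₁ h₂ h₃ p₀ p₁ p₂ D : ℤ} {k : ℕ} (hk : k ≠ 0)
    (hA₀ : A₀ % 8 = 1) (ha : Odd a) (hD : D ≠ 0) (h : SquareSystem A₀ (4 * 4 ^ k * a)
      (16 * (4 ^ k) ^ 2 * b) h₀ h₁ h₂ h₃ p₀ p₁ p₂ D) (hp : Odd p₀ ∨ Odd p₁ ∨ Odd p₂) :
    Odd p₀ ∧ ((∃ u w, Odd u ∧ p₁ = 4 ^ k * u ∧ p₂ = (4 ^ k) ^ 2 * w) ∨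
      ∃ s, Odd s ∧ Odd p₁ ∧ p₂ = 4 ^ k * s ∧ 8 ∣ p₀ * s - (4 ^ k - 1)) := by
  obtain ⟨α, hα⟩ : ∃ α : ℤ_[2], α ^ 2 = A₀ := exists_sq_eq (by
    have : 8 ∣ A₀ - 1 := by omega
    simpa using eight_dvd_cast.2 this)
  have hαodd : Odd α := by
    have h1 := odd_cast.2 (Int.odd_iff.2 (by omega : A₀ % 2 = 1))
    rw [← hα, odd_iff, map_pow] at h1
    rw [odd_iff]
    generalize red2 α = x at h1 ⊢
    revert x
    decide
  obtain ⟨β, hβ⟩ := (isUnit_iff_odd.2 hαodd).exists_right_inv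
  have hβodd : Odd β := isUnit_iff_odd.1 (IsUnit.of_mul_eq_one_right _ hβ)
  have of_odd_mul {x : ℤ} (hx : Odd (α * x)) : Odd x := by
    rw [odd_iff, map_mul, red2_of_odd hαodd, one_mul, ← odd_iff] at hx
    exact odd_cast.1 hx
  have cast_pow : (((4 : ℤ) ^ k : ℤ) : ℤ_[2]) = (2 ^ k) ^ 2 := by
    push_cast
    rw [← pow_mul, mul_comm, pow_mul]
    norm_num
  have pow_ne : ((2 : ℤ_[2]) ^ k) ^ 2 ≠ 0 := pow_ne_zero 2 (pow_ne_zero k two_ne_zero)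
  have dvd_of {x : ℤ} {u : ℤ_[2]} (hx : α * x = (2 ^ k) ^ 2 * u) :
      ∃ y : ℤ, x = 4 ^ k * y ∧ α * y = u := by
    obtain ⟨y, hy⟩ : (2 : ℤ) ^ (k * 2) ∣ x := by
      rw [← two_pow_dvd_cast, pow_mul]
      exact dvd_of_odd_mul hαodd ⟨u, hx⟩
    rw [mul_comm k, pow_mul] at hy
    norm_num at hy
    refine ⟨y, hy, mul_left_cancel₀ pow_ne ?_⟩
    rw [← hx, hy, Int.cast_mul, cast_pow]
    ring
  have h' := h.map (Int.castRingHom ℤ_[2])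
  simp only [eq_intCast] at h'
  have e₀ : (A₀ : ℤ_[2]) = α ^ 2 * 1 := by rw [hα, mul_one]
  have e₁ : ((4 * 4 ^ k * a : ℤ) : ℤ_[2]) = α ^ 2 * (4 * (2 ^ k) ^ 2 * (β ^ 2 * a)) := by
    rw [Int.cast_mul, Int.cast_mul, cast_pow, Int.cast_ofNat]
    linear_combination -4 * (2 ^ k) ^ 2 * (a : ℤ_[2]) * (α * β + 1) * hβ
  have e₂ : ((16 * (4 ^ k) ^ 2 * b : ℤ) : ℤ_[2]) = α ^ 2 * (16 * (2 ^ k) ^ 4 * (β ^ 2 * b)) := by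
    rw [Int.cast_mul, Int.cast_mul, Int.cast_pow, cast_pow, Int.cast_ofNat]
    linear_combination -16 * (2 ^ k) ^ 4 * (b : ℤ_[2]) * (α * β + 1) * hβ
  rw [e₀, e₁, e₂] at h'
  obtain ⟨h0, hc⟩ := odd_and_conclusion (pow_ne_zero k two_ne_zero) (dvd_pow_self 2 hk)
    (hβodd.pow.mul (odd_cast.2 ha)) (Int.cast_ne_zero.2 hD) h'.absorb (by
      refine hp.imp (hαodd.mul <| odd_cast.2 ·) (Or.imp ?_ ?_) <;>
        exact (hαodd.mul <| odd_cast.2 ·))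
  refine ⟨of_odd_mul h0, hc.imp ?_ ?_⟩
  · rintro ⟨u, w, hu, h1, h2⟩
    obtain ⟨u, hu1, rfl⟩ := dvd_of h1
    obtain ⟨y, rfl, h3⟩ := dvd_of (u := (2 ^ k) ^ 2 * w) (by rw [h2]; ring)
    obtain ⟨y, rfl, -⟩ := dvd_of h3
    exact ⟨u, y, of_odd_mul hu, hu1, by ring⟩
  · rintro ⟨s, hs, h1, h2, h3⟩
    obtain ⟨s, rfl, rfl⟩ := dvd_of h2
    refine ⟨s, of_odd_mul hs, of_odd_mul h1, rfl, ?_⟩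
    have h4 : 8 ∣ A₀ * (p₀ * s) - (4 ^ k - 1) := by
      rw [← eight_dvd_cast, Int.cast_sub, Int.cast_sub, cast_pow, Int.cast_mul, ← hα]
      convert h3 using 1
      push_cast
      ring
    obtain ⟨c, hc⟩ : 8 ∣ A₀ - 1 := by omega
    have : p₀ * s - (4 ^ k - 1) = (A₀ * (p₀ * s) - (4 ^ k - 1)) - 8 * (c * (p₀ * s)) := by
      linear_combination -p₀ * s * hc
    rw [this]
    exact h4.sub (dvd_mul_right _ _)

theorem det_ratPoly {a b c : ℚ} (hc : c ≠ 0) :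
    (aeval !![0, -(a / c); 1, -(b / c)] ratPoly).det * c ^ 5 = quadNorm a b c := by
  have h2 : !![0, -(a / c); 1, -(b / c)] ^ 2 =
      !![-(a / c), a / c * (b / c); -(b / c), (b / c) ^ 2 - a / c] := by
    rw [sq, Matrix.mul_fin_two]
    ext i j
    fin_cases i <;> fin_cases j <;> (simp; try ring)
  have h4 := congrArg (· ^ 2) h2
  simp only [← pow_mul, sq !![-(a / c), a / c * (b / c); -(b / c), (b / c) ^ 2 - a / c],
    Matrix.mul_fin_two] at h4
  norm_num at h4
  simp only [ratPoly, map_add, map_mul, map_pow, aeval_X, aeval_C, pow_succ _ 4, h4,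
    Matrix.mul_fin_two, Matrix.det_fin_two, Matrix.add_apply, Algebra.algebraMap_eq_smul_one]
  simp
  field_simp
  unfold quadNorm
  ring

theorem aeval_ratQuad {a b c : ℚ} (hc : c ≠ 0) :
    aeval !![0, -(a / c); 1, -(b / c)] (ratQuad a b c) = 0 := by
  simp only [ratQuad, map_add, map_mul, aeval_X, aeval_C, sq, Matrix.mul_fin_two,
    Algebra.algebraMap_eq_smul_one]
  ext i j
  fin_cases i <;> fin_cases j <;> simp <;> field_simp <;> ring

theorem exists_int_mul_sq_eq {N l : ℤ} {x y : ℚ} (hx : x ≠ 0) (h : N * x ^ 2 = l * y ^ 2) :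
    ∃ x y : ℤ, x ≠ 0 ∧ N * x ^ 2 = l * y ^ 2 := by
  refine ⟨x.num * y.den, y.num * x.den,
    mul_ne_zero (Rat.num_ne_zero.2 hx) (mod_cast y.den_ne_zero), ?_⟩
  have hx := Rat.den_mul_eq_num x
  have hy := Rat.den_mul_eq_num y
  have : (N : ℚ) * (x.num * y.den) ^ 2 = l * (y.num * x.den) ^ 2 := by
    rw [← hx, ← hy]
    linear_combination (x.den * y.den : ℚ) ^ 2 * h
  exact_mod_cast this

theorem CutsDivisor.exists_quadNorm_mul_sq_eq {a b c ν l : ℤ} (h : CutsDivisor a b c) (hc0 : c ≠ 0)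
    (hc : c = ν ^ 2 * l) : ∃ x y : ℤ, x ≠ 0 ∧ quadNorm a b c * x ^ 2 = l * y ^ 2 := by
  obtain ⟨V, W, m, hm, h⟩ := h
  have hc0' : (c : ℚ) ≠ 0 := Int.cast_ne_zero.2 hc0
  have hN := det_ratPoly (a := a) (b := b) hc0'
  have key := congrArg (fun V ↦ (aeval !![0, -(a / c : ℚ); 1, -(b / c : ℚ)] V).det) h
  simp only [map_sub, map_mul, map_pow, aeval_ratQuad hc0', zero_mul, sub_zero, aeval_C,
    Algebra.algebraMap_eq_smul_one, smul_mul_assoc, _root_.smul_pow, one_pow, one_mul, Matrix.det_smul, Matrix.det_pow,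
    Fintype.card_fin] at key
  generalize (aeval !![0, -(a / c : ℚ); 1, -(b / c : ℚ)] V).det = d at key
  refine exists_int_mul_sq_eq (x := 3 * m ^ 2) (y := ν * c ^ 2 * d) (by simpa using hm) ?_
  have hc' : (c : ℚ) = ν ^ 2 * l := mod_cast hc
  have hN' : ((quadNorm a b c : ℤ) : ℚ) = quadNorm (a : ℚ) b c := by simp [quadNorm]
  rw [hN', ← hN]
  linear_combination -c ^ 5 * key + c ^ 4 * d ^ 2 * hc'

theorem exists_primitive {p₀ : ℤ} (h0 : p₀ ≠ 0) (p₁ p₂ : ℤ) : ∃ g q₀ q₁ q₂ : ℤ, p₀ = g * q₀ ∧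
    p₁ = g * q₁ ∧ p₂ = g * q₂ ∧
      ∀ p : ℕ, p.Prime → ¬ ((p : ℤ) ∣ q₀ ∧ (p : ℤ) ∣ q₁ ∧ (p : ℤ) ∣ q₂) := by
  obtain ⟨g, hg⟩ : ∃ g, g = gcd (gcd p₀ p₁) p₂ := ⟨_, rfl⟩
  have hdvd : ∀ d, d ∣ p₀ ∧ d ∣ p₁ ∧ d ∣ p₂ ↔ d ∣ g := by
    intro d
    rw [hg, dvd_gcd_iff, dvd_gcd_iff, and_assoc]
  obtain ⟨⟨q₀, rfl⟩, ⟨q₁, rfl⟩, ⟨q₂, rfl⟩⟩ := (hdvd g).2 dvd_rfl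
  refine ⟨g, q₀, q₁, q₂, rfl, rfl, rfl, fun p hp h ↦ ?_⟩
  have hg0 : g ≠ 0 := left_ne_zero_of_mul h0
  have : g * p ∣ g * 1 := by
    rw [mul_one, ← hdvd]
    exact ⟨mul_dvd_mul_left g h.1, mul_dvd_mul_left g h.2.1, mul_dvd_mul_left g h.2.2⟩
  exact (Nat.prime_iff_prime_int.1 hp).not_isUnit
    (isUnit_of_dvd_one ((mul_dvd_mul_iff_left hg0).1 this))

theorem exists_eq_mul_of_odd_mul {g x u n : ℤ} {k : ℕ} (hg : Odd g) (hn : n = 4 ^ k)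
    (h : g * x = n * u) : ∃ y, x = n * y ∧ g * y = u := by
  have hco : IsCoprime n g := by
    rw [hn, show (4 : ℤ) = 2 ^ 2 by norm_num]
    exact (Int.isCoprime_two_left.2 hg).pow_left.pow_left
  obtain ⟨y, rfl⟩ := hco.dvd_of_dvd_mul_left ⟨u, h⟩
  have hn0 : n ≠ 0 := by rw [hn]; positivity
  exact ⟨y, rfl, mul_left_cancel₀ hn0 (by linear_combination h)⟩

theorem eight_dvd_sq_sub_one {g : ℤ} (hg : Odd g) : 8 ∣ g ^ 2 - 1 := by
  obtain ⟨x, rfl⟩ := hg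
  obtain ⟨c, hc⟩ := (Int.even_mul_succ_self x).two_dvd
  exact ⟨c, by linear_combination 4 * hc⟩

theorem coeff_ratQuad (a b c : ℚ) : (ratQuad a b c).coeff 0 = a ∧ (ratQuad a b c).coeff 1 = b ∧
    (ratQuad a b c).coeff 2 = c := by
  simp [ratQuad, coeff_X, coeff_C]

theorem natDegree_ratQuad_le (a b c : ℚ) : (ratQuad a b c).natDegree ≤ 2 := by
  unfold ratQuad
  compute_degree

theorem sq_eq_of_isSquare_ratQuad {a b c : ℚ} (h : IsSquare (ratQuad a b c)) :
    b ^ 2 = 4 * a * c := by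
  obtain ⟨r, hr⟩ := h
  have hdeg : r.natDegree ≤ 1 := by
    have := congrArg natDegree hr
    rw [← sq, natDegree_pow] at this
    have := natDegree_ratQuad_le a b c
    omega
  obtain ⟨v, u, rfl⟩ := exists_eq_X_add_C_of_natDegree_le_one hdeg
  have e : (C v * X + C u) * (C v * X + C u) = ratQuad (u ^ 2) (2 * u * v) (v ^ 2) := by
    simp only [ratQuad, map_mul, map_pow, map_ofNat]
    ring
  rw [e] at hr
  obtain ⟨h0, h1, h2⟩ := coeff_ratQuad a b c
  obtain ⟨k0, k1, k2⟩ := coeff_ratQuad (u ^ 2) (2 * u * v) (v ^ 2)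
  rw [hr] at h0 h1 h2
  rw [← h0, ← h1, ← h2, k0, k1, k2]
  ring

/-- A divisor cut out by a quadratic polynomial which is `2`-adically close to a constant, as
measured by `k`. -/
structure NearConstant (k : ℕ) (a b c : ℤ) : Prop where
  cutsDivisor : CutsDivisor a b c
  prim : ∀ p : ℕ, p.Prime → ¬ ((p : ℤ) ∣ a ∧ (p : ℤ) ∣ b ∧ (p : ℤ) ∣ c)
  odd : Odd a
  linear : ∃ u, Odd u ∧ b = 4 ^ k * u
  quadratic : ∃ w, c = (4 ^ k) ^ 2 * w

theorem NearConstant.exists_squareSystem {k : ℕ} {a b c : ℤ} (h : NearConstant (k + 1) a b c)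
    {s : ℤ} {γ : 𝓞 K} (hs : s = 1 ∨ s = -1)
    (hγ : (Coord.quad (s * a) (s * b) (s * c)).toInt = γ ^ 2) :
    ∃ h₀ h₁ h₂ h₃ p₀ p₁ p₂ D : ℤ, D ≠ 0 ∧
      SquareSystem (s * a) (s * b) (s * c) h₀ h₁ h₂ h₃ p₀ p₁ p₂ D := by
  obtain ⟨⟨V, W, m, hm, hV⟩, -, -, ⟨u, hu, hb⟩, ⟨w, hc⟩⟩ := h
  have hs2 : s ^ 2 = 1 := by rcases hs with rfl | rfl <;> norm_num
  have hs0 : s ≠ 0 := by rintro rfl; norm_num at hs2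
  have hu0 : u ≠ 0 := by rintro rfl; simp at hu
  have hb0 : s * b ≠ 0 := by
    rw [hb]
    positivity
  have hU : (ratQuad (s * a : ℤ) (s * b : ℤ) (s * c : ℤ)) = C (s : ℚ) * ratQuad a b c := by
    simp only [ratQuad, Int.cast_mul, map_mul]
    ring
  obtain ⟨H, P, m, hm, -, hH, hP, h⟩ := exists_half
    (U := ratQuad (s * a : ℤ) (s * b : ℤ) (s * c : ℤ)) (V := V) (W := C (s : ℚ) * W) (γ := γ) hm
    (le_natDegree_of_ne_zero (by rw [(coeff_ratQuad _ _ _).2.1]; exact_mod_cast hb0))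
    (natDegree_ratQuad_le _ _ _) (fun hsq ↦ by
      have h4 : (s * b) ^ 2 = 4 * (s * a) * (s * c) := by
        exact_mod_cast sq_eq_of_isSquare_ratQuad hsq
      have h4 : (4 ^ (k + 1)) ^ 2 * u ^ 2 = (4 ^ (k + 1)) ^ 2 * (4 * a * w) := by
        rw [hb, hc] at h4
        linear_combination h4 - ((4 ^ (k + 1)) ^ 2 * (u ^ 2 - 4 * a * w)) * hs2
      have h4 : u ^ 2 = 4 * a * w := mul_left_cancel₀ (by positivity) h4
      have : Odd (u ^ 2) := hu.pow
      rw [h4, mul_assoc, Int.odd_mul] at this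
      exact absurd this.1 (by decide))
    (by
      have := congrArg (algebraMap (𝓞 K) K) hγ
      rw [Coord.toInt_quad] at this
      simpa [ratQuad] using this)
    (by
      have hC : (C (s : ℚ)) ^ 2 = 1 := by
        rw [← map_pow, ← Int.cast_pow, hs2, Int.cast_one, map_one]
      rw [hU]
      linear_combination hV - ratQuad a b c * W * hC)
  exact SquareSystem.exists_int hm hH hP h

theorem not_nearConstant_succ (k : ℕ) {a b c : ℤ} : ¬ NearConstant (k + 1) a b c := by
  induction k generalizing a b c with
  | zero =>
    intro h
    obtain ⟨u, hu, hb⟩ := h.linear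
    obtain ⟨w, hc⟩ := h.quadratic
    norm_num at hb hc
    have := (h.cutsDivisor.isSquare h.odd h.prim (by omega) (by omega)).1
    rw [Int.odd_iff] at hu
    omega
  | succ k ih =>
    intro h
    obtain ⟨u, hu, hb⟩ := h.linear
    obtain ⟨w, hc⟩ := h.quadratic
    obtain ⟨n, hn⟩ : ∃ n : ℤ, n = 4 ^ (k + 1) := ⟨_, rfl⟩
    have hn4 : 4 ∣ n := hn ▸ dvd_pow_self 4 k.succ_ne_zero
    have hb' : b = 4 * (n * u) := by rw [hb, hn]; ring
    have hc' : c = 8 * (2 * n ^ 2 * w) := by rw [hc, hn]; ring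
    obtain ⟨-, s, γ, hs, hsa, hγ⟩ :=
      h.cutsDivisor.isSquare h.odd h.prim ⟨_, hb'⟩ ⟨_, hc'⟩
    obtain ⟨h₀, h₁, h₂, h₃, p₀, p₁, p₂, D, hD, hS⟩ := h.exists_squareSystem hs hγ
    obtain ⟨h₀, h₁, h₂, h₃, p₀, p₁, p₂, D, hD, hS, hp⟩ := hS.exists_odd hD
    have hsu : Odd (s * u) := by
      rcases hs with rfl | rfl <;> simpa using hu
    have e₁ : s * b = 4 * 4 ^ (k + 1) * (s * u) := by rw [hb', hn]; ring
    have e₂ : s * c = 16 * (4 ^ (k + 1)) ^ 2 * (s * w) := by rw [hc', hn]; ring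
    rw [e₁, e₂] at hS
    obtain ⟨h0, hcon⟩ := hS.conclusion k.succ_ne_zero hsa hsu hD hp
    obtain ⟨g, q₀, q₁, q₂, rfl, rfl, rfl, hprim⟩ :=
      exists_primitive (by rintro rfl; simp at h0 : p₀ ≠ 0) p₁ p₂
    have hcut := hS.cutsDivisor hD
    rw [Int.odd_mul] at h0
    rcases hcon with ⟨u, w, hu, h1, h2⟩ | ⟨t, ht, h1, h2, h3⟩
    · obtain ⟨u, rfl, rfl⟩ := exists_eq_mul_of_odd_mul h0.1 rfl h1
      obtain ⟨w, rfl, -⟩ := exists_eq_mul_of_odd_mul (k := (k + 1) * 2) h0.1 (pow_mul _ _ _).symm h2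
      exact ih ⟨hcut, hprim, h0.2, ⟨u, (Int.odd_mul.1 hu).2, rfl⟩, ⟨w, rfl⟩⟩
    · obtain ⟨t, rfl, rfl⟩ := exists_eq_mul_of_odd_mul h0.1 rfl h2
      rw [Int.odd_mul] at h1 ht
      obtain ⟨x, y, hx, hxy⟩ := hcut.exists_quadNorm_mul_sq_eq (ν := 2 ^ (k + 1)) (l := t)
        (by have : t ≠ 0 := by (rintro rfl; simp at ht)
            positivity)
        (by rw [← pow_mul, mul_comm (k + 1), pow_mul]; norm_num)
      have := hcut.mul_mod_eight h0.2 hprim h1.2 ht.2 hx hxy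
      obtain ⟨c, hg⟩ := eight_dvd_sq_sub_one h0.1
      have e : g * q₀ * (g * t) = q₀ * t + 8 * (c * (q₀ * t)) := by linear_combination q₀ * t * hg
      rw [e, ← hn] at h3
      omega

theorem cutsDivisor_of_eval_eq {a e : ℤ} {x z : ℚ} (he : e ≠ 0) (hx : a = 3 * e ^ 2 * x)
    (h : x ^ 5 + 11 * x ^ 4 + 64 = 3 * z ^ 2) : CutsDivisor a (-3 * e ^ 2) 0 := by
  obtain ⟨W, hW⟩ : X - C x ∣ C (9 * z ^ 2) - C 3 * ratPoly := by
    rw [dvd_iff_isRoot, IsRoot.def]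
    simp only [ratPoly, eval_sub, eval_mul, eval_add, eval_pow, eval_C, eval_X]
    linear_combination -3 * h
  have hc : (-3 * e ^ 2 : ℚ) ≠ 0 := by
    have : (e : ℚ) ≠ 0 := Int.cast_ne_zero.2 he
    positivity
  refine ⟨C (3 * z), C (-3 * e ^ 2 : ℚ)⁻¹ * W, 1, one_ne_zero, ?_⟩
  have hU : ratQuad a (-3 * e ^ 2 : ℤ) (0 : ℤ) = C (-3 * e ^ 2 : ℚ) * (X - C x) := by
    simp only [ratQuad, hx, map_mul, map_pow, map_neg, map_ofNat, Int.cast_mul, Int.cast_neg,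
      Int.cast_pow, Int.cast_ofNat, Int.cast_zero, map_zero]
    ring
  have hC : C (-3 * e ^ 2 : ℚ) * C (-3 * e ^ 2 : ℚ)⁻¹ = 1 := by
    rw [← C_mul, mul_inv_cancel₀ hc, C_1]
  rw [hU]
  have h9 : C (9 * z ^ 2) = (C (3 * z)) ^ 2 := by
    rw [← C_pow]
    congr 1
    ring
  have h3 : C (3 * 1 ^ 2 : ℚ) = C 3 := by norm_num
  rw [h3]
  linear_combination hW - h9 - (X - C x) * W * hC

theorem exists_int_of_sq_eq {n : ℤ} {r : ℚ} (h : r ^ 2 = n) : ∃ t : ℤ, t ^ 2 = n := by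
  have hr := Rat.den_mul_eq_num r
  have h1 : r.num ^ 2 = r.den ^ 2 * n := by
    have : (r.num : ℚ) ^ 2 = r.den ^ 2 * n := by
      rw [← hr]
      linear_combination (r.den : ℚ) ^ 2 * h
    exact_mod_cast this
  have hd : (r.den : ℤ) ≠ 0 := mod_cast r.den_ne_zero
  obtain ⟨t, ht⟩ := (Int.pow_dvd_pow_iff two_ne_zero).1 (Dvd.intro _ h1.symm)
  refine ⟨t, mul_left_cancel₀ (pow_ne_zero 2 hd) ?_⟩
  rw [← h1, ht]
  ring

theorem exists_coprime_of_eq {x z : ℚ} (h : x ^ 5 + 11 * x ^ 4 + 64 = 3 * z ^ 2) :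
    ∃ a e w : ℤ, e ≠ 0 ∧ IsCoprime a e ∧ (a : ℚ) = 3 * e ^ 2 * x ∧
      w ^ 2 = a ^ 5 + 33 * a ^ 4 * e ^ 2 + 15552 * e ^ 10 := by
  obtain ⟨X, hX⟩ : ∃ X, X = 3 * x := ⟨_, rfl⟩
  have hco : IsCoprime X.num X.den := Int.isCoprime_iff_gcd_eq_one.2 X.reduced
  have hb : (0 : ℤ) < X.den := mod_cast X.den_pos
  have hab : (X.num : ℚ) = X.den * X := (Rat.den_mul_eq_num X).symm
  have hb' : ((X.den : ℤ) : ℚ) = X.den := Int.cast_natCast _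
  rw [← hb'] at hab
  generalize X.num = a, (X.den : ℤ) = b at hco hab hb
  obtain ⟨t, ht⟩ := exists_int_of_sq_eq (r := 27 * z * b ^ 3)
    (n := b * (a ^ 5 + 33 * a ^ 4 * b + 15552 * b ^ 5)) (by
      push_cast
      rw [hab, hX]
      linear_combination -243 * b ^ 6 * h)
  have hco' : IsCoprime b (a ^ 5 + 33 * a ^ 4 * b + 15552 * b ^ 5) := by
    have : a ^ 5 + 33 * a ^ 4 * b + 15552 * b ^ 5 =
      a ^ 5 + b * (33 * a ^ 4 + 15552 * b ^ 4) := by ring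
    rw [this]
    exact hco.symm.pow_right.add_mul_left_right _
  obtain ⟨e, rfl | rfl⟩ := Int.sq_of_isCoprime hco' ht.symm
  · have he : e ≠ 0 := by rintro rfl; simp at hb
    obtain ⟨w, rfl⟩ := (Int.pow_dvd_pow_iff two_ne_zero).1 (Dvd.intro _ ht.symm)
    refine ⟨a, e, w, he, (IsCoprime.pow_right_iff two_pos).1 hco, ?_, mul_left_cancel₀ (pow_ne_zero 2 he) ?_⟩
    · rw [hab, hX]
      push_cast
      ring
    · linear_combination ht
  · nlinarith [sq_nonneg e]

theorem not_three_dvd {a e w : ℤ} (he : IsCoprime a e)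
    (h : w ^ 2 = a ^ 5 + 33 * a ^ 4 * e ^ 2 + 15552 * e ^ 10) : ¬ 3 ∣ a := by
  rintro ⟨a, rfl⟩
  have he3 : ¬ 3 ∣ e := fun h3 ↦ Int.prime_three.not_isUnit (he.isUnit_of_dvd' (dvd_mul_right 3 a) h3)
  obtain ⟨w, rfl⟩ := (Int.pow_dvd_pow_iff (a := 9) (b := w) two_ne_zero).1
    ⟨3 * a ^ 5 + 33 * a ^ 4 * e ^ 2 + 192 * e ^ 10, by linear_combination h⟩
  have h : w ^ 2 = 3 * (a ^ 5 + 11 * a ^ 4 * e ^ 2 + 64 * e ^ 10) := by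
    linarith [h]
  obtain ⟨w, rfl⟩ := Int.prime_three.dvd_of_dvd_pow (Dvd.intro _ h.symm)
  have h : a ^ 5 + 11 * a ^ 4 * e ^ 2 + 64 * e ^ 10 = 3 * w ^ 2 := by linarith [h]
  have key := congrArg (Int.cast : ℤ → ZMod 3) h
  have he0 : (e : ZMod 3) ≠ 0 := by rwa [Ne, ZMod.intCast_zmod_eq_zero_iff_dvd]
  push_cast at key
  generalize (a : ZMod 3) = a, (e : ZMod 3) = e, (w : ZMod 3) = w at key he0
  revert a e w
  decide

theorem odd_of_eq {a e w : ℤ} (he : IsCoprime a e)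
    (h : w ^ 2 = a ^ 5 + 33 * a ^ 4 * e ^ 2 + 15552 * e ^ 10) : Odd a := by
  rw [← Int.not_even_iff_odd, even_iff_two_dvd]
  rintro ⟨b, rfl⟩
  have he2 : Odd e := by
    rw [← Int.not_even_iff_odd, even_iff_two_dvd]
    exact fun h2 ↦ Int.prime_two.not_isUnit (he.isUnit_of_dvd' (dvd_mul_right 2 b) h2)
  obtain ⟨w, rfl⟩ := (Int.pow_dvd_pow_iff (a := 4) (b := w) two_ne_zero).1
    ⟨2 * b ^ 5 + 33 * b ^ 4 * e ^ 2 + 972 * e ^ 10, by linear_combination h⟩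
  have h : w ^ 2 = 2 * b ^ 5 + 33 * b ^ 4 * e ^ 2 + 972 * e ^ 10 := by linarith [h]
  obtain ⟨c, rfl⟩ | hb := (Int.even_or_odd b).imp_left Even.two_dvd
  · obtain ⟨w, rfl⟩ := (Int.pow_dvd_pow_iff (a := 2) (b := w) two_ne_zero).1
      ⟨16 * c ^ 5 + 132 * c ^ 4 * e ^ 2 + 243 * e ^ 10, by linear_combination h⟩
    have h : w ^ 2 = 16 * c ^ 5 + 132 * c ^ 4 * e ^ 2 + 243 * e ^ 10 := by linarith [h]
    obtain ⟨d, rfl⟩ := he2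
    have key := congrArg (Int.cast : ℤ → ZMod 4) h
    push_cast at key
    generalize (c : ZMod 4) = c, (d : ZMod 4) = d, (w : ZMod 4) = w at key
    revert c d w
    decide
  · obtain ⟨d, rfl⟩ := he2
    obtain ⟨b, rfl⟩ := hb
    have key := congrArg (Int.cast : ℤ → ZMod 8) h
    push_cast at key
    generalize (b : ZMod 8) = b, (d : ZMod 8) = d, (w : ZMod 8) = w at key
    revert b d w
    decide

theorem prim_of_coprime {a e : ℤ} (h : IsCoprime a e) (h3 : ¬ 3 ∣ a) (p : ℕ) (hp : p.Prime) :
    ¬ ((p : ℤ) ∣ a ∧ (p : ℤ) ∣ -3 * e ^ 2 ∧ (p : ℤ) ∣ 0) := by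
  rintro ⟨ha, hb, -⟩
  have hp' := Nat.prime_iff_prime_int.1 hp
  rcases hp'.dvd_or_dvd hb with hb | hb
  · have hb : (p : ℤ) ∣ (3 : ℕ) := by simpa using hb
    rw [Int.natCast_dvd_natCast, Nat.prime_dvd_prime_iff_eq hp Nat.prime_three] at hb
    subst hb
    exact h3 ha
  · exact hp'.not_isUnit (h.isUnit_of_dvd' ha (hp'.dvd_of_dvd_pow hb))

end QuinticDescent


open QuinticDescent

theorem no_rational_points_d_three : ¬ ∃ x z : ℚ, x ^ 5 + 11 * x ^ 4 + 64 = 3 * z ^ 2 := by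
  rintro ⟨x, z, h⟩
  obtain ⟨a, e, w, he, hco, hx, hw⟩ := exists_coprime_of_eq h
  have ha := odd_of_eq hco hw
  have hprim := prim_of_coprime hco (not_three_dvd hco hw)
  have hcut := cutsDivisor_of_eval_eq he hx h
  obtain ⟨k, e, hodd, rfl⟩ := WfDvdMonoid.max_power_factor he Int.prime_two.irreducible
  rw [← even_iff_two_dvd, Int.not_even_iff_odd] at hodd
  rcases k with _ | k
  · rw [pow_zero, one_mul] at *
    have key := hcut.mul_mod_eight (l := 1) (x := 1) (y := w) ha hprim
      ((by decide : Odd (-3 : ℤ)).mul hodd.pow) odd_one one_ne_zero (by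
        rw [hw, quadNorm]
        ring)
    obtain ⟨b, rfl⟩ : ∃ b, a = 8 * b + 5 := ⟨a / 8, by omega⟩
    obtain ⟨d, rfl⟩ := hodd
    have key := congrArg (Int.cast : ℤ → ZMod 8) hw
    push_cast at key
    generalize (b : ZMod 8) = b, (d : ZMod 8) = d, (w : ZMod 8) = w at key
    revert b d w
    decide
  · refine not_nearConstant_succ k ⟨hcut, hprim, ha, ⟨-3 * e ^ 2,
      (by decide : Odd (-3 : ℤ)).mul hodd.pow, ?_⟩, 0, by simp⟩
    rw [mul_pow, ← pow_mul, mul_comm _ 2, pow_mul]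
    norm_num
    ring
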